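/- Let φ ∈ C^∞(ℝ^n_y × ℝ^n_ξ) be real-valued with |det ∂_y∂_ξ φ(y,ξ)| ≥ C₀ > 0 for all (y,ξ), and with every entry h of ∂_y∂_ξ φ satisfying |∂_y^α h| ≤ C_α and |∂_ξ^β h| ≤ C_β for all |α|, |β| ≤ 2n+1. Let a : ℝ^n_x × ℝ^n_ξ → ℂ be continuous, and suppose there exist λ > 1/2 and C₁ > 0 such that ‖δ_x^α(h) δ_ξ^β(h') a‖_{L^∞(ℝ^n×ℝ^n)} ≤ C₁ ∏_{i,j=1}^n |h_i|^{α_i λ} |h'_j|^{β_j λ} for all α, β ∈ {0,1}^n and all h, h' ∈ ℝ^n (the case α = β = 0 gives ‖a‖_{L^∞} ≤ C₁). Assume a(x,ξ) = 0 whenever ξ lies outside some compact set K. Then the operator Tu(x) = ∫∫ e^{i(x·ξ + φ(y,ξ))} a(x,ξ) u(y) dy dξ, defined for Schwartz u, satisfies ‖Tu‖_{L²(ℝ^n)} ≤ C ‖u‖_{L²(ℝ^n)}, where C depends only on n, λ, C₁, C₀ and the phase constants, and is independent of K. -/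

import Mathlib

open MeasureTheory Complex SchwartzMap
open scoped BigOperators ENNReal Real RealInnerProductSpace

noncomputable section

/-- The derivative of `g` along the direction `v`. -/
def dLine {W F : Type*} [NormedAddCommGroup W] [NormedSpace ℝ W]
    [NormedAddCommGroup F] [NormedSpace ℝ F] (v : W) (g : W → F) : W → F :=
  fun z => fderiv ℝ g z v

/-- The iterated partial derivative `∂^α` along the coordinate directions `dirs`,
with multiplicities given by the multi-index `α`. -/
def mderiv {n : ℕ} {W F : Type*} [NormedAddCommGroup W] [NormedSpace ℝ W]
    [NormedAddCommGroup F] [NormedSpace ℝ F]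
    (dirs : Fin n → W) (α : Fin n → ℕ) (g : W → F) : W → F :=
  ((List.ofFn fun i => (dLine (dirs i) (F := F))^[α i]).foldr (· ∘ ·) id) g

/-- The length `|α|` of a multi-index. -/
def mdeg {n : ℕ} (α : Fin n → ℕ) : ℕ := ∑ i, α i

/-- The first-factor coordinate directions in `ℝ^n × ℝ^n`. -/
def dX {n : ℕ} (i : Fin n) : EuclideanSpace ℝ (Fin n) × EuclideanSpace ℝ (Fin n) :=
  (EuclideanSpace.single i 1, 0)

/-- The second-factor coordinate directions in `ℝ^n × ℝ^n`. -/
def dY {n : ℕ} (j : Fin n) : EuclideanSpace ℝ (Fin n) × EuclideanSpace ℝ (Fin n) :=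
  (0, EuclideanSpace.single j 1)

/-- The entry `∂²φ/∂u_i∂v_j` of the mixed Hessian of a function of two `ℝ^n` variables. -/
def mixedHessXY {n : ℕ}
    (φ : EuclideanSpace ℝ (Fin n) × EuclideanSpace ℝ (Fin n) → ℝ) (i j : Fin n) :
    EuclideanSpace ℝ (Fin n) × EuclideanSpace ℝ (Fin n) → ℝ :=
  dLine (dX i) (dLine (dY j) φ)

/-- The finite difference of `g` with step `v`. -/
def dDiff {W F : Type*} [NormedAddCommGroup W] [NormedAddCommGroup F]
    (v : W) (g : W → F) : W → F :=
  fun z => g (z + v) - g z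

/-- The iterated finite difference `δ^α(h)` along the directions `dirs` with steps
`h i • dirs i` and multiplicities `α`. -/
def mdiff {n : ℕ} {W F : Type*} [NormedAddCommGroup W] [Module ℝ W] [NormedAddCommGroup F]
    (dirs : Fin n → W) (α : Fin n → ℕ) (h : Fin n → ℝ) (g : W → F) : W → F :=
  ((List.ofFn fun i => (dDiff (h i • dirs i) (F := F))^[α i]).foldr (· ∘ ·) id) g

set_option linter.unusedSectionVars false
namespace CotlarAux

variable {A : Type*} [NormedRing A] [StarRing A] [CStarRing A] {ι : Type*}

/-- alternating words; the boolean tells whether the first letter is starred -/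
def word (t : ι → A) : Bool → List ι → A
  | _, [] => 1
  | true, i :: l => star (t i) * word t false l
  | false, i :: l => t i * word t true l

/-- The pairing bound. -/
def pairB (g : ι → ι → ℝ) (B : ℝ) : List ι → ℝ
  | [] => 1
  | [_] => B
  | i :: j :: l => g i j ^ 2 * pairB g B l

lemma pairB_nonneg (g : ι → ι → ℝ) {B : ℝ} (hB : 0 ≤ B) : ∀ l, 0 ≤ pairB g B l
  | [] => by simp [pairB]
  | [_] => by simpa [pairB]
  | i :: j :: l => by
      have := pairB_nonneg g hB l
      simp only [pairB]; positivity

lemma word_le_pairB [NormOneClass A] (t : ι → A) (g : ι → ι → ℝ) {B : ℝ} (hB : 0 ≤ B)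
    (h0 : ∀ i, ‖t i‖ ≤ B)
    (h1 : ∀ i j, ‖star (t i) * t j‖ ≤ g i j ^ 2) (h2 : ∀ i j, ‖t i * star (t j)‖ ≤ g i j ^ 2) :
    ∀ (b : Bool) (l : List ι), ‖word t b l‖ ≤ pairB g B l
  | _, [] => by simp [pairB, word]
  | true, [i] => by simpa [pairB, word] using h0 i
  | false, [i] => by simpa [pairB, word] using h0 i
  | true, i :: j :: l => by
      have := word_le_pairB t g hB h0 h1 h2 true l
      simp only [word, pairB]
      rw [← mul_assoc]
      refine (norm_mul_le _ _).trans ?_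
      exact mul_le_mul (h1 i j) this (norm_nonneg _) (by positivity)
  | false, i :: j :: l => by
      have := word_le_pairB t g hB h0 h1 h2 false l
      simp only [word, pairB]
      rw [← mul_assoc]
      refine (norm_mul_le _ _).trans ?_
      exact mul_le_mul (h2 i j) this (norm_nonneg _) (by positivity)

/-- The chain product. -/
def chain (g : ι → ι → ℝ) : ι → List ι → ℝ
  | _, [] => 1
  | i, j :: l => g i j * chain g j l

lemma chain_nonneg (g : ι → ι → ℝ) (hg : ∀ i j, 0 ≤ g i j) : ∀ i l, 0 ≤ chain g i l
  | _, [] => by simp [chain]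
  | i, j :: l => mul_nonneg (hg i j) (chain_nonneg g hg j l)

lemma pairB_mul (g : ι → ι → ℝ) (B : ℝ) :
    ∀ i l, pairB g B (i :: l) * pairB g B l = B * chain g i l ^ 2
  | i, [] => by simp [pairB, chain]
  | i, j :: l => by
      have := pairB_mul g B j l
      simp only [chain, pairB]
      rw [mul_pow]
      linear_combination (g i j ^ 2) * this

lemma word_le_chain [NormOneClass A] (t : ι → A) (g : ι → ι → ℝ) {B : ℝ} (hB : 0 ≤ B)
    (hg : ∀ i j, 0 ≤ g i j)
    (h0 : ∀ i, ‖t i‖ ≤ B)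
    (h1 : ∀ i j, ‖star (t i) * t j‖ ≤ g i j ^ 2) (h2 : ∀ i j, ‖t i * star (t j)‖ ≤ g i j ^ 2)
    (b : Bool) (i : ι) (l : List ι) : ‖word t b (i :: l)‖ ≤ B * chain g i l := by
  have e1 := word_le_pairB t g hB h0 h1 h2 b (i :: l)
  have e2 : ‖word t b (i :: l)‖ ≤ B * pairB g B l := by
    cases b
    · simp only [word]
      refine (norm_mul_le _ _).trans ?_
      exact mul_le_mul (h0 i) (word_le_pairB t g hB h0 h1 h2 _ l) (norm_nonneg _) hB
    · simp only [word]
      refine (norm_mul_le _ _).trans ?_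
      rw [norm_star]
      exact mul_le_mul (h0 i) (word_le_pairB t g hB h0 h1 h2 _ l) (norm_nonneg _) hB
  have e3 := pairB_mul g B i l
  have e4 := chain_nonneg g hg i l
  refine le_of_sq_le_sq ?_ (by positivity)
  calc ‖word t b (i :: l)‖ ^ 2 = ‖word t b (i :: l)‖ * ‖word t b (i :: l)‖ := sq _
    _ ≤ pairB g B (i :: l) * (B * pairB g B l) :=
        mul_le_mul e1 e2 (norm_nonneg _) (pairB_nonneg g hB _)
    _ = (B * chain g i l) ^ 2 := by rw [mul_pow]; linear_combination B * e3

/-- Finset of words of length `r`. -/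
def wsum (s : Finset ι) (F : List ι → A) : ℕ → A
  | 0 => F []
  | r + 1 => ∑ i ∈ s, wsum s (fun l => F (i :: l)) r


lemma wsum_mul_left (s : Finset ι) (c : A) : ∀ (r : ℕ) (F : List ι → A),
    wsum s (fun l => c * F l) r = c * wsum s F r
  | 0, F => rfl
  | r + 1, F => by
      simp only [wsum, Finset.mul_sum]
      exact Finset.sum_congr rfl fun i _ => wsum_mul_left s c r _

lemma wsum_norm_le (s : Finset ι) (g : ι → ι → ℝ) (hg : ∀ i j, 0 ≤ g i j) {Λ : ℝ}
    (hΛ : ∀ i, ∑ j ∈ s, g i j ≤ Λ) (hΛ0 : 0 ≤ Λ) : ∀ (r : ℕ) (F : List ι → A) (M : ℝ) (i : ι),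
    0 ≤ M → (∀ l, ‖F l‖ ≤ M * chain g i l) → ‖wsum s F r‖ ≤ M * Λ ^ r
  | 0, F, M, i, hM, h => by simpa [wsum, chain] using h []
  | r + 1, F, M, i, hM, h => by
      simp only [wsum]
      refine (norm_sum_le _ _).trans ?_
      calc ∑ j ∈ s, ‖wsum s (fun l => F (j :: l)) r‖ ≤ ∑ j ∈ s, (M * g i j) * Λ ^ r := by
            refine Finset.sum_le_sum fun j _ => ?_
            refine wsum_norm_le s g hg hΛ hΛ0 r _ (M * g i j) j (mul_nonneg hM (hg i j)) ?_
            intro l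
            refine (h _).trans (le_of_eq ?_)
            simp only [chain]; ring
        _ = (M * Λ ^ r) * ∑ j ∈ s, g i j := by
            rw [Finset.mul_sum]; exact Finset.sum_congr rfl fun _ _ => by ring
        _ ≤ (M * Λ ^ r) * Λ := by gcongr; exact hΛ i
        _ = _ := by ring

lemma wsum_word (s : Finset ι) (t : ι → A) : ∀ (m : ℕ),
    wsum s (word t true) (2 * m) = (star (∑ i ∈ s, t i) * ∑ i ∈ s, t i) ^ m
  | 0 => by simp [wsum, word]
  | m + 1 => by
      rw [pow_succ', ← wsum_word s t m, show 2 * (m + 1) = (2 * m + 1) + 1 by ring]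
      simp only [wsum, word, wsum_mul_left, star_sum]
      rw [mul_assoc, Finset.sum_mul, Finset.sum_mul]
      exact Finset.sum_congr rfl fun i _ => (Finset.mul_sum ..).symm

/-- Cotlar and Stein lemma in a star algebra. -/
theorem cotlar [NormOneClass A] (s : Finset ι) (t : ι → A) (g : ι → ι → ℝ)
    (hg : ∀ i j, 0 ≤ g i j)
    (h1 : ∀ i j, ‖star (t i) * t j‖ ≤ g i j ^ 2) (h2 : ∀ i j, ‖t i * star (t j)‖ ≤ g i j ^ 2)
    {Λ : ℝ} (hΛ : ∀ i, ∑ j ∈ s, g i j ≤ Λ) (hΛ0 : 0 ≤ Λ) {B : ℝ} (hB : ∀ i, ‖t i‖ ≤ B) :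
    ‖∑ i ∈ s, t i‖ ≤ Λ := by
  rcases s.eq_empty_or_nonempty with rfl | ⟨i0, -⟩
  · simpa
  have hB0 : 0 ≤ B := (norm_nonneg _).trans (hB i0)
  set S := ∑ i ∈ s, t i with hS
  have key : ∀ k : ℕ, ‖S‖ ^ (2 * 2 ^ k) * Λ ≤ s.card * B * Λ ^ (2 * 2 ^ k) := by
    intro k
    have hsa : IsSelfAdjoint (star S * S) := IsSelfAdjoint.star_mul_self S
    have e1 : ‖(star S * S) ^ (2 ^ k)‖ = ‖S‖ ^ (2 * 2 ^ k) := by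
      have := hsa.nnnorm_pow_two_pow k
      have h3 : ‖(star S * S) ^ (2 ^ k)‖ = ‖star S * S‖ ^ (2 ^ k) := by
        simpa using congrArg NNReal.toReal this
      rw [h3, CStarRing.norm_star_mul_self, pow_mul, sq]
    have e2 := wsum_word s t (2 ^ k)
    rw [← hS] at e2
    obtain ⟨m, hm⟩ : ∃ m, 2 * 2 ^ k = m + 1 := ⟨2 * 2 ^ k - 1, by
      have : 0 < 2 ^ k := by positivity
      omega⟩
    rw [← e1, ← e2, hm]
    have : ‖wsum s (word t true) (m + 1)‖ ≤ s.card * B * Λ ^ m := by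
      simp only [wsum]
      refine (norm_sum_le _ _).trans ?_
      calc _ ≤ ∑ j ∈ s, B * Λ ^ m := by
            refine Finset.sum_le_sum fun j _ => ?_
            exact wsum_norm_le s g hg hΛ hΛ0 m _ B j hB0
              (fun l => word_le_chain t g hB0 hg hB h1 h2 true j l)
        _ = _ := by simp; ring
    calc _ ≤ (s.card * B * Λ ^ m) * Λ := by gcongr
      _ = _ := by ring
  by_contra hlt
  push Not at hlt
  rcases hΛ0.eq_or_lt with h0 | hpos
  · -- Λ = 0 : perturb
    have hz : ∀ i ∈ s, ∀ j ∈ s, g i j = 0 := by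
      intro i hi j hj
      have h3 := hΛ i
      rw [← h0] at h3
      have h4 := Finset.single_le_sum (f := fun j => g i j) (fun j _ => hg i j) hj
      exact le_antisymm (h4.trans h3) (hg i j)
    have : S = 0 := by
      refine Finset.sum_eq_zero fun i hi => ?_
      have h5 := h1 i i
      rw [hz i hi i hi, CStarRing.norm_star_mul_self] at h5
      have : ‖t i‖ = 0 := by nlinarith [norm_nonneg (t i)]
      exact norm_eq_zero.mp this
    rw [this, norm_zero] at hlt
    linarith
  · set q := ‖S‖ / Λ with hq
    have hq1 : 1 < q := by rw [hq, lt_div_iff₀ hpos]; linarith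
    have hb : ∀ k : ℕ, q ^ (2 * 2 ^ k) * Λ ≤ s.card * B := by
      intro k
      have := key k
      rw [hq, div_pow]
      have hp : 0 < Λ ^ (2 * 2 ^ k) := by positivity
      rw [div_mul_eq_mul_div, div_le_iff₀ hp]
      exact this
    have ht : Filter.Tendsto (fun m : ℕ => q ^ m) Filter.atTop Filter.atTop :=
      tendsto_pow_atTop_atTop_of_one_lt hq1
    obtain ⟨m, hm⟩ := (ht.eventually_gt_atTop (s.card * B / Λ)).exists
    have h6 : q ^ m ≤ q ^ (2 * 2 ^ m) := by
      apply pow_le_pow_right₀ hq1.le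
      have := Nat.lt_two_pow_self (n := m)
      omega
    have h7 := hb m
    rw [div_lt_iff₀ hpos] at hm
    nlinarith

end CotlarAux

/-- shorthand for the Euclidean space -/
abbrev EE (n : ℕ) := EuclideanSpace ℝ (Fin n)

/-- shorthand for the Hilbert space `L²` -/
abbrev HH (n : ℕ) := Lp ℂ 2 (volume : Measure (EE n))

/-- Continuous compactly supported kernels. -/
structure Ker (n : ℕ) where
  k : EE n → EE n → ℂ
  P : Set (EE n)
  Q : Set (EE n)
  hP : IsCompact P
  hQ : IsCompact Q
  cont : Continuous (fun z : EE n × EE n => k z.1 z.2)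
  supp : ∀ ξ y, ¬ (ξ ∈ P ∧ y ∈ Q) → k ξ y = 0

namespace Ker
variable {n : ℕ}

/-- adjoint kernel -/
def adj (κ : Ker n) : Ker n where
  k := fun y ξ => (starRingEnd ℂ) (κ.k ξ y)
  P := κ.Q
  Q := κ.P
  hP := κ.hQ
  hQ := κ.hP
  cont := by
    have := κ.cont.comp (continuous_swap (X := EE n) (Y := EE n))
    exact Complex.continuous_conj.comp this
  supp := fun y ξ h => by
    rw [κ.supp ξ y (fun h' => h ⟨h'.2, h'.1⟩), map_zero]

lemma exists_bound (κ : Ker n) : ∃ M : ℝ, 0 ≤ M ∧ ∀ ξ y, ‖κ.k ξ y‖ ≤ M := by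
  have : HasCompactSupport (fun z : EE n × EE n => κ.k z.1 z.2) := by
    refine HasCompactSupport.intro (κ.hP.prod κ.hQ) ?_
    rintro ⟨ξ, y⟩ h
    exact κ.supp ξ y (fun h' => h h')
  obtain ⟨M, hM⟩ := this.exists_bound_of_continuous κ.cont
  exact ⟨M, (norm_nonneg _).trans (hM (0, 0)), fun ξ y => hM (ξ, y)⟩

/-- the function `ξ ↦ ∫ k(ξ,y) u(y) dy` -/
def app (κ : Ker n) (u : EE n → ℂ) (ξ : EE n) : ℂ := ∫ y, κ.k ξ y * u y

lemma bound_ind {κ : Ker n} {M : ℝ} (hM : ∀ ξ y, ‖κ.k ξ y‖ ≤ M) (u : EE n → ℂ) (ξ y : EE n) :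
    ‖κ.k ξ y * u y‖ ≤ M * κ.Q.indicator (fun y => ‖u y‖) y := by
  by_cases h : y ∈ κ.Q
  · rw [Set.indicator_of_mem h, norm_mul]
    exact mul_le_mul_of_nonneg_right (hM _ _) (norm_nonneg _)
  · rw [κ.supp ξ y (fun h' => h h'.2), Set.indicator_of_notMem h]; simp

lemma integrable_ind (κ : Ker n) {u : EE n → ℂ} (hu : MemLp u 2 volume) :
    Integrable (κ.Q.indicator (fun y => ‖u y‖)) volume := by
  rw [integrable_indicator_iff κ.hQ.measurableSet]
  have : IsFiniteMeasure ((volume : Measure (EE n)).restrict κ.Q) :=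
    ⟨by simpa using κ.hQ.measure_lt_top⟩
  exact ((hu.restrict κ.Q).integrable (by norm_num)).norm

lemma meas_k (κ : Ker n) (ξ : EE n) : Continuous (fun y => κ.k ξ y) :=
  κ.cont.comp (by fun_prop : Continuous fun y : EE n => (ξ, y))

lemma integrable_app (κ : Ker n) {u : EE n → ℂ} (hu : MemLp u 2 volume) (ξ : EE n) :
    Integrable (fun y => κ.k ξ y * u y) volume := by
  obtain ⟨M, hM0, hM⟩ := κ.exists_bound
  refine Integrable.mono' ((κ.integrable_ind hu).const_mul M) ?_ ?_
  · exact (κ.meas_k ξ).aestronglyMeasurable.mul hu.1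
  · exact Filter.Eventually.of_forall fun y => bound_ind hM u ξ y

lemma continuous_app (κ : Ker n) {u : EE n → ℂ} (hu : MemLp u 2 volume) :
    Continuous (κ.app u) := by
  obtain ⟨M, hM0, hM⟩ := κ.exists_bound
  refine continuous_of_dominated (bound := fun y => M * κ.Q.indicator (fun y => ‖u y‖) y)
    (fun ξ => (κ.integrable_app hu ξ).1) ?_ ((κ.integrable_ind hu).const_mul M) ?_
  · exact fun ξ => Filter.Eventually.of_forall fun y => bound_ind hM u ξ y
  · refine Filter.Eventually.of_forall fun y => ?_
    have : Continuous (fun ξ => κ.k ξ y) :=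
      κ.cont.comp (by fun_prop : Continuous fun ξ : EE n => (ξ, y))
    fun_prop

lemma app_supp (κ : Ker n) (u : EE n → ℂ) {ξ : EE n} (h : ξ ∉ κ.P) : κ.app u ξ = 0 := by
  unfold app
  rw [integral_eq_zero_of_ae]
  exact Filter.Eventually.of_forall fun y => by
    simp [κ.supp ξ y (fun h' => h h'.1)]

lemma memLp_app (κ : Ker n) {u : EE n → ℂ} (hu : MemLp u 2 volume) :
    MemLp (κ.app u) 2 volume :=
  (κ.continuous_app hu).memLp_of_hasCompactSupport
    (HasCompactSupport.intro κ.hP fun _ h => κ.app_supp u h)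

lemma l1_le (Q : Set (EE n)) (hQ : IsCompact Q) {u : EE n → ℂ} (hu : MemLp u 2 volume) :
    ∫ y, Q.indicator (fun y => ‖u y‖) y ≤
      Real.sqrt (volume.real Q) * (eLpNorm u 2 volume).toReal := by
  rw [integral_indicator hQ.measurableSet]
  have hf : IsFiniteMeasure ((volume : Measure (EE n)).restrict Q) :=
    ⟨by simpa using hQ.measure_lt_top⟩
  have h1 := eLpNorm_le_eLpNorm_mul_rpow_measure_univ (μ := volume.restrict Q) (p := 1) (q := 2)
    (f := u) (by norm_num) hu.1.restrict
  have h2 : ∫ y in Q, ‖u y‖ = (eLpNorm u 1 (volume.restrict Q)).toReal := by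
    rw [eLpNorm_one_eq_lintegral_enorm, integral_norm_eq_lintegral_enorm hu.1.restrict]
  rw [h2]
  have h3 : eLpNorm u 2 (volume.restrict Q) ≤ eLpNorm u 2 volume :=
    eLpNorm_restrict_le u 2 volume Q
  have h4 : eLpNorm u 1 (volume.restrict Q) ≤ eLpNorm u 2 volume * (volume Q) ^ (1 / 2 : ℝ) := by
    refine h1.trans ?_
    refine mul_le_mul' h3 ?_
    simp only [Measure.restrict_apply_univ]
    refine le_of_eq ?_
    congr 1
    norm_num
  have h5 : eLpNorm u 2 volume * (volume Q) ^ (1 / 2 : ℝ) ≠ ⊤ :=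
    ENNReal.mul_ne_top hu.2.ne (ENNReal.rpow_ne_top_of_nonneg (by norm_num) hQ.measure_lt_top.ne)
  refine (ENNReal.toReal_mono h5 h4).trans (le_of_eq ?_)
  rw [ENNReal.toReal_mul, mul_comm, ← ENNReal.toReal_rpow, Real.sqrt_eq_rpow]
  rfl

lemma app_norm_le (κ : Ker n) {M : ℝ} (hM : ∀ ξ y, ‖κ.k ξ y‖ ≤ M) {u : EE n → ℂ}
    (hu : MemLp u 2 volume) (ξ : EE n) :
    ‖κ.app u ξ‖ ≤ M * (Real.sqrt (volume.real κ.Q) * (eLpNorm u 2 volume).toReal) := by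
  have hM0 : 0 ≤ M := (norm_nonneg _).trans (hM 0 0)
  refine (norm_integral_le_of_norm_le ((κ.integrable_ind hu).const_mul M)
    (Filter.Eventually.of_forall fun y => bound_ind hM u ξ y)).trans ?_
  rw [integral_const_mul]
  exact mul_le_mul_of_nonneg_left (l1_le κ.Q κ.hQ hu) hM0

/-- the operator on `L²` -/
def op (κ : Ker n) : HH n →L[ℂ] HH n :=
  LinearMap.mkContinuousOfExistsBound
    { toFun := fun u => (κ.memLp_app (Lp.memLp u)).toLp _
      map_add' := fun u v => by
        rw [← MemLp.toLp_add]
        refine MemLp.toLp_congr _ _ (Filter.Eventually.of_forall fun ξ => ?_)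
        simp only [app, Pi.add_apply]
        rw [← integral_add (κ.integrable_app (Lp.memLp u) ξ) (κ.integrable_app (Lp.memLp v) ξ)]
        refine integral_congr_ae ?_
        filter_upwards [Lp.coeFn_add u v] with y hy
        rw [hy, Pi.add_apply, mul_add]
      map_smul' := fun c u => by
        rw [RingHom.id_apply, ← MemLp.toLp_const_smul]
        refine MemLp.toLp_congr _ _ (Filter.Eventually.of_forall fun ξ => ?_)
        simp only [app, Pi.smul_apply, smul_eq_mul]
        rw [← integral_const_mul]
        refine integral_congr_ae ?_
        filter_upwards [Lp.coeFn_smul c u] with y hy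
        rw [hy, Pi.smul_apply, smul_eq_mul]; ring }
    (by
      obtain ⟨M, hM0, hM⟩ := κ.exists_bound
      refine ⟨M * Real.sqrt (volume.real κ.Q) * Real.sqrt (volume.real κ.P), fun u => ?_⟩
      simp only [LinearMap.coe_mk, AddHom.coe_mk]
      rw [Lp.norm_toLp]
      set c := M * (Real.sqrt (volume.real κ.Q) * (eLpNorm u 2 volume).toReal) with hc
      have hc0 : 0 ≤ c := by positivity
      have h1 : eLpNorm (κ.app u) 2 volume = eLpNorm (κ.app u) 2 (volume.restrict κ.P) := by
        rw [← eLpNorm_indicator_eq_eLpNorm_restrict κ.hP.measurableSet]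
        congr 1
        funext ξ
        by_cases h : ξ ∈ κ.P
        · rw [Set.indicator_of_mem h]
        · rw [Set.indicator_of_notMem h, κ.app_supp _ h]
      have h2 : eLpNorm (κ.app u) 2 (volume.restrict κ.P) ≤
          (volume.restrict κ.P) Set.univ ^ ((2 : ℝ≥0∞).toReal⁻¹) * ENNReal.ofReal c :=
        eLpNorm_le_of_ae_bound (Filter.Eventually.of_forall fun ξ => κ.app_norm_le hM (Lp.memLp u) ξ)
      rw [h1]
      have h5 : (volume.restrict κ.P) Set.univ ^ ((2 : ℝ≥0∞).toReal⁻¹) * ENNReal.ofReal c ≠ ⊤ := by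
        refine ENNReal.mul_ne_top (ENNReal.rpow_ne_top_of_nonneg (by norm_num) ?_) ENNReal.ofReal_ne_top
        simpa using κ.hP.measure_lt_top.ne
      refine (ENNReal.toReal_mono h5 h2).trans (le_of_eq ?_)
      rw [ENNReal.toReal_mul, ENNReal.toReal_ofReal hc0, ← ENNReal.toReal_rpow,
        Measure.restrict_apply_univ, hc, Real.sqrt_eq_rpow (volume.real κ.P), Lp.norm_def]
      have : ((2 : ℝ≥0∞).toReal⁻¹) = 1 / 2 := by norm_num
      rw [this]
      simp only [Measure.real]
      ring)

lemma op_coe (κ : Ker n) (u : HH n) : (κ.op u : EE n → ℂ) =ᵐ[volume] κ.app u :=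
  (κ.memLp_app (Lp.memLp u)).coeFn_toLp

lemma inner_app (κ' κ : Ker n) {f g : EE n → ℂ} (hf : MemLp f 2 volume) (hg : MemLp g 2 volume) :
    ∫ ξ, (starRingEnd ℂ) (κ'.app f ξ) * κ.app g ξ =
      ∫ z : EE n × EE n, ((starRingEnd ℂ) (f z.1) * g z.2) *
        ∫ ξ, (starRingEnd ℂ) (κ'.k ξ z.1) * κ.k ξ z.2 := by
  obtain ⟨M, hM0, hM⟩ := κ.exists_bound
  obtain ⟨M', hM0', hM'⟩ := κ'.exists_bound
  have e1 : ∀ ξ, (starRingEnd ℂ) (κ'.app f ξ) * κ.app g ξ =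
      ∫ z : EE n × EE n, (starRingEnd ℂ) (κ'.k ξ z.1 * f z.1) * (κ.k ξ z.2 * g z.2) := by
    intro ξ
    simp only [app]
    rw [← integral_conj, ← integral_prod_mul]
    rfl
  simp_rw [e1]
  rw [integral_integral_swap]
  · refine integral_congr_ae (Filter.Eventually.of_forall fun z => ?_)
    simp only []
    rw [← integral_const_mul]
    refine integral_congr_ae (Filter.Eventually.of_forall fun ξ => ?_)
    simp only [map_mul]
    ring
  · have hb : Integrable (fun w : EE n × (EE n × EE n) => (κ.P.indicator (fun _ => (1 : ℝ)) w.1) *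
        ((M' * κ'.Q.indicator (fun y => ‖f y‖) w.2.1) *
          (M * κ.Q.indicator (fun y => ‖g y‖) w.2.2))) (volume.prod volume) := by
      refine Integrable.mul_prod (f := κ.P.indicator (fun _ => (1 : ℝ)))
        (g := fun z : EE n × EE n => (M' * κ'.Q.indicator (fun y => ‖f y‖) z.1) *
          (M * κ.Q.indicator (fun y => ‖g y‖) z.2)) ?_ ?_
      · rw [integrable_indicator_iff κ.hP.measurableSet]
        exact integrableOn_const κ.hP.measure_lt_top.ne
      · exact Integrable.mul_prod ((κ'.integrable_ind hf).const_mul M')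
          ((κ.integrable_ind hg).const_mul M)
    refine Integrable.mono' hb ?_ ?_
    · have hk1 : Continuous fun w : EE n × (EE n × EE n) => κ'.k w.1 w.2.1 :=
        κ'.cont.comp (by fun_prop : Continuous fun w : EE n × (EE n × EE n) => (w.1, w.2.1))
      have hk2 : Continuous fun w : EE n × (EE n × EE n) => κ.k w.1 w.2.2 :=
        κ.cont.comp (by fun_prop : Continuous fun w : EE n × (EE n × EE n) => (w.1, w.2.2))
      have hf1 : AEStronglyMeasurable (fun w : EE n × (EE n × EE n) => f w.2.1)
          (volume.prod (volume.prod volume)) := hf.1.comp_fst.comp_snd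
      have hg1 : AEStronglyMeasurable (fun w : EE n × (EE n × EE n) => g w.2.2)
          (volume.prod (volume.prod volume)) := hg.1.comp_snd.comp_snd
      have h3 := (Complex.continuous_conj.comp_aestronglyMeasurable
        (hk1.aestronglyMeasurable.mul hf1)).mul (hk2.aestronglyMeasurable.mul hg1)
      exact h3
    · refine Filter.Eventually.of_forall fun w => ?_
      obtain ⟨ξ, y', y⟩ := w
      simp only [Function.uncurry_apply_pair, norm_mul, RCLike.norm_conj]
      rw [← norm_mul, ← norm_mul]
      by_cases h : ξ ∈ κ.P
      · rw [Set.indicator_of_mem h, one_mul]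
        refine mul_le_mul (bound_ind hM' f ξ y') (bound_ind hM g ξ y) (norm_nonneg _) ?_
        exact mul_nonneg hM0' (Set.indicator_nonneg (fun _ _ => norm_nonneg _) _)
      · rw [Set.indicator_of_notMem h, κ.supp ξ y (fun h' => h h'.1)]; simp

lemma norm_star_mul_le (κ' κ : Ker n) {M V : ℝ} 
    (hV : volume.real κ.Q ≤ V) (hV' : volume.real κ'.Q ≤ V)
    (h : ∀ y' y, ‖∫ ξ, (starRingEnd ℂ) (κ'.k ξ y') * κ.k ξ y‖ ≤ M) :
    ‖star κ'.op * κ.op‖ ≤ M * V := by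
  have hV0 : 0 ≤ V := measureReal_nonneg.trans hV
  have hM0 : 0 ≤ M := (norm_nonneg _).trans (h 0 0)
  have key : ∀ u w : HH n, ‖inner ℂ (κ'.op w) (κ.op u)‖ ≤ M * V * (‖w‖ * ‖u‖) := by
    intro u w
    rw [L2.inner_def]
    have e1 : ∫ ξ, inner ℂ ((κ'.op w : EE n → ℂ) ξ) ((κ.op u : EE n → ℂ) ξ) =
        ∫ ξ, (starRingEnd ℂ) (κ'.app w ξ) * κ.app u ξ := by
      refine integral_congr_ae ?_
      filter_upwards [κ'.op_coe w, κ.op_coe u] with ξ h1 h2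
      rw [h1, h2, RCLike.inner_apply, mul_comm]
    rw [e1, inner_app κ' κ (Lp.memLp w) (Lp.memLp u)]
    have hI : Integrable (fun z : EE n × EE n => M * ((κ'.Q.indicator (fun y => ‖w y‖) z.1) *
          (κ.Q.indicator (fun y => ‖u y‖) z.2))) (volume.prod volume) :=
      ((κ'.integrable_ind (Lp.memLp w)).mul_prod (κ.integrable_ind (Lp.memLp u))).const_mul M
    refine (norm_integral_le_of_norm_le hI (Filter.Eventually.of_forall fun z => ?_)).trans ?_
    · obtain ⟨y', y⟩ := z
      simp only []
      by_cases h1 : y' ∈ κ'.Q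
      · by_cases h2 : y ∈ κ.Q
        · rw [Set.indicator_of_mem h1, Set.indicator_of_mem h2, norm_mul, norm_mul, mul_comm,
            RCLike.norm_conj]
          exact mul_le_mul_of_nonneg_right (h y' y) (by positivity)
        · have : ∀ ξ, κ.k ξ y = 0 := fun ξ => κ.supp ξ y (fun h' => h2 h'.2)
          simp [this, Set.indicator_of_notMem h2]
      · have : ∀ ξ, κ'.k ξ y' = 0 := fun ξ => κ'.supp ξ y' (fun h' => h1 h'.2)
        simp [this, Set.indicator_of_notMem h1]
    · rw [integral_const_mul, integral_prod_mul]
      have a1 := l1_le κ'.Q κ'.hQ (Lp.memLp w)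
      have a2 := l1_le κ.Q κ.hQ (Lp.memLp u)
      rw [← Lp.norm_def] at a1 a2
      have b1 : Real.sqrt (volume.real κ'.Q) ≤ Real.sqrt V := Real.sqrt_le_sqrt hV'
      have b2 : Real.sqrt (volume.real κ.Q) ≤ Real.sqrt V := Real.sqrt_le_sqrt hV
      calc _ ≤ M * ((Real.sqrt V * ‖w‖) * (Real.sqrt V * ‖u‖)) := by
            refine mul_le_mul_of_nonneg_left ?_ hM0
            refine mul_le_mul (a1.trans (by gcongr)) (a2.trans (by gcongr)) ?_ (by positivity)
            exact integral_nonneg fun y => Set.indicator_nonneg (fun _ _ => norm_nonneg _) _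
        _ = M * (Real.sqrt V * Real.sqrt V) * (‖w‖ * ‖u‖) := by ring
        _ = _ := by rw [Real.mul_self_sqrt hV0]
  refine ContinuousLinearMap.opNorm_le_bound _ (by positivity) fun u => ?_
  set w := (star κ'.op * κ.op) u with hw
  have h2 := key u w
  have h3 : inner ℂ (κ'.op w) (κ.op u) = inner ℂ w w := by
    rw [hw, ContinuousLinearMap.star_eq_adjoint]
    rw [← ContinuousLinearMap.adjoint_inner_right]
    rfl
  rw [h3, inner_self_eq_norm_sq_to_K, norm_pow, RCLike.norm_ofReal, abs_of_nonneg (norm_nonneg _)] at h2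
  by_cases h0 : ‖w‖ = 0
  · rw [h0]; positivity
  · have : 0 < ‖w‖ := lt_of_le_of_ne (norm_nonneg _) (Ne.symm h0)
    nlinarith

lemma app_adj (κ : Ker n) {f g : EE n → ℂ} (hf : MemLp f 2 volume) (hg : MemLp g 2 volume) :
    ∫ ξ, (starRingEnd ℂ) (κ.app f ξ) * g ξ = ∫ y, (starRingEnd ℂ) (f y) * κ.adj.app g y := by
  obtain ⟨M, hM0, hM⟩ := κ.exists_bound
  have e1 : ∀ ξ, (starRingEnd ℂ) (κ.app f ξ) * g ξ =
      ∫ y, (starRingEnd ℂ) (κ.k ξ y * f y) * g ξ := by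
    intro ξ
    simp only [app]
    rw [← integral_conj, integral_mul_const]
  simp_rw [e1]
  rw [integral_integral_swap]
  · refine integral_congr_ae (Filter.Eventually.of_forall fun y => ?_)
    simp only [app, adj]
    rw [← integral_const_mul]
    refine integral_congr_ae (Filter.Eventually.of_forall fun ξ => ?_)
    simp only [map_mul]
    ring
  · have hb : Integrable (fun w : EE n × EE n => (κ.P.indicator (fun ξ => ‖g ξ‖) w.1) *
        ((M * κ.Q.indicator (fun y => ‖f y‖) w.2))) (volume.prod volume) := 
      Integrable.mul_prod (κ.adj.integrable_ind hg) ((κ.integrable_ind hf).const_mul M)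
    refine Integrable.mono' hb ?_ ?_
    · exact (Complex.continuous_conj.comp_aestronglyMeasurable
        (κ.cont.aestronglyMeasurable.mul hf.1.comp_snd)).mul hg.1.comp_fst
    · refine Filter.Eventually.of_forall fun w => ?_
      obtain ⟨ξ, y⟩ := w
      simp only [Function.uncurry_apply_pair]
      rw [norm_mul, RCLike.norm_conj, mul_comm]
      by_cases h : ξ ∈ κ.P
      · rw [Set.indicator_of_mem h]
        exact mul_le_mul_of_nonneg_left (bound_ind hM f ξ y) (norm_nonneg _)
      · rw [Set.indicator_of_notMem h, κ.supp ξ y (fun h' => h h'.1)]; simp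

lemma star_op (κ : Ker n) : star κ.op = κ.adj.op := by
  rw [ContinuousLinearMap.star_eq_adjoint]
  symm
  rw [ContinuousLinearMap.eq_adjoint_iff]
  intro g f
  rw [← inner_conj_symm, L2.inner_def, L2.inner_def, ← integral_conj]
  have e1 : ∫ ξ, inner ℂ ((g : EE n → ℂ) ξ) ((κ.op f : EE n → ℂ) ξ) =
      ∫ ξ, (starRingEnd ℂ) ((starRingEnd ℂ) (κ.app f ξ) * g ξ) := by
    refine integral_congr_ae ?_
    filter_upwards [κ.op_coe f] with ξ h1
    rw [h1, RCLike.inner_apply, map_mul, Complex.conj_conj]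
  have e2 : ∫ y, (starRingEnd ℂ) (inner ℂ ((f : EE n → ℂ) y) ((κ.adj.op g : EE n → ℂ) y)) =
      ∫ y, (starRingEnd ℂ) ((starRingEnd ℂ) (f y) * κ.adj.app g y) := by
    refine integral_congr_ae ?_
    filter_upwards [κ.adj.op_coe g] with y h1
    rw [h1, RCLike.inner_apply, mul_comm]
  rw [e1, e2, integral_conj, integral_conj, app_adj κ (Lp.memLp f) (Lp.memLp g)]

lemma norm_mul_star_le (κ κ' : Ker n) {M V : ℝ} 
    (hV : volume.real κ.P ≤ V) (hV' : volume.real κ'.P ≤ V)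
    (h : ∀ ξ ξ', ‖∫ y, κ.k ξ y * (starRingEnd ℂ) (κ'.k ξ' y)‖ ≤ M) :
    ‖κ.op * star κ'.op‖ ≤ M * V := by
  have : κ.op = star κ.adj.op := by rw [← star_op, star_star]
  rw [this, star_op κ']
  refine norm_star_mul_le κ.adj κ'.adj hV' hV fun y' y => ?_
  simpa [adj] using h y' y

end Ker

namespace Hadamard
variable {E : Type*} [NormedAddCommGroup E] [NormedSpace ℝ E] [CompleteSpace E]

lemma lift_path {f : E → E} (hf : ContDiff ℝ 1 f) (Ai : E → (E →L[ℝ] E)) {B K : ℝ}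
    (hr : ∀ y, (fderiv ℝ f y).comp (Ai y) = ContinuousLinearMap.id ℝ E)
    (hB : ∀ y, ‖Ai y‖ ≤ B) (hK0 : 0 ≤ K) (hK : ∀ y y', ‖Ai y - Ai y'‖ ≤ K * ‖y - y'‖)
    (y0 w : E) : ∃ α : ℝ → E, α 0 = y0 ∧
      (∀ t ∈ Set.Icc (0:ℝ) 1, HasDerivWithinAt α (Ai (α t) w) (Set.Icc 0 1) t) ∧
      f (α 1) = f y0 + w ∧ ‖α 1 - y0‖ ≤ B * ‖w‖ := by
  have hB0 : 0 ≤ B := (norm_nonneg _).trans (hB y0)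
  have hlip : LipschitzWith (K.toNNReal * ‖w‖₊) (fun y => Ai y w) := by
    apply LipschitzWith.of_dist_le_mul
    intro y y'
    rw [dist_eq_norm, dist_eq_norm, ← sub_apply]
    refine ((Ai y - Ai y').le_opNorm w).trans ?_
    have := mul_le_mul_of_nonneg_right (hK y y') (norm_nonneg w)
    simp only [NNReal.coe_mul, Real.coe_toNNReal _ hK0, coe_nnnorm]
    linarith
  have hbd : ∀ y, ‖Ai y w‖ ≤ B * ‖w‖ := fun y =>
    ((Ai y).le_opNorm w).trans (mul_le_mul_of_nonneg_right (hB y) (norm_nonneg _))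
  have hPL : IsPicardLindelof (fun _ : ℝ => fun y => Ai y w) (tmin := 0) (tmax := 1)
      ⟨0, by simp⟩ y0 (B * ‖w‖).toNNReal 0 (B * ‖w‖).toNNReal (K.toNNReal * ‖w‖₊) := by
    apply IsPicardLindelof.of_time_independent
    · intro x _
      rw [Real.coe_toNNReal _ (by positivity)]
      exact hbd x
    · exact hlip.lipschitzOnWith
    · simp
  obtain ⟨α, h0, hα⟩ := hPL.exists_eq_forall_mem_Icc_hasDerivWithinAt₀
  simp only at h0 hα
  refine ⟨α, h0, hα, ?_, ?_⟩
  · have hd : ∀ t ∈ Set.Icc (0:ℝ) 1, HasDerivWithinAt (fun t => f (α t) - t • w) 0 (Set.Icc 0 1) t := by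
      intro t ht
      have h1 : HasFDerivAt f (fderiv ℝ f (α t)) (α t) :=
        (hf.differentiable (by norm_num) (α t)).hasFDerivAt
      have h2 := h1.comp_hasDerivWithinAt t (hα t ht)
      have h3 : (fderiv ℝ f (α t)) (Ai (α t) w) = w := by
        have := congrArg (fun L : E →L[ℝ] E => L w) (hr (α t))
        simpa using this
      rw [h3] at h2
      have h4 := h2.sub ((hasDerivAt_id t).smul_const w).hasDerivWithinAt
      simp only [one_smul, sub_self] at h4
      exact h4
    have hc := (convex_Icc (0:ℝ) 1).norm_image_sub_le_of_norm_hasDerivWithin_le (C := 0) hd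
      (by simp) (x := 0) (y := 1) (by simp) (by simp)
    simp only [zero_mul, norm_le_zero_iff, h0, one_smul, zero_smul, sub_zero] at hc
    rw [sub_sub, sub_eq_zero] at hc
    rw [hc, add_comm]
  · have hc := (convex_Icc (0:ℝ) 1).norm_image_sub_le_of_norm_hasDerivWithin_le (C := B * ‖w‖) hα
      (fun t _ => hbd _) (x := 0) (y := 1) (by simp) (by simp)
    simpa [h0] using hc

lemma loc_inj {f : E → E} (hf : ContDiff ℝ 1 f) (Ai : E → (E →L[ℝ] E))
    (hl : ∀ y, (Ai y).comp (fderiv ℝ f y) = ContinuousLinearMap.id ℝ E)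
    (hr : ∀ y, (fderiv ℝ f y).comp (Ai y) = ContinuousLinearMap.id ℝ E) (y : E) :
    ∃ s, y ∈ s ∧ IsOpen s ∧ Set.InjOn f s := by
  let e : E ≃L[ℝ] E := ContinuousLinearEquiv.equivOfInverse (fderiv ℝ f y) (Ai y)
    (fun x => by simpa using congrArg (fun L : E →L[ℝ] E => L x) (hl y))
    (fun x => by simpa using congrArg (fun L : E →L[ℝ] E => L x) (hr y))
  have hs : HasStrictFDerivAt f (e : E →L[ℝ] E) y :=
    hf.contDiffAt.hasStrictFDerivAt (by norm_num)
  refine ⟨(hs.toOpenPartialHomeomorph f).source, hs.mem_toOpenPartialHomeomorph_source,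
    (hs.toOpenPartialHomeomorph f).open_source, ?_⟩
  have := (hs.toOpenPartialHomeomorph f).injOn
  rwa [hs.toOpenPartialHomeomorph_coe] at this

theorem main {f : E → E} (hf : ContDiff ℝ 1 f) (Ai : E → (E →L[ℝ] E)) {B K : ℝ}
    (hl : ∀ y, (Ai y).comp (fderiv ℝ f y) = ContinuousLinearMap.id ℝ E)
    (hr : ∀ y, (fderiv ℝ f y).comp (Ai y) = ContinuousLinearMap.id ℝ E)
    (hB : ∀ y, ‖Ai y‖ ≤ B) (hK0 : 0 ≤ K) (hK : ∀ y y', ‖Ai y - Ai y'‖ ≤ K * ‖y - y'‖)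
    (y y0 : E) : ‖y - y0‖ ≤ B * ‖f y - f y0‖ := by
  choose α h0 hα hf1 hn using fun w => lift_path hf Ai hr hB hK0 hK y0 w
  have hlip : ∀ w, LipschitzWith (K.toNNReal * ‖w‖₊) (fun y => Ai y w) := by
    intro w
    apply LipschitzWith.of_dist_le_mul
    intro y y'
    rw [dist_eq_norm, dist_eq_norm, ← sub_apply]
    refine ((Ai y - Ai y').le_opNorm w).trans ?_
    have := mul_le_mul_of_nonneg_right (hK y y') (norm_nonneg w)
    simp only [NNReal.coe_mul, Real.coe_toNNReal _ hK0, coe_nnnorm]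
    linarith
  have hIci : ∀ w, ∀ t ∈ Set.Ico (0:ℝ) 1, HasDerivWithinAt (α w) (Ai (α w t) w) (Set.Ici t) t := by
    intro w t ht
    have h := hα w t ⟨ht.1, ht.2.le⟩
    have h2 : HasDerivWithinAt (α w) (Ai (α w t) w) (Set.Icc t 1) t :=
      h.mono (Set.Icc_subset_Icc_left ht.1)
    exact h2.mono_of_mem_nhdsWithin (Icc_mem_nhdsGE ht.2)
  have hcont : ∀ w, ContinuousOn (α w) (Set.Icc 0 1) := fun w t ht =>
    (hα w t ht).continuousWithinAt
  have hg : Continuous (fun w => α w 1) := by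
    rw [continuous_iff_continuousAt]
    intro w
    have hle : ∀ w', dist (α w' 1) (α w 1) ≤
        gronwallBound 0 (K.toNNReal * ‖w‖₊ : NNReal) (B * ‖w' - w‖ + 0) 1 := by
      intro w'
      have := dist_le_of_approx_trajectories_ODE (v := fun _ y => Ai y w) (a := 0) (b := 1)
        (εf := B * ‖w' - w‖) (εg := 0) (δ := 0)
        (fun _ => hlip w) (hcont w') (hIci w')
        (fun t _ => by
          rw [dist_eq_norm, ← map_sub]
          exact ((Ai (α w' t)).le_opNorm _).trans
            (mul_le_mul_of_nonneg_right (hB _) (norm_nonneg _)))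
        (hcont w) (hIci w) (fun t _ => by simp) (by simp [h0]) 1 (by simp)
      simpa using this
    rw [ContinuousAt, tendsto_iff_dist_tendsto_zero]
    refine squeeze_zero (fun _ => dist_nonneg) hle ?_
    have h1 : Filter.Tendsto (fun w' => B * ‖w' - w‖ + 0) (nhds w) (nhds 0) := by
      have : Continuous (fun w' => B * ‖w' - w‖ + 0) := by fun_prop
      simpa using this.tendsto w
    have h2 := ((gronwallBound_continuous_ε 0 (K.toNNReal * ‖w‖₊ : NNReal) 1).tendsto 0).comp h1
    simpa [Function.comp_def, gronwallBound_ε0_δ0] using h2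
  have hfc : Continuous f := hf.continuous
  set G : E → E := fun y => α (f y - f y0) 1 with hG
  have hGc : Continuous G := hg.comp (hfc.sub continuous_const)
  have hfG : ∀ y, f (G y) = f y := by
    intro y
    simp [hG, hf1]
  have hclopen : IsClopen {y | G y = y} := by
    refine ⟨isClosed_eq hGc continuous_id, ?_⟩
    rw [isOpen_iff_mem_nhds]
    intro y1 hy1
    obtain ⟨s, hys, hso, hsi⟩ := loc_inj hf Ai hl hr y1
    have h1 : ∀ᶠ y in nhds y1, G y ∈ s := by
      apply hGc.continuousAt.eventually_mem
      rw [show G y1 = y1 from hy1]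
      exact hso.mem_nhds hys
    filter_upwards [h1, hso.mem_nhds hys] with y hy1 hy2
    exact hsi hy1 hy2 (hfG y)
  have hne : ({y | G y = y} : Set E).Nonempty := by
    refine ⟨y0, ?_⟩
    have := hn 0
    simp only [norm_zero, mul_zero, norm_le_zero_iff, sub_eq_zero] at this
    simpa [hG] using this
  have hall := hclopen.eq_univ hne
  have hy : G y = y := by
    have : y ∈ {y | G y = y} := by rw [hall]; trivial
    exact this
  have := hn (f y - f y0)
  rw [← hy]
  simpa [hG, hy, hf1] using this
end Hadamard

namespace Phase

section lines
variable {W V : Type*} [NormedAddCommGroup W] [NormedSpace ℝ W] [NormedAddCommGroup V]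
  [NormedSpace ℝ V]

lemma contDiff_dLine {F : W → ℝ} (hF : ContDiff ℝ (⊤ : ℕ∞) F) (v : W) :
    ContDiff ℝ (⊤ : ℕ∞) (dLine v F) := by
  unfold dLine
  exact (hF.fderiv_right (by simp)).clm_apply contDiff_const

lemma contDiff_dLine_iter {F : W → ℝ} (hF : ContDiff ℝ (⊤ : ℕ∞) F) (v : W) (m : ℕ) :
    ContDiff ℝ (⊤ : ℕ∞) ((dLine v)^[m] F) := by
  induction m with
  | zero => simpa using hF
  | succ m ih => rw [Function.iterate_succ_apply']; exact contDiff_dLine ih v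

lemma dLine_comm {F : W → ℝ} (hF : ContDiff ℝ (⊤ : ℕ∞) F) (v w : W) :
    dLine v (dLine w F) = dLine w (dLine v F) := by
  funext z
  have hd : DifferentiableAt ℝ (fderiv ℝ F) z :=
    (hF.fderiv_right (m := ((⊤ : ℕ∞) : WithTop ℕ∞)) (by simp)).differentiable (by simp) z
  have key : ∀ v w : W, dLine v (dLine w F) z = fderiv ℝ (fderiv ℝ F) z v w := by
    intro v w
    unfold dLine
    rw [fderiv_clm_apply hd (differentiableAt_const w)]
    simp
  rw [key, key]
  have hs : IsSymmSndFDerivAt ℝ F z :=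
    hF.contDiffAt.isSymmSndFDerivAt (by
      rw [minSmoothness_of_isRCLikeNormedField]
      exact WithTop.coe_le_coe.2 (le_top : (2 : ℕ∞) ≤ ⊤))
  exact hs v w

lemma dLine_iter_comm {F : W → ℝ} (hF : ContDiff ℝ (⊤ : ℕ∞) F) (v w : W) (m : ℕ) :
    dLine v ((dLine w)^[m] F) = (dLine w)^[m] (dLine v F) := by
  induction m with
  | zero => rfl
  | succ m ih =>
    rw [Function.iterate_succ_apply', Function.iterate_succ_apply',
      dLine_comm (contDiff_dLine_iter hF w m), ih]

lemma dLine_comp_equiv (e : W ≃L[ℝ] V) (v : W) (F : V → ℝ) :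
    dLine v (F ∘ e) = (dLine (e v) F) ∘ e := by
  funext z
  unfold dLine
  rw [e.comp_right_fderiv]
  rfl

end lines

lemma foldr_all_id {A : Type*} : ∀ (n : ℕ) (f : Fin n → (A → A)), (∀ j, f j = id) →
    (List.ofFn f).foldr (· ∘ ·) id = id := by
  intro n
  induction n with
  | zero => intro f _; rfl
  | succ n ih =>
    intro f hf
    rw [List.ofFn_succ, List.foldr_cons, ih _ (fun j => hf _), hf 0]; rfl

lemma foldr_single {A : Type*} : ∀ (n : ℕ) (f : Fin n → (A → A)) (i : Fin n),
    (∀ j, j ≠ i → f j = id) → (List.ofFn f).foldr (· ∘ ·) id = f i := by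
  intro n
  induction n with
  | zero => intro f i; exact i.elim0
  | succ n ih =>
    intro f i hf
    rw [List.ofFn_succ, List.foldr_cons]
    induction i using Fin.cases with
    | zero =>
      rw [foldr_all_id n _ (fun j => hf _ (Fin.succ_ne_zero j))]; rfl
    | succ i =>
      rw [ih (fun k => f k.succ) i (fun j hj => hf _ (by simpa using hj)),
        hf 0 (Fin.succ_ne_zero i).symm]; rfl

lemma mderiv_single {n : ℕ} {W : Type*} [NormedAddCommGroup W] [NormedSpace ℝ W]
    (dirs : Fin n → W) (i : Fin n) (m : ℕ) (g : W → ℝ) :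
    mderiv dirs (Pi.single i m) g = (dLine (dirs i))^[m] g := by
  unfold mderiv
  rw [foldr_single n _ i]
  · simp
  · intro j hj
    simp [Pi.single_eq_of_ne hj]

lemma mderiv_zero {n : ℕ} {W : Type*} [NormedAddCommGroup W] [NormedSpace ℝ W]
    (dirs : Fin n → W) (g : W → ℝ) : mderiv dirs 0 g = g := by
  unfold mderiv
  rw [foldr_all_id n]
  · rfl
  · intro j; simp

lemma mdeg_single {n : ℕ} (i : Fin n) (m : ℕ) : mdeg (Pi.single i m) = m := by
  unfold mdeg
  simp [Finset.sum_pi_single']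

lemma foldr_swap {A B : Type*} (S : A → B) : ∀ (n : ℕ) (f : Fin n → (A → A)) (g : Fin n → (B → B)),
    (∀ j a, S (f j a) = g j (S a)) → ∀ a, S ((List.ofFn f).foldr (· ∘ ·) id a) =
      (List.ofFn g).foldr (· ∘ ·) id (S a) := by
  intro n
  induction n with
  | zero => intro f g _ a; rfl
  | succ n ih =>
    intro f g h a
    rw [List.ofFn_succ, List.foldr_cons, List.ofFn_succ, List.foldr_cons]
    simp only [Function.comp_apply]
    rw [h, ih (fun i => f i.succ) (fun i => g i.succ) (fun j a => h _ a)]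

/-- the hypotheses on the phase -/
structure Hyp (n : ℕ) (C₀ : ℝ) (Cph : (Fin n → ℕ) → ℝ) (φ : EE n × EE n → ℝ) : Prop where
  smooth : ContDiff ℝ (⊤ : ℕ∞) φ
  det : ∀ z, C₀ ≤ |Matrix.det (Matrix.of fun i j => mixedHessXY φ i j z)|
  bd : ∀ i j : Fin n, ∀ α : Fin n → ℕ, mdeg α ≤ 2 * n + 1 →
          (∀ z, |mderiv dX α (mixedHessXY φ i j) z| ≤ Cph α) ∧
          (∀ z, |mderiv dY α (mixedHessXY φ i j) z| ≤ Cph α)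

/-- swapping the variables -/
def sw (n : ℕ) : (EE n × EE n) ≃L[ℝ] (EE n × EE n) := ContinuousLinearEquiv.prodComm ℝ (EE n) (EE n)

lemma sw_dX {n : ℕ} (i : Fin n) : sw n (dX i) = dY i := rfl
lemma sw_dY {n : ℕ} (i : Fin n) : sw n (dY i) = dX i := rfl

lemma mixedHess_sw {n : ℕ} {φ : EE n × EE n → ℝ} (h : ContDiff ℝ (⊤ : ℕ∞) φ) (i j : Fin n) :
    mixedHessXY (φ ∘ sw n) i j = mixedHessXY φ j i ∘ sw n := by
  unfold mixedHessXY
  rw [dLine_comp_equiv, dLine_comp_equiv, sw_dX, sw_dY, dLine_comm h]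

lemma mderiv_sw {n : ℕ} (d d' : Fin n → EE n × EE n) (hd : ∀ i, sw n (d i) = d' i)
    (α : Fin n → ℕ) (g : EE n × EE n → ℝ) :
    mderiv d α (g ∘ sw n) = mderiv d' α g ∘ sw n := by
  unfold mderiv
  symm
  refine foldr_swap (fun g : EE n × EE n → ℝ => g ∘ sw n) n _ _ ?_ g
  intro j a
  generalize α j = m
  induction m generalizing a with
  | zero => rfl
  | succ m ih =>
    rw [Function.iterate_succ_apply, Function.iterate_succ_apply, ih, dLine_comp_equiv, hd]

lemma Hyp.swap {n : ℕ} {C₀ : ℝ} {Cph : (Fin n → ℕ) → ℝ} {φ : EE n × EE n → ℝ}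
    (h : Hyp n C₀ Cph φ) : Hyp n C₀ Cph (φ ∘ sw n) where
  smooth := h.smooth.comp (sw n).contDiff
  det := by
    intro z
    have := h.det (sw n z)
    rw [← Matrix.det_transpose] at this
    convert this using 4
    ext i j
    simp [mixedHess_sw h.smooth, Matrix.transpose_apply]
  bd := by
    intro i j α hα
    rw [mixedHess_sw h.smooth, mderiv_sw dX dY sw_dX, mderiv_sw dY dX sw_dY]
    exact ⟨fun z => (h.bd j i α hα).2 _, fun z => (h.bd j i α hα).1 _⟩

/-- derived facts on the phase -/
structure Facts (n : ℕ) (c L : ℝ) (φ : EE n × EE n → ℝ) : Prop where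
  smooth : ContDiff ℝ (⊤ : ℕ∞) φ
  p1 : ∀ y y' ξ, y ≠ y' → ∃ i, c * ‖y - y'‖ ≤ |dLine (dY i) φ (y, ξ) - dLine (dY i) φ (y', ξ)|
  p2 : ∀ i m, m ≤ 2 * n + 1 → ∀ y y' ξ,
    |(dLine (dY i))^[m+1] φ (y, ξ) - (dLine (dY i))^[m+1] φ (y', ξ)| ≤ L * ‖y - y'‖
  p3 : ∀ i y y' ξ ξ', |(dLine (dY i) φ (y, ξ) - dLine (dY i) φ (y', ξ)) -
    (dLine (dY i) φ (y, ξ') - dLine (dY i) φ (y', ξ'))| ≤ L * ‖y - y'‖ * ‖ξ - ξ'‖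

lemma vec_sum {n : ℕ} (v : EE n) : v = ∑ l, v l • (EuclideanSpace.single l 1 : EE n) := by
  ext i
  simp [Pi.single_apply]

lemma opNorm_le_of_basis {n : ℕ} {G : Type*} [NormedAddCommGroup G] [NormedSpace ℝ G]
    (T : EE n →L[ℝ] G) {M : ℝ} (hM : 0 ≤ M)
    (h : ∀ l, ‖T (EuclideanSpace.single l 1)‖ ≤ M) : ‖T‖ ≤ n * M := by
  refine T.opNorm_le_bound (by positivity) fun v => ?_
  conv_lhs => rw [vec_sum v, map_sum]
  refine (norm_sum_le _ _).trans ?_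
  have : ∀ l ∈ Finset.univ, ‖T (v l • (EuclideanSpace.single l 1 : EE n))‖ ≤ M * ‖v‖ := by
    intro l _
    rw [map_smul, norm_smul, mul_comm]
    exact mul_le_mul (h l) (PiLp.norm_apply_le v l) (norm_nonneg _) hM
  refine (Finset.sum_le_sum this).trans ?_
  simp [mul_assoc]

lemma lip_of_partial {n : ℕ} {F : EE n → ℝ} (hF : Differentiable ℝ F) {M : ℝ} (hM : 0 ≤ M)
    (h : ∀ l y, |fderiv ℝ F y (EuclideanSpace.single l 1)| ≤ M) (y y' : EE n) :
    |F y - F y'| ≤ n * M * ‖y - y'‖ := by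
  have := Convex.norm_image_sub_le_of_norm_fderiv_le (f := F) (s := Set.univ) (C := n * M)
    (x := y') (y := y) (fun x _ => hF x)
    (fun x _ => opNorm_le_of_basis _ hM (fun l => h l x)) convex_univ trivial trivial
  simpa using this

lemma fderiv_left {n : ℕ} {F : EE n × EE n → ℝ} (hF : Differentiable ℝ F) (y ξ v : EE n) :
    fderiv ℝ (fun y => F (y, ξ)) y v = dLine (v, (0 : EE n)) F (y, ξ) := by
  have h := (hF (y, ξ)).hasFDerivAt.comp y (hasFDerivAt_prodMk_left (𝕜 := ℝ) y ξ)
  have h2 : fderiv ℝ (fun y => F (y, ξ)) y = _ := h.fderiv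
  rw [h2]; simp [dLine]

lemma fderiv_right {n : ℕ} {F : EE n × EE n → ℝ} (hF : Differentiable ℝ F) (y ξ v : EE n) :
    fderiv ℝ (fun ξ => F (y, ξ)) ξ v = dLine ((0 : EE n), v) F (y, ξ) := by
  have h := (hF (y, ξ)).hasFDerivAt.comp ξ (hasFDerivAt_prodMk_right (𝕜 := ℝ) y ξ)
  have h2 : fderiv ℝ (fun ξ => F (y, ξ)) ξ = _ := h.fderiv
  rw [h2]; simp [dLine]

lemma lip_left {n : ℕ} {F : EE n × EE n → ℝ} (hF : ContDiff ℝ (⊤ : ℕ∞) F) {M : ℝ} (hM : 0 ≤ M)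
    (h : ∀ l z, |dLine (dX l) F z| ≤ M) (y y' ξ : EE n) :
    |F (y, ξ) - F (y', ξ)| ≤ n * M * ‖y - y'‖ := by
  have hd : Differentiable ℝ F := hF.differentiable (by simp)
  refine lip_of_partial (F := fun y => F (y, ξ)) ?_ hM ?_ y y'
  · exact hd.comp (by fun_prop)
  · intro l y
    rw [fderiv_left hd]
    exact h l _

/-- entrywise bound for the norm of a matrix -/
lemma norm_clm_le {n : ℕ} (A : Matrix (Fin n) (Fin n) ℝ) {M : ℝ} (hM : 0 ≤ M)
    (h : ∀ i j, |A i j| ≤ M) : ‖Matrix.toEuclideanCLM (𝕜 := ℝ) A‖ ≤ n * (n * M) := by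
  refine opNorm_le_of_basis _ (by positivity) fun l => ?_
  set w := Matrix.toEuclideanCLM (𝕜 := ℝ) A (EuclideanSpace.single l 1) with hw
  have hwi : ∀ i, w i = A i l := by
    intro i
    rw [hw, Matrix.ofLp_toEuclideanCLM]
    simp [Matrix.mulVec_single]
  rw [vec_sum w]
  refine (norm_sum_le _ _).trans ?_
  have : ∀ i ∈ Finset.univ, ‖w i • (EuclideanSpace.single i 1 : EE n)‖ ≤ M := by
    intro i _
    rw [norm_smul, hwi]
    simpa using h i l
  refine (Finset.sum_le_sum this).trans ?_
  simp

lemma inv_entry_le {n : ℕ} (A : Matrix (Fin n) (Fin n) ℝ) {M C₀ : ℝ} (hM : 1 ≤ M) (hC : 0 < C₀)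
    (h : ∀ i j, |A i j| ≤ M) (hd : C₀ ≤ |A.det|) (i j : Fin n) :
    |A⁻¹ i j| ≤ C₀⁻¹ * (n.factorial * M ^ n) := by
  rw [Matrix.inv_def, Matrix.smul_apply, smul_eq_mul, abs_mul, Ring.inverse_eq_inv', abs_inv]
  refine mul_le_mul (inv_anti₀ hC hd) ?_ (abs_nonneg _) (by positivity)
  rw [Matrix.adjugate_apply]
  have := Matrix.det_le (A := A.updateRow j (Pi.single i 1)) (abv := AbsoluteValue.abs) (x := M) ?_
  · simpa using this
  · intro k l
    simp only [AbsoluteValue.abs_apply, Matrix.updateRow_apply]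
    split_ifs with hk
    · by_cases hl : l = i
      · subst hl; simpa using hM
      · simp [Pi.single_eq_of_ne hl]; linarith
    · exact h k l

theorem facts_of_hyp (n : ℕ) (C₀ : ℝ) (hC₀ : 0 < C₀) (Cph : (Fin n → ℕ) → ℝ) :
    ∃ c L : ℝ, 0 < c ∧ 0 ≤ L ∧ ∀ φ, Hyp n C₀ Cph φ → Facts n c L φ := by
  -- a uniform bound of all the needed constants
  obtain ⟨M, hM1, hM⟩ : ∃ M : ℝ, 1 ≤ M ∧ ∀ i : Fin n, ∀ m ≤ 2 * n + 1, Cph (Pi.single i m) ≤ M := by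
    refine ⟨1 + ∑ i : Fin n, ∑ m ∈ Finset.range (2 * n + 2), |Cph (Pi.single i m)|, ?_, ?_⟩
    · have : 0 ≤ ∑ i : Fin n, ∑ m ∈ Finset.range (2 * n + 2), |Cph (Pi.single i m)| := by positivity
      linarith
    · intro i m hm
      have h1 : |Cph (Pi.single i m)| ≤ ∑ m ∈ Finset.range (2 * n + 2), |Cph (Pi.single i m)| :=
        Finset.single_le_sum (f := fun m => |Cph (Pi.single i m)|) (fun _ _ => abs_nonneg _) (by simp; omega)
      have h2 : ∑ m ∈ Finset.range (2 * n + 2), |Cph (Pi.single i m)| ≤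
          ∑ i : Fin n, ∑ m ∈ Finset.range (2 * n + 2), |Cph (Pi.single i m)| :=
        Finset.single_le_sum (f := fun i : Fin n => ∑ m ∈ Finset.range (2 * n + 2), |Cph (Pi.single i m)|)
          (fun _ _ => Finset.sum_nonneg fun _ _ => abs_nonneg _) (by simp)
      have := le_abs_self (Cph (Pi.single i m))
      linarith
  have hM0 : 0 ≤ M := by linarith
  set I : ℝ := C₀⁻¹ * (n.factorial * M ^ n)
  have hI : 0 ≤ I := by positivity
  set B : ℝ := n * (n * I) with hB
  have hB0 : 0 ≤ B := by positivity
  refine ⟨(n * B + 1)⁻¹, n * (n * M), by positivity, by positivity, ?_⟩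
  intro φ hφ
  have hent : ∀ i j z, |mixedHessXY φ i j z| ≤ M := by
    intro i j z
    have := (hφ.bd i j (Pi.single i 0) (by rw [mdeg_single]; omega)).1 z
    rw [mderiv_single] at this
    exact (by simpa using this : _ ≤ Cph (Pi.single i 0)).trans (hM i 0 (by omega))
  have hYd : ∀ i j k m, m ≤ 2 * n + 1 → ∀ z, |(dLine (dY k))^[m] (mixedHessXY φ i j) z| ≤ M := by
    intro i j k m hm z
    have := (hφ.bd i j (Pi.single k m) (by rw [mdeg_single]; omega)).2 z
    rw [mderiv_single] at this
    exact this.trans (hM k m hm)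
  have hXd : ∀ i j k z, |dLine (dX k) (mixedHessXY φ i j) z| ≤ M := by
    intro i j k z
    have := (hφ.bd i j (Pi.single k 1) (by rw [mdeg_single]; omega)).1 z
    rw [mderiv_single] at this
    exact this.trans (hM k 1 (by omega))
  have hs := hφ.smooth
  have hnM : (n:ℝ) * M ≤ n * (n * M) := by
    rcases Nat.eq_zero_or_pos n with h | h
    · simp [h]
    · have : (1:ℝ) ≤ n := by exact_mod_cast h
      nlinarith [mul_nonneg (by positivity : (0:ℝ) ≤ n) hM0]
  refine ⟨hs, ?_, ?_, ?_⟩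
  · intro y y' ξ hne
    set f : EE n → EE n := fun y => WithLp.toLp 2 (fun j => dLine (dY j) φ (y, ξ)) with hf
    have hfs : ContDiff ℝ 1 f := by
      rw [contDiff_euclidean]
      intro j
      have := (contDiff_dLine hs (dY j)).comp (f := fun y : EE n => (y, ξ)) (by fun_prop)
      exact this.of_le (by exact_mod_cast le_top)
    set H : EE n → Matrix (Fin n) (Fin n) ℝ := fun y => Matrix.of fun j i => mixedHessXY φ i j (y, ξ)
      with hH
    have hHd : ∀ y, C₀ ≤ |(H y).det| := by
      intro y
      have := hφ.det (y, ξ)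
      rw [← Matrix.det_transpose] at this
      exact this
    have hHu : ∀ y, IsUnit (H y).det := by
      intro y
      rw [isUnit_iff_ne_zero]
      intro h0
      have := hHd y
      rw [h0] at this
      simp at this; linarith
    have hfd : ∀ y, fderiv ℝ f y = Matrix.toEuclideanCLM (𝕜 := ℝ) (H y) := by
      intro y
      have hdf : DifferentiableAt ℝ f y := hfs.differentiable (by norm_num) y
      have hcol : ∀ l, fderiv ℝ f y (EuclideanSpace.single l 1) =
          Matrix.toEuclideanCLM (𝕜 := ℝ) (H y) (EuclideanSpace.single l 1) := by
        intro l
        ext j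
        rw [Matrix.ofLp_toEuclideanCLM]
        have h1 : fderiv ℝ (fun y => f y j) y (EuclideanSpace.single l 1) =
            (fderiv ℝ f y (EuclideanSpace.single l 1)) j := by
          have := ((EuclideanSpace.proj (𝕜 := ℝ) j : EE n →L[ℝ] ℝ).hasFDerivAt.comp y hdf.hasFDerivAt).fderiv
          have h3 : (fun y => f y j) = (EuclideanSpace.proj (𝕜 := ℝ) j : EE n →L[ℝ] ℝ) ∘ f := rfl
          rw [h3, this]; rfl
        rw [← h1]
        have h2 := fderiv_left (F := dLine (dY j) φ) ((contDiff_dLine hs (dY j)).differentiable (by simp))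
          y ξ (EuclideanSpace.single l 1)
        rw [show (fun y => f y j) = fun y => dLine (dY j) φ (y, ξ) from rfl, h2]
        simp [Matrix.mulVec_single, hH, mixedHessXY, dX]
      ext1 v
      rw [vec_sum v, map_sum, map_sum]
      simp only [map_smul, hcol]
    set Ai : EE n → (EE n →L[ℝ] EE n) := fun y => Matrix.toEuclideanCLM (𝕜 := ℝ) (H y)⁻¹ with hAi
    have hAiB : ∀ y, ‖Ai y‖ ≤ B := by
      intro y
      refine norm_clm_le _ hI fun i j => ?_
      exact inv_entry_le _ hM1 hC₀ (fun j i => hent i j _) (hHd y) i j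
    have hl : ∀ y, (Ai y).comp (fderiv ℝ f y) = ContinuousLinearMap.id ℝ (EE n) := by
      intro y
      rw [hfd, hAi]
      have := map_mul (Matrix.toEuclideanCLM (𝕜 := ℝ) (n := Fin n)) (H y)⁻¹ (H y)
      rw [Matrix.nonsing_inv_mul _ (hHu y), map_one] at this
      exact this.symm
    have hr : ∀ y, (fderiv ℝ f y).comp (Ai y) = ContinuousLinearMap.id ℝ (EE n) := by
      intro y
      rw [hfd, hAi]
      have := map_mul (Matrix.toEuclideanCLM (𝕜 := ℝ) (n := Fin n)) (H y) (H y)⁻¹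
      rw [Matrix.mul_nonsing_inv _ (hHu y), map_one] at this
      exact this.symm
    have hHlip : ∀ y y', ‖Matrix.toEuclideanCLM (𝕜 := ℝ) (H y) - Matrix.toEuclideanCLM (𝕜 := ℝ) (H y')‖ ≤
        n * (n * (n * M * ‖y - y'‖)) := by
      intro y y'
      rw [← map_sub]
      refine norm_clm_le _ (by positivity) fun j i => ?_
      exact lip_left (contDiff_dLine (contDiff_dLine hs _) _) hM0 (fun l z => hXd i j l z) y y' ξ
    have hAlip : ∀ y y', ‖Ai y - Ai y'‖ ≤ (B * (n * (n * (n * M))) * B) * ‖y - y'‖ := by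
      intro y y'
      have e : Ai y - Ai y' = Ai y * (fderiv ℝ f y' - fderiv ℝ f y) * Ai y' := by
        rw [mul_sub, sub_mul, mul_assoc, show fderiv ℝ f y' * Ai y' = 1 from hr y',
          show Ai y * fderiv ℝ f y = 1 from hl y, mul_one, one_mul]
      rw [e]
      refine (norm_mul_le _ _).trans ?_
      refine (mul_le_mul_of_nonneg_right (norm_mul_le _ _) (norm_nonneg _)).trans ?_
      have h1 := hHlip y' y
      rw [← hfd, ← hfd, norm_sub_rev y' y] at h1
      have h2 := hAiB y
      have h3 := hAiB y'
      calc ‖Ai y‖ * ‖fderiv ℝ f y' - fderiv ℝ f y‖ * ‖Ai y'‖ ≤ B * (n * (n * (n * M * ‖y - y'‖))) * B := by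
            gcongr
        _ = _ := by ring
    have hmain := Hadamard.main hfs Ai hl hr hAiB (by positivity) hAlip y y'
    by_contra hcon
    push Not at hcon
    have hpos : 0 < ‖y - y'‖ := norm_pos_iff.2 (sub_ne_zero.2 hne)
    have h1 : ‖f y - f y'‖ ≤ n * ((n * B + 1)⁻¹ * ‖y - y'‖) := by
      rw [vec_sum (f y - f y')]
      refine (norm_sum_le _ _).trans ?_
      have : ∀ i ∈ Finset.univ, ‖(f y - f y') i • (EuclideanSpace.single i 1 : EE n)‖ ≤
          (n * B + 1)⁻¹ * ‖y - y'‖ := by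
        intro i _
        rw [norm_smul]
        have := (hcon i).le
        simpa [hf] using this
      refine (Finset.sum_le_sum this).trans ?_
      simp
    have h2 : ‖y - y'‖ ≤ B * (n * ((n * B + 1)⁻¹ * ‖y - y'‖)) :=
      hmain.trans (mul_le_mul_of_nonneg_left h1 hB0)
    have h3 : B * (n * ((n * B + 1)⁻¹ * ‖y - y'‖)) = (n * B) / (n * B + 1) * ‖y - y'‖ := by
      field_simp
    rw [h3] at h2
    have h4 : (n * B) / (n * B + 1) < 1 := by
      rw [div_lt_one (by positivity)]; linarith
    nlinarith
  · intro i m hm y y' ξ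
    refine (lip_left (contDiff_dLine_iter hs _ _) hM0 (fun l z => ?_) y y' ξ).trans
      (mul_le_mul_of_nonneg_right hnM (norm_nonneg _))
    rw [Function.iterate_succ_apply, dLine_iter_comm (contDiff_dLine hs _)]
    exact hYd l i i m hm z
  · intro i y y' ξ ξ'
    have hd := (contDiff_dLine hs (dY i))
    have hdd : Differentiable ℝ (dLine (dY i) φ) := hd.differentiable (by simp)
    have := lip_of_partial (F := fun ξ => dLine (dY i) φ (y, ξ) - dLine (dY i) φ (y', ξ))
      ((hdd.comp (by fun_prop)).sub (hdd.comp (by fun_prop))) (M := n * M * ‖y - y'‖) (by positivity)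
      (fun l ξ => by
        have e1 : ∀ y, DifferentiableAt ℝ (fun ξ => dLine (dY i) φ (y, ξ)) ξ := fun y =>
          (hdd.comp (g := dLine (dY i) φ) (f := fun ξ : EE n => (y, ξ)) (by fun_prop)) ξ
        rw [fderiv_fun_sub (e1 y) (e1 y'), sub_apply, fderiv_right hdd, fderiv_right hdd]
        refine lip_left (contDiff_dLine hd _) hM0 (fun k z => ?_) y y' ξ
        rw [dLine_comm hd]
        exact hYd k i l 1 (by omega) z) ξ ξ'
    refine this.trans (le_of_eq ?_)
    ring
end Phase

namespace Osc
open Phase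
variable {n : ℕ}

/-- the first `k` derivatives in direction `e` are bounded by `M` -/
def Bd (e : EE n) (k : ℕ) (f : EE n → ℝ) (M : ℝ) : Prop :=
  ∀ l ≤ k, ∀ x, |(dLine e)^[l] f x| ≤ M

lemma Bd.mono {e : EE n} {k k' : ℕ} {f : EE n → ℝ} {M M' : ℝ} (h : Bd e k f M) (hk : k' ≤ k)
    (hM : M ≤ M') : Bd e k' f M' := fun l hl x => (h l (hl.trans hk) x).trans hM

lemma Bd.deriv {e : EE n} {k : ℕ} {f : EE n → ℝ} {M : ℝ} (h : Bd e (k+1) f M) :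
    Bd e k (dLine e f) M := by
  intro l hl x
  have := h (l+1) (by omega) x
  rwa [Function.iterate_succ_apply] at this

lemma Bd.of_deriv {e : EE n} {k : ℕ} {f : EE n → ℝ} {M : ℝ} (h0 : ∀ x, |f x| ≤ M)
    (h : Bd e k (dLine e f) M) : Bd e (k+1) f M := by
  intro l hl x
  cases l with
  | zero => exact h0 x
  | succ l => rw [Function.iterate_succ_apply]; exact h l (by omega) x

lemma dLine_add' {e : EE n} {f g : EE n → ℝ} (hf : ContDiff ℝ (⊤ : ℕ∞) f)
    (hg : ContDiff ℝ (⊤ : ℕ∞) g) : dLine e (fun x => f x + g x) = fun x => dLine e f x + dLine e g x := by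
  funext x
  unfold dLine
  rw [fderiv_fun_add (hf.differentiable (by simp) x) (hg.differentiable (by simp) x)]
  rfl

lemma dLine_sub' {e : EE n} {f g : EE n → ℝ} (hf : ContDiff ℝ (⊤ : ℕ∞) f)
    (hg : ContDiff ℝ (⊤ : ℕ∞) g) : dLine e (fun x => f x - g x) = fun x => dLine e f x - dLine e g x := by
  funext x
  unfold dLine
  rw [fderiv_fun_sub (hf.differentiable (by simp) x) (hg.differentiable (by simp) x)]
  rfl

lemma dLine_mul' {e : EE n} {f g : EE n → ℝ} (hf : ContDiff ℝ (⊤ : ℕ∞) f)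
    (hg : ContDiff ℝ (⊤ : ℕ∞) g) :
    dLine e (fun x => f x * g x) = fun x => dLine e f x * g x + f x * dLine e g x := by
  funext x
  unfold dLine
  rw [fderiv_fun_mul (hf.differentiable (by simp) x) (hg.differentiable (by simp) x)]
  simp
  ring

lemma dLine_iter_sub {e : EE n} {f g : EE n → ℝ} (hf : ContDiff ℝ (⊤ : ℕ∞) f)
    (hg : ContDiff ℝ (⊤ : ℕ∞) g) (l : ℕ) :
    (dLine e)^[l] (fun x => f x - g x) = fun x => (dLine e)^[l] f x - (dLine e)^[l] g x := by
  induction l with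
  | zero => rfl
  | succ l ih =>
    rw [Function.iterate_succ_apply', ih, dLine_sub' (contDiff_dLine_iter hf e l)
      (contDiff_dLine_iter hg e l)]
    simp only [Function.iterate_succ_apply']

lemma dLine_iter_add {e : EE n} {f g : EE n → ℝ} (hf : ContDiff ℝ (⊤ : ℕ∞) f)
    (hg : ContDiff ℝ (⊤ : ℕ∞) g) (l : ℕ) :
    (dLine e)^[l] (fun x => f x + g x) = fun x => (dLine e)^[l] f x + (dLine e)^[l] g x := by
  induction l with
  | zero => rfl
  | succ l ih =>
    rw [Function.iterate_succ_apply', ih, dLine_add' (contDiff_dLine_iter hf e l)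
      (contDiff_dLine_iter hg e l)]
    simp only [Function.iterate_succ_apply']

lemma dLine_iter_cmul {e : EE n} {f : EE n → ℝ} (hf : ContDiff ℝ (⊤ : ℕ∞) f) (c : ℝ) (l : ℕ) :
    (dLine e)^[l] (fun x => c * f x) = fun x => c * (dLine e)^[l] f x := by
  induction l with
  | zero => rfl
  | succ l ih =>
    rw [Function.iterate_succ_apply', ih, dLine_mul' contDiff_const
      (contDiff_dLine_iter hf e l)]
    funext x
    simp [Function.iterate_succ_apply', dLine]

lemma Bd.sub {e : EE n} {k : ℕ} {f g : EE n → ℝ} {M M' : ℝ} (hf : ContDiff ℝ (⊤ : ℕ∞) f)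
    (hg : ContDiff ℝ (⊤ : ℕ∞) g) (h : Bd e k f M) (h' : Bd e k g M') :
    Bd e k (fun x => f x - g x) (M + M') := by
  intro l hl x
  rw [dLine_iter_sub hf hg]
  exact (abs_sub _ _).trans (add_le_add (h l hl x) (h' l hl x))

lemma Bd.add {e : EE n} {k : ℕ} {f g : EE n → ℝ} {M M' : ℝ} (hf : ContDiff ℝ (⊤ : ℕ∞) f)
    (hg : ContDiff ℝ (⊤ : ℕ∞) g) (h : Bd e k f M) (h' : Bd e k g M') :
    Bd e k (fun x => f x + g x) (M + M') := by
  intro l hl x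
  rw [dLine_iter_add hf hg]
  exact (abs_add_le _ _).trans (add_le_add (h l hl x) (h' l hl x))

lemma Bd.nonneg {e : EE n} {k : ℕ} {f : EE n → ℝ} {M : ℝ} (h : Bd e k f M) : 0 ≤ M :=
  (abs_nonneg _).trans (h 0 (Nat.zero_le _) 0)

lemma Bd.mul {e : EE n} {k : ℕ} {f g : EE n → ℝ} {M M' : ℝ} (hf : ContDiff ℝ (⊤ : ℕ∞) f)
    (hg : ContDiff ℝ (⊤ : ℕ∞) g) (h : Bd e k f M) (h' : Bd e k g M') :
    Bd e k (fun x => f x * g x) (2 ^ k * (M * M')) := by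
  have h0 : 0 ≤ M * M' := mul_nonneg h.nonneg h'.nonneg
  have hz : ∀ k : ℕ, Bd e k f M → Bd e k g M' → ∀ x, |f x * g x| ≤ M * M' := by
    intro k h h' x
    rw [abs_mul]
    exact mul_le_mul (h 0 (Nat.zero_le _) x) (h' 0 (Nat.zero_le _) x) (abs_nonneg _) h.nonneg
  induction k generalizing f g with
  | zero =>
    intro l hl x
    obtain rfl : l = 0 := by omega
    simpa using hz 0 h h' x
  | succ k ih =>
    refine Bd.of_deriv (fun x => (hz _ h h' x).trans ?_) ?_
    · nlinarith [one_le_pow₀ (one_le_two : (1:ℝ) ≤ 2) (n := k+1)]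
    · rw [dLine_mul' hf hg]
      have hz' : ∀ {f g : EE n → ℝ}, ∀ k : ℕ, Bd e k f M → Bd e k g M' → ∀ x, |f x * g x| ≤ M * M' := by
        intro f g k h h' x
        rw [abs_mul]
        exact mul_le_mul (h 0 (Nat.zero_le _) x) (h' 0 (Nat.zero_le _) x) (abs_nonneg _) h.nonneg
      have h1 := ih (contDiff_dLine hf e) hg h.deriv (h'.mono (by omega) le_rfl) (fun k => hz' k)
      have h2 := ih hf (contDiff_dLine hg e) (h.mono (by omega) le_rfl) h'.deriv (fun k => hz' k)
      refine (Bd.add ((contDiff_dLine hf e).mul hg) (hf.mul (contDiff_dLine hg e)) h1 h2).mono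
        le_rfl ?_
      rw [pow_succ]; linarith

lemma dLine_tsupport {e : EE n} {f : EE n → ℝ} {S : Set (EE n)} (h : tsupport f ⊆ S) :
    tsupport (dLine e f) ⊆ S := by
  refine subset_trans ?_ h
  apply closure_minimal _ (isClosed_tsupport f)
  refine subset_trans ?_ (support_fderiv_subset ℝ)
  intro x hx
  simp only [Function.mem_support, dLine] at hx ⊢
  intro h0
  rw [h0] at hx
  simp at hx

lemma eq_zero_of_tsupport {f : EE n → ℝ} {S : Set (EE n)} (h : tsupport f ⊆ S) {x : EE n}
    (hx : x ∉ S) : f x = 0 := image_eq_zero_of_notMem_tsupport fun hh => hx (h hh)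

/-- quotient bound -/
lemma quot_bound (k : ℕ) (M G c : ℝ) (hc : 0 < c) : ∃ C : ℝ, ∀ (e : EE n) (q b g : EE n → ℝ)
    (S : Set (EE n)), ContDiff ℝ (⊤ : ℕ∞) q → ContDiff ℝ (⊤ : ℕ∞) g → ContDiff ℝ (⊤ : ℕ∞) b →
    tsupport q ⊆ S → (∀ x ∈ S, c ≤ |g x|) → (∀ x, q x * g x = b x) → Bd e k b M → Bd e k g G →
    Bd e k q C := by
  induction k generalizing M with
  | zero =>
    refine ⟨M / c, ?_⟩
    intro e q b g S hq hg hb hqS hS hqg hbM hgG l hl x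
    obtain rfl : l = 0 := by omega
    have hM := hbM.nonneg
    by_cases hx : x ∈ S
    · have h1 := hbM 0 le_rfl x
      simp only [Function.iterate_zero, id] at h1 ⊢
      rw [← hqg, abs_mul] at h1
      rw [le_div_iff₀ hc]
      exact (mul_le_mul_of_nonneg_left (hS x hx) (abs_nonneg _)).trans h1
    · simp only [Function.iterate_zero, id, eq_zero_of_tsupport hqS hx]
      simp; positivity
  | succ k ih =>
    obtain ⟨C1, h1⟩ := ih M
    obtain ⟨C2, h2⟩ := ih (M + 2 ^ k * (C1 * G))
    refine ⟨max C1 C2, ?_⟩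
    intro e q b g S hq hg hb hqS hS hqg hbM hgG
    have hqk := h1 e q b g S hq hg hb hqS hS hqg (hbM.mono (by omega) le_rfl) (hgG.mono (by omega) le_rfl)
    have hb' : Bd e k (fun x => dLine e b x - q x * dLine e g x) (M + 2 ^ k * (C1 * G)) :=
      Bd.sub (contDiff_dLine hb e) (hq.mul (contDiff_dLine hg e)) hbM.deriv
        (Bd.mul hq (contDiff_dLine hg e) hqk hgG.deriv)
    refine Bd.of_deriv (fun x => (hqk 0 (Nat.zero_le _) x).trans (le_max_left _ _)) ?_
    refine (h2 e (dLine e q) _ g S (contDiff_dLine hq e) hg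
      ((contDiff_dLine hb e).sub (hq.mul (contDiff_dLine hg e))) (dLine_tsupport hqS) hS ?_ hb'
      (hgG.mono (by omega) le_rfl)).mono le_rfl (le_max_right _ _)
    intro x
    have hbe : b = fun x => q x * g x := (funext hqg).symm
    rw [hbe, dLine_mul' hq hg]
    ring

lemma quot_smooth {b g : EE n → ℝ} {S : Set (EE n)} {c : ℝ} (hc : 0 < c)
    (hb : ContDiff ℝ (⊤ : ℕ∞) b) (hg : ContDiff ℝ (⊤ : ℕ∞) g) (hbS : tsupport b ⊆ S)
    (hS : ∀ x ∈ S, c ≤ |g x|) : ContDiff ℝ (⊤ : ℕ∞) (fun x => b x / g x) ∧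
      tsupport (fun x => b x / g x) ⊆ S ∧ ∀ x, (b x / g x) * g x = b x := by
  have h0 : tsupport (fun x => b x / g x) ⊆ tsupport b := by
    apply closure_mono
    intro x hx
    simp only [Function.mem_support] at hx ⊢
    intro h; simp [h] at hx
  refine ⟨?_, h0.trans hbS, ?_⟩
  · rw [contDiff_iff_contDiffAt]
    intro x
    by_cases hx : x ∈ tsupport b
    · have : g x ≠ 0 := by
        intro h; have := hS x (hbS hx); rw [h] at this; simp at this; linarith
      exact hb.contDiffAt.div hg.contDiffAt this
    · have : x ∉ tsupport (fun x => b x / g x) := fun hh => hx (h0 hh)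
      rw [notMem_tsupport_iff_eventuallyEq] at this
      exact contDiffAt_const.congr_of_eventuallyEq this
  · intro x
    by_cases hx : x ∈ S
    · have : g x ≠ 0 := by
        intro h; have := hS x hx; rw [h] at this; simp at this; linarith
      field_simp
    · simp [eq_zero_of_tsupport hbS hx]

/-- the oscillating factor -/
def osc (Ψ : EE n → ℝ) (x : EE n) : ℂ := Complex.exp (Complex.I * (Ψ x : ℂ))

lemma norm_osc (Ψ : EE n → ℝ) (x : EE n) : ‖osc Ψ x‖ = 1 := by
  unfold osc
  rw [mul_comm]; exact Complex.norm_exp_ofReal_mul_I _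

lemma continuous_osc {Ψ : EE n → ℝ} (h : Continuous Ψ) : Continuous (osc Ψ) := by
  unfold osc; fun_prop

lemma hasFDerivAt_osc {Ψ : EE n → ℝ} (h : ContDiff ℝ (⊤ : ℕ∞) Ψ) (x : EE n) :
    HasFDerivAt (osc Ψ) (osc Ψ x • (Complex.I • (Complex.ofRealCLM.comp (fderiv ℝ Ψ x)))) x := by
  have h1 : HasFDerivAt Ψ (fderiv ℝ Ψ x) x := (h.differentiable (by simp) x).hasFDerivAt
  have h2 := ((Complex.ofRealCLM.hasFDerivAt.comp x h1).const_smul Complex.I).cexp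
  exact h2

lemma fderiv_osc {Ψ : EE n → ℝ} (h : ContDiff ℝ (⊤ : ℕ∞) Ψ) (e x : EE n) :
    fderiv ℝ (osc Ψ) x e = Complex.I * ((dLine e Ψ x : ℝ) : ℂ) * osc Ψ x := by
  rw [(hasFDerivAt_osc h x).fderiv]
  simp [dLine]; ring

lemma ibp {Ψ q : EE n → ℝ} (h : ContDiff ℝ (⊤ : ℕ∞) Ψ) (hq : ContDiff ℝ (⊤ : ℕ∞) q)
    (hc : HasCompactSupport q) (e : EE n) :
    ‖∫ x, osc Ψ x * ((q x * dLine e Ψ x : ℝ) : ℂ)‖ = ‖∫ x, osc Ψ x * ((dLine e q x : ℝ) : ℂ)‖ := by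
  have hcq : HasCompactSupport (fun x => ((q x : ℝ) : ℂ)) := hc.comp_left (g := fun t : ℝ => (t : ℂ)) (by simp)
  have hqc : Continuous q := hq.continuous
  have hfq : ∀ x, fderiv ℝ (fun x => ((q x : ℝ) : ℂ)) x e = ((dLine e q x : ℝ) : ℂ) := by
    intro x
    have h1 : HasFDerivAt q (fderiv ℝ q x) x := (hq.differentiable (by simp) x).hasFDerivAt
    have h2 := (Complex.ofRealCLM.hasFDerivAt.comp x h1).fderiv
    have h3 : fderiv ℝ (fun x => ((q x : ℝ) : ℂ)) x = _ := h2
    rw [h3]; rfl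
  have hcd : HasCompactSupport (fun x => ((dLine e q x : ℝ) : ℂ)) := by
    apply HasCompactSupport.comp_left (g := fun t : ℝ => (t : ℂ)) _ (by simp)
    exact hc.of_isClosed_subset (isClosed_tsupport _) (dLine_tsupport le_rfl)
  have c1 : Continuous (dLine e Ψ) := (contDiff_dLine h e).continuous
  have c2 : Continuous (dLine e q) := (contDiff_dLine hq e).continuous
  have c3 : Continuous (osc Ψ) := continuous_osc h.continuous
  have key := integral_mul_fderiv_eq_neg_fderiv_mul_of_integrable (μ := (volume : Measure (EE n)))
    (f := osc Ψ) (g := fun x => ((q x : ℝ) : ℂ)) (v := e)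
    (by
      simp only [fderiv_osc h]
      apply Continuous.integrable_of_hasCompactSupport (by fun_prop)
      exact hcq.mul_left)
    (by
      simp only [hfq]
      apply Continuous.integrable_of_hasCompactSupport (by fun_prop)
      exact hcd.mul_left)
    (by
      apply Continuous.integrable_of_hasCompactSupport (by fun_prop)
      exact hcq.mul_left)
    (fun x _ => (hasFDerivAt_osc h x).differentiableAt)
    (fun x _ => Complex.ofRealCLM.differentiableAt.comp x (hq.differentiable (by simp) x))
  simp only [hfq, fderiv_osc h] at key
  rw [key, norm_neg]
  have : ∀ x, Complex.I * ((dLine e Ψ x : ℝ) : ℂ) * osc Ψ x * (q x : ℂ) =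
      Complex.I * (osc Ψ x * ((q x * dLine e Ψ x : ℝ) : ℂ)) := by
    intro x; push_cast; ring
  simp only [this]
  rw [integral_const_mul, norm_mul, Complex.norm_I, one_mul]

theorem nonstationary (N : ℕ) (M G c V : ℝ) (hc : 0 < c) : ∃ C : ℝ, ∀ (e : EE n) (Ψ b : EE n → ℝ)
    (S : Set (EE n)) (R : ℝ), 0 < R → ContDiff ℝ (⊤ : ℕ∞) Ψ → ContDiff ℝ (⊤ : ℕ∞) b →
    IsCompact S → volume.real S ≤ V → tsupport b ⊆ S → (∀ x ∈ S, c * R ≤ |dLine e Ψ x|) →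
    Bd e N b M → Bd e N (dLine e Ψ) (G * R) →
    ‖∫ x, osc Ψ x * (b x : ℂ)‖ ≤ C * (R⁻¹) ^ N := by
  induction N generalizing M with
  | zero =>
    refine ⟨|M| * |V|, ?_⟩
    intro e Ψ b S R hR hΨ hb hSc hV hbS hS hbM hG
    rw [← setIntegral_eq_integral_of_forall_compl_eq_zero (s := S)]
    · have := norm_setIntegral_le_of_norm_le_const (μ := (volume : Measure (EE n))) (s := S)
        (f := fun x => osc Ψ x * (b x : ℂ)) (C := |M|)
        hSc.measure_lt_top ?_
      · simp only [pow_zero, mul_one]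
        exact this.trans (mul_le_mul_of_nonneg_left (hV.trans (le_abs_self V)) (abs_nonneg _))
      · intro x _
        rw [norm_mul, norm_osc, one_mul]
        simpa using (hbM 0 le_rfl x).trans (le_abs_self M)
    · intro x hx
      simp [eq_zero_of_tsupport hbS hx]
  | succ N ih =>
    obtain ⟨C1, h1⟩ := quot_bound (n := n) (N+1) M G c hc
    obtain ⟨C2, h2⟩ := ih C1
    refine ⟨C2, ?_⟩
    intro e Ψ b S R hR hΨ hb hSc hV hbS hS hbM hG
    set g : EE n → ℝ := fun x => R⁻¹ * dLine e Ψ x with hg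
    have hgs : ContDiff ℝ (⊤ : ℕ∞) g := contDiff_const.mul (contDiff_dLine hΨ e)
    have hgS : ∀ x ∈ S, c ≤ |g x| := by
      intro x hx
      rw [hg]
      simp only [abs_mul, abs_inv, abs_of_pos hR]
      rw [le_inv_mul_iff₀ hR, mul_comm]
      exact hS x hx
    have hgG : Bd e (N+1) g G := by
      intro l hl x
      rw [hg, dLine_iter_cmul (contDiff_dLine hΨ e), abs_mul, abs_inv, abs_of_pos hR,
        inv_mul_le_iff₀ hR, mul_comm R]
      exact hG l hl x
    obtain ⟨hqs, hqS, hqg⟩ := quot_smooth hc hb hgs hbS hgS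
    set q : EE n → ℝ := fun x => b x / g x with hq
    have hqC := h1 e q b g S hqs hgs hb hqS hgS hqg hbM hgG
    have hIH := h2 e Ψ (dLine e q) S R hR hΨ (contDiff_dLine hqs e) hSc hV (dLine_tsupport hqS) hS
      hqC.deriv (hG.mono (by omega) le_rfl)
    have hqcs : HasCompactSupport q := hSc.of_isClosed_subset (isClosed_tsupport _) hqS
    have hib := ibp hΨ hqs hqcs e
    have hbe : ∀ x, osc Ψ x * (b x : ℂ) = (R⁻¹ : ℂ) * (osc Ψ x * ((q x * dLine e Ψ x : ℝ) : ℂ)) := by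
      intro x
      have hqg' : q x * g x = b x := hqg x
      rw [← hqg', show g x = R⁻¹ * dLine e Ψ x from rfl]
      push_cast
      ring
    simp only [hbe]
    rw [integral_const_mul, norm_mul, hib, norm_inv, Complex.norm_real, Real.norm_eq_abs, abs_of_pos hR,
      pow_succ]
    calc R⁻¹ * ‖∫ x, osc Ψ x * ((dLine e q x : ℝ) : ℂ)‖ ≤ R⁻¹ * (C2 * R⁻¹ ^ N) :=
          mul_le_mul_of_nonneg_left hIH (by positivity)
      _ = _ := by ring
end Osc

namespace Cut
open Phase Osc
variable {n : ℕ}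

/-- basic one dimensional cutoff -/
def θ (t : ℝ) : ℝ := Real.smoothTransition (t + 1) - Real.smoothTransition t

lemma θ_smooth : ContDiff ℝ (⊤ : ℕ∞) θ := by
  unfold θ
  exact (Real.smoothTransition.contDiff.comp (contDiff_id.add contDiff_const)).sub
    Real.smoothTransition.contDiff

lemma θ_abs_le (t : ℝ) : |θ t| ≤ 1 := by
  unfold θ
  rw [abs_le]
  have := Real.smoothTransition.nonneg (t+1)
  have := Real.smoothTransition.nonneg t
  have := Real.smoothTransition.le_one (t+1)
  have := Real.smoothTransition.le_one t
  constructor <;> linarith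

lemma θ_zero {t : ℝ} (h : 1 < |t|) : θ t = 0 := by
  unfold θ
  rcases lt_abs.1 h with h | h
  · rw [Real.smoothTransition.one_of_one_le (by linarith), Real.smoothTransition.one_of_one_le (by linarith)]
    simp
  · rw [Real.smoothTransition.zero_of_nonpos (by linarith), Real.smoothTransition.zero_of_nonpos (by linarith)]
    simp

lemma θ_sum (m : ℕ) (t : ℝ) (ht : |t| ≤ m) : ∑ k ∈ Finset.Icc (-(m:ℤ)) m, θ (t - k) = 1 := by
  have key : ∀ p : ℕ, ∑ k ∈ Finset.Ico (-(m:ℤ)) (-m + p), θ (t - k) =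
      Real.smoothTransition (t + m + 1) - Real.smoothTransition (t + m + 1 - p) := by
    intro p
    induction p with
    | zero => simp
    | succ p ih =>
      have : Finset.Ico (-(m:ℤ)) (-m + (p+1 : ℕ)) = insert (-(m:ℤ) + p) (Finset.Ico (-(m:ℤ)) (-m + p)) := by
        ext x; simp only [Finset.mem_Ico, Finset.mem_insert]; push_cast; omega
      rw [this, Finset.sum_insert (by simp), ih]
      unfold θ
      push_cast
      rw [show t - (-(m:ℝ) + p) + 1 = t + m + 1 - p by ring, show t - (-(m:ℝ) + p) = t + m + 1 - (p + 1) by ring]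
      ring
  have h2 := key (2 * m + 1)
  have : Finset.Ico (-(m:ℤ)) (-m + (2*m+1 : ℕ)) = Finset.Icc (-(m:ℤ)) m := by
    ext x; simp only [Finset.mem_Ico, Finset.mem_Icc]; push_cast; omega
  rw [this] at h2
  rw [h2]
  have := abs_le.1 ht
  rw [Real.smoothTransition.one_of_one_le (by linarith), Real.smoothTransition.zero_of_nonpos (by push_cast; linarith)]
  simp

/-- the lattice point `r k` -/
def pt (r : ℝ) (k : Fin n → ℤ) : EE n := WithLp.toLp 2 fun i => r * (k i : ℝ)

/-- cutoff around the lattice point -/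
def χ (r : ℝ) (k : Fin n → ℤ) (x : EE n) : ℝ := ∏ i, θ (x i / r - k i)

/-- box of lattice points -/
def box (n m : ℕ) : Finset (Fin n → ℤ) := Fintype.piFinset fun _ => Finset.Icc (-(m:ℤ)) m

lemma χ_sum {r : ℝ} (hr : 0 < r) (m : ℕ) (x : EE n) (hx : ‖x‖ ≤ r * m) :
    ∑ k ∈ box n m, χ r k x = 1 := by
  unfold box χ
  rw [Finset.sum_prod_piFinset (Finset.Icc (-(m:ℤ)) m) (fun i k => θ (x i / r - (k:ℝ)))]
  apply Finset.prod_eq_one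
  intro i _
  apply θ_sum
  rw [abs_div, abs_of_pos hr, div_le_iff₀ hr, mul_comm]
  exact (PiLp.norm_apply_le x i).trans hx

lemma χ_smooth (r : ℝ) (k : Fin n → ℤ) : ContDiff ℝ (⊤ : ℕ∞) (χ r k) := by
  unfold χ
  apply contDiff_prod
  intro i _
  apply θ_smooth.comp
  have : ContDiff ℝ (⊤ : ℕ∞) (fun x : EE n => x i) :=
    (EuclideanSpace.proj (𝕜 := ℝ) i : EE n →L[ℝ] ℝ).contDiff
  exact (this.div_const r).sub contDiff_const

lemma χ_abs_le (r : ℝ) (k : Fin n → ℤ) (x : EE n) : |χ r k x| ≤ 1 := by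
  unfold χ
  rw [Finset.abs_prod]
  exact Finset.prod_le_one (fun _ _ => abs_nonneg _) (fun _ _ => θ_abs_le _)

/-- the supporting ball -/
def ball (r : ℝ) (k : Fin n → ℤ) : Set (EE n) := Metric.closedBall (pt r k) (n * r)

lemma χ_ball {r : ℝ} (hr : 0 < r) (k : Fin n → ℤ) (x : EE n) (h : χ r k x ≠ 0) : x ∈ ball r k := by
  have h1 : ∀ i, |x i - r * k i| ≤ r := by
    intro i
    by_contra hc
    push Not at hc
    apply h
    unfold χ
    apply Finset.prod_eq_zero (Finset.mem_univ i)
    apply θ_zero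
    rw [show x i / r - k i = (x i - r * k i) / r by field_simp, abs_div, abs_of_pos hr,
      lt_div_iff₀ hr]
    linarith
  rw [ball, mem_closedBall_iff_norm, vec_sum (x - pt r k)]
  refine (norm_sum_le _ _).trans ?_
  have : ∀ i ∈ Finset.univ, ‖(x - pt r k) i • (EuclideanSpace.single i 1 : EE n)‖ ≤ r := by
    intro i _
    rw [norm_smul]
    simpa [pt] using h1 i
  refine (Finset.sum_le_sum this).trans ?_
  simp

lemma χ_tsupport {r : ℝ} (hr : 0 < r) (k : Fin n → ℤ) : tsupport (χ r k) ⊆ ball r k :=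
  closure_minimal (fun x hx => χ_ball hr k x hx) Metric.isClosed_closedBall

lemma ball_compact (r : ℝ) (k : Fin n → ℤ) : IsCompact (ball r k) := isCompact_closedBall _ _

lemma ball_volume (r : ℝ) (k : Fin n → ℤ) :
    volume.real (ball r k) = volume.real (Metric.closedBall (0 : EE n) (n * r)) := by
  unfold ball
  simp only [Measure.real, Measure.addHaar_closedBall_center]

lemma χ_translate {r : ℝ} (hr : 0 < r) (k : Fin n → ℤ) : χ r k = fun x => χ r 0 (x - pt r k) := by
  funext x
  unfold χ
  apply Finset.prod_congr rfl
  intro i _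
  congr 1
  simp only [pt, PiLp.sub_apply, Pi.zero_apply, Int.cast_zero, sub_zero]
  field_simp

lemma dLine_iter_translate (e v : EE n) (f : EE n → ℝ) (l : ℕ) :
    (dLine e)^[l] (fun x => f (x - v)) = fun x => (dLine e)^[l] f (x - v) := by
  induction l with
  | zero => rfl
  | succ l ih =>
    rw [Function.iterate_succ_apply', ih, Function.iterate_succ_apply']
    funext x
    unfold dLine
    rw [fderiv_comp_sub]

lemma χ_Bd (n : ℕ) {r : ℝ} (hr : 0 < r) (N : ℕ) : ∃ M : ℝ, ∀ (i : Fin n) (k : Fin n → ℤ),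
    Bd (EuclideanSpace.single i 1) N (χ r k) M := by
  have h1 : ∀ (i : Fin n) (l : ℕ), ∃ M : ℝ, ∀ x, |(dLine (EuclideanSpace.single i 1 : EE n))^[l] (χ r 0) x| ≤ M := by
    intro i l
    have hc : HasCompactSupport ((dLine (EuclideanSpace.single i 1 : EE n))^[l] (χ r 0)) := by
      refine (ball_compact r (0 : Fin n → ℤ)).of_isClosed_subset (isClosed_tsupport _) ?_
      induction l with
      | zero => exact χ_tsupport hr 0
      | succ l ih => rw [Function.iterate_succ_apply']; exact dLine_tsupport ih
    obtain ⟨M, hM⟩ := hc.exists_bound_of_continuous (contDiff_dLine_iter (χ_smooth r 0) _ l).continuous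
    exact ⟨M, fun x => hM x⟩
  choose M hM using h1
  refine ⟨∑ i, ∑ l ∈ Finset.range (N+1), |M i l|, ?_⟩
  intro i k l hl x
  rw [χ_translate hr, dLine_iter_translate]
  refine (hM i l _).trans ((le_abs_self _).trans ?_)
  refine (Finset.single_le_sum (f := fun l => |M i l|) (fun _ _ => abs_nonneg _)
    (show l ∈ Finset.range (N+1) by simp; omega)).trans ?_
  exact Finset.single_le_sum (f := fun i => ∑ l ∈ Finset.range (N+1), |M i l|)
    (fun _ _ => Finset.sum_nonneg fun _ _ => abs_nonneg _) (Finset.mem_univ i)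

/-- one dimensional weight -/
def ρ (n : ℕ) (m : ℤ) : ℝ := (1 + |(m:ℝ)|) ^ (-(1 + 1 / (2 * (n:ℝ))))

/-- weight -/
def ω (d : Fin n → ℤ) : ℝ := ∏ i, ρ n (d i)

lemma ρ_nonneg (n : ℕ) (m : ℤ) : 0 ≤ ρ n m := by unfold ρ; positivity
lemma ω_nonneg (d : Fin n → ℤ) : 0 ≤ ω d := Finset.prod_nonneg fun _ _ => ρ_nonneg _ _

lemma ρ_summable (n : ℕ) (hn : 0 < n) : Summable (ρ n) := by
  have hp : (1:ℝ) < 1 + 1 / (2 * (n:ℝ)) := by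
    have : (0:ℝ) < n := by exact_mod_cast hn
    have : 0 < 1 / (2 * (n:ℝ)) := by positivity
    linarith
  have h1 := (Real.summable_abs_int_rpow hp)
  have h2 : Summable (fun m : ℤ => (if m = 0 then (1:ℝ) else 0) + |(m:ℝ)| ^ (-(1 + 1 / (2 * (n:ℝ))))) := by
    apply Summable.add _ h1
    exact (hasSum_ite_eq (0:ℤ) (1:ℝ)).summable
  refine Summable.of_nonneg_of_le (ρ_nonneg n) (fun m => ?_) h2
  unfold ρ
  by_cases hm : m = 0
  · subst hm
    simp
    positivity
  · simp only [hm, if_false, zero_add]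
    apply Real.rpow_le_rpow_of_nonpos
    · have : (0:ℝ) < |(m:ℝ)| := by positivity
      exact this
    · linarith
    · linarith

lemma ω_sum (n : ℕ) : ∃ W : ℝ, 0 ≤ W ∧ ∀ (m : ℕ) (d : Fin n → ℤ), ∑ d' ∈ box n m, ω (d - d') ≤ W := by
  rcases Nat.eq_zero_or_pos n with hn | hn
  · subst hn
    refine ⟨1, by norm_num, fun m d => ?_⟩
    simp [box, ω]
  refine ⟨∏ _i : Fin n, ∑' m, ρ n m, Finset.prod_nonneg fun _ _ => tsum_nonneg (ρ_nonneg n), ?_⟩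
  intro m d
  unfold box ω
  simp only [Pi.sub_apply]
  rw [Finset.sum_prod_piFinset (Finset.Icc (-(m:ℤ)) m) (fun i k => ρ n (d i - k))]
  apply Finset.prod_le_prod
  · intro i _; exact Finset.sum_nonneg fun _ _ => ρ_nonneg _ _
  · intro i _
    have hs : Summable (fun k => ρ n (d i - k)) :=
      ((Equiv.subLeft (d i)).summable_iff (f := ρ n)).2 (ρ_summable n hn)
    have he : ∑' k, ρ n (d i - k) = ∑' k, ρ n k := (Equiv.subLeft (d i)).tsum_eq (ρ n)
    rw [← he]
    exact hs.sum_le_tsum _ (fun _ _ => ρ_nonneg _ _)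

lemma weight_le (d : Fin n → ℤ) (A : ℝ) (hA : 1 ≤ A) (h : ∀ i, 1 + |(d i : ℝ)| ≤ A) :
    (A⁻¹) ^ (2 * n + 1) ≤ ω d ^ 2 := by
  rcases Nat.eq_zero_or_pos n with hn | hn
  · subst hn
    simp [ω]
    exact inv_le_one_of_one_le₀ hA
  have hn' : (0:ℝ) < n := by exact_mod_cast hn
  have h1 : ∏ _i : Fin n, A ^ (-(1 + 1 / (2 * (n:ℝ)))) ≤ ω d := by
    unfold ω
    apply Finset.prod_le_prod
    · intro i _; positivity
    · intro i _
      unfold ρ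
      apply Real.rpow_le_rpow_of_nonpos
      · positivity
      · exact h i
      · have : 0 < 1 / (2 * (n:ℝ)) := by positivity
        linarith
  have h0 : (0:ℝ) ≤ A := by linarith
  have h2 : (A⁻¹) ^ (2 * n + 1) = (∏ _i : Fin n, A ^ (-(1 + 1 / (2 * (n:ℝ))))) ^ 2 := by
    rw [Finset.prod_const, Finset.card_univ, Fintype.card_fin, ← pow_mul, inv_pow, ← Real.rpow_natCast,
      ← Real.rpow_natCast, ← Real.rpow_neg h0, ← Real.rpow_mul h0]
    congr 1
    push_cast
    field_simp
  rw [h2]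
  exact pow_le_pow_left₀ (Finset.prod_nonneg fun _ _ => by positivity) h1 2

end Cut

namespace AF
open Phase Osc Cut
variable {n : ℕ}

lemma iter_right {φ : EE n × EE n → ℝ} (h : ContDiff ℝ (⊤ : ℕ∞) φ) (y : EE n) (i : Fin n) (l : ℕ) :
    (dLine (EuclideanSpace.single i 1 : EE n))^[l] (fun ξ => φ (y, ξ)) =
      fun ξ => (dLine (dY i))^[l] φ (y, ξ) := by
  induction l with
  | zero => rfl
  | succ l ih =>
    rw [Function.iterate_succ_apply', ih]
    funext ξ
    rw [Function.iterate_succ_apply']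
    exact fderiv_right ((contDiff_dLine_iter h _ l).differentiable (by simp)) y ξ _

lemma lattice_dist {r : ℝ} (hr : 0 < r) (j j' : Fin n → ℤ) (y y' : EE n) (hy : y' ∈ ball r j)
    (hy' : y ∈ ball r j') (i : Fin n) :
    1 + |(((j - j') i : ℤ) : ℝ)| ≤ 1 + 2 * n + ‖y - y'‖ / r := by
  rw [ball, mem_closedBall_iff_norm] at hy hy'
  have h1 : |r * (j i : ℝ) - r * (j' i : ℝ)| ≤ ‖pt r j - pt r j'‖ := PiLp.norm_apply_le (pt r j - pt r j') i
  have h2 : ‖pt r j - pt r j'‖ ≤ ‖y' - pt r j‖ + ‖y - y'‖ + ‖y - pt r j'‖ := by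
    have : pt r j - pt r j' = -(y' - pt r j) - (y - y') + (y - pt r j') := by abel
    rw [this]
    refine (norm_add_le _ _).trans (add_le_add_left ((norm_sub_le _ _).trans ?_) _)
    rw [norm_neg]
  rw [← mul_sub, abs_mul, abs_of_pos hr] at h1
  have h3 : |(j i : ℝ) - j' i| ≤ 2 * n + ‖y - y'‖ / r := by
    rw [← mul_le_mul_iff_right₀ hr]
    have : r * (2 * n + ‖y - y'‖ / r) = 2 * (n * r) + ‖y - y'‖ := by field_simp
    linarith
  simp only [Pi.sub_apply, Int.cast_sub]
  linarith

theorem kernel_bound (n : ℕ) (c L : ℝ) (hc : 0 < c) (hL : 0 ≤ L) : ∃ r C : ℝ, 0 < r ∧ 0 ≤ C ∧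
    ∀ φ, Facts n c L φ → ∀ (j j' k k' : Fin n → ℤ) (y y' : EE n),
    |χ r j y'| * |χ r j' y| * ‖∫ ξ, osc (fun ξ => φ (y, ξ) - φ (y', ξ)) ξ *
      ((χ r k ξ * χ r k' ξ : ℝ) : ℂ)‖ ≤ C * (ω (j - j') * ω (k - k')) ^ 2 := by
  set r : ℝ := c / (2 * (L * n + 1)) with hrdef
  have hr : 0 < r := by positivity
  have hLr : L * (n * r) ≤ c / 2 := by
    rw [hrdef]
    have : L * (n * (c / (2 * (L * n + 1)))) = c / 2 * ((L * n) / (L * n + 1)) := by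
      field_simp
    rw [this]
    have h1 : (L * n) / (L * n + 1) ≤ 1 := by
      rw [div_le_one (by positivity)]; linarith
    nlinarith
  set V : ℝ := volume.real (Metric.closedBall (0 : EE n) (n * r)) with hV
  have hV0 : 0 ≤ V := measureReal_nonneg
  set N : ℕ := 2 * n + 1 with hN
  obtain ⟨M, hM⟩ := χ_Bd n hr N
  obtain ⟨C1, hC1⟩ := nonstationary (n := n) N (2 ^ N * (M * M)) L (c / 2) V (by positivity)
  set Q : ℝ := 1 + 2 * n + 1 / r with hQ
  have hQ0 : 0 < Q := by positivity
  set E : ℝ := max V |C1| * Q ^ N with hE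
  have hE0 : 0 ≤ E := by positivity
  refine ⟨r, E * (1 + 2 * n) ^ N, hr, by positivity, ?_⟩
  intro φ hφ j j' k k' y y'
  set Ψ : EE n → ℝ := fun ξ => φ (y, ξ) - φ (y', ξ) with hΨ
  have hs1 : ∀ y, ContDiff ℝ (⊤ : ℕ∞) (fun ξ => φ (y, ξ)) := fun y => hφ.smooth.comp (by fun_prop)
  have hΨs : ContDiff ℝ (⊤ : ℕ∞) Ψ := (hs1 y).sub (hs1 y')
  set b : EE n → ℝ := fun ξ => χ r k ξ * χ r k' ξ with hb
  have hbs : ContDiff ℝ (⊤ : ℕ∞) b := (χ_smooth r k).mul (χ_smooth r k')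
  have hbS : tsupport b ⊆ ball r k :=
    (tsupport_mul_subset_left (f := χ r k) (g := χ r k')).trans (χ_tsupport hr k)
  set R : ℝ := ‖y - y'‖ with hR
  have hR0 : 0 ≤ R := norm_nonneg _
  set A : ℝ := 1 + 2 * n + R / r with hA
  have hA1 : 1 ≤ A := by
    have : 0 ≤ R / r := by positivity
    have : (0:ℝ) ≤ n := by positivity
    rw [hA]; linarith
  have hint : ‖∫ ξ, osc Ψ ξ * (b ξ : ℂ)‖ ≤ E * (A⁻¹) ^ N := by
    rcases le_total R 1 with hR1 | hR1
    · have h1 : ‖∫ ξ, osc Ψ ξ * (b ξ : ℂ)‖ ≤ V := by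
        rw [← setIntegral_eq_integral_of_forall_compl_eq_zero (s := ball r k)]
        · have := norm_setIntegral_le_of_norm_le_const (μ := (volume : Measure (EE n))) (s := ball r k)
            (f := fun x => osc Ψ x * (b x : ℂ)) (C := 1)
            (ball_compact r k).measure_lt_top ?_
          · rw [ball_volume, one_mul] at this
            exact this
          · intro x _
            rw [norm_mul, norm_osc, one_mul]
            simp only [hb, Complex.norm_real, Real.norm_eq_abs, abs_mul]
            exact mul_le_one₀ (χ_abs_le _ _ _) (abs_nonneg _) (χ_abs_le _ _ _)
        · intro x hx
          simp [eq_zero_of_tsupport hbS hx]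
      have hAQ : A ≤ Q := by
        rw [hA, hQ]; gcongr
      have h2 : 1 ≤ Q * A⁻¹ := by
        rw [le_mul_inv_iff₀ (by linarith)]; linarith
      calc _ ≤ V := h1
        _ ≤ max V |C1| * (Q * A⁻¹) ^ N := by
          have := one_le_pow₀ h2 (n := N)
          have h3 : V ≤ max V |C1| := le_max_left _ _
          nlinarith
        _ = _ := by rw [mul_pow, hE]; ring
    · have hne : y ≠ y' := by
        intro h; rw [hR, h] at hR1; simp at hR1; linarith
      obtain ⟨i, hi⟩ := hφ.p1 y y' (pt r k) hne
      have hd1 : ∀ l x, (dLine (EuclideanSpace.single i 1 : EE n))^[l] Ψ x =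
          (dLine (dY i))^[l] φ (y, x) - (dLine (dY i))^[l] φ (y', x) := by
        intro l x
        rw [hΨ, dLine_iter_sub (hs1 y) (hs1 y'), iter_right hφ.smooth, iter_right hφ.smooth]
      have h1 := hC1 (EuclideanSpace.single i 1) Ψ b (ball r k) R (by linarith) hΨs hbs
        (ball_compact r k) (ball_volume r k).le hbS ?_ ?_ ?_
      · have hAQ : A ≤ R * Q := by
          rw [hA, hQ]
          have : R * (1 + 2 * n + 1 / r) = R * (1 + 2 * n) + R / r := by ring
          rw [this]
          have : (0:ℝ) ≤ n := by positivity
          nlinarith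
        have h2 : R⁻¹ ≤ Q * A⁻¹ := by
          rw [inv_le_iff_one_le_mul₀ (by linarith), mul_assoc, mul_comm, mul_assoc, mul_comm _ Q]
          rw [inv_mul_eq_div, le_div_iff₀ (by linarith)]
          linarith
        calc _ ≤ C1 * R⁻¹ ^ N := h1
          _ ≤ max V |C1| * (Q * A⁻¹) ^ N := by
            apply mul_le_mul ((le_abs_self _).trans (le_max_right _ _)) _ (by positivity) (by positivity)
            exact pow_le_pow_left₀ (by positivity) h2 N
          _ = _ := by rw [mul_pow, hE]; ring
      · intro x hx
        have h3 := hφ.p3 i y y' (pt r k) x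
        have h4 := hd1 1 x
        simp only [Function.iterate_one] at h4
        rw [h4]
        rw [ball, mem_closedBall_iff_norm] at hx
        rw [norm_sub_rev] at hx
        have h5 : L * R * ‖pt r k - x‖ ≤ c / 2 * R := by
          have : L * R * ‖pt r k - x‖ ≤ L * R * (n * r) := by gcongr
          nlinarith
        have h6 := abs_sub_abs_le_abs_sub (dLine (dY i) φ (y, pt r k) - dLine (dY i) φ (y', pt r k))
          (dLine (dY i) φ (y, x) - dLine (dY i) φ (y', x))
        linarith
      · exact Bd.mul (χ_smooth r k) (χ_smooth r k') (hM i k) (hM i k')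
      · intro l hl x
        have h4 := hd1 (l+1) x
        rw [Function.iterate_succ_apply] at h4
        rw [h4]
        exact hφ.p2 i l hl y y' x
  have hω : 0 ≤ (ω (j - j') * ω (k - k')) ^ 2 := by positivity
  by_cases hz : χ r j y' = 0 ∨ χ r j' y = 0 ∨ ∀ ξ, b ξ = 0
  · have : |χ r j y'| * |χ r j' y| * ‖∫ ξ, osc Ψ ξ * (b ξ : ℂ)‖ = 0 := by
      rcases hz with h | h | h <;> simp [h]
    rw [this]
    positivity
  push Not at hz
  obtain ⟨hz1, hz2, ξ, hξ⟩ := hz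
  have hj : (A⁻¹) ^ N ≤ ω (j - j') ^ 2 :=
    weight_le _ _ hA1 (fun i => lattice_dist hr j j' y y' (χ_ball hr _ _ hz1) (χ_ball hr _ _ hz2) i)
  have hk : ((1 + 2 * (n:ℝ))⁻¹) ^ N ≤ ω (k - k') ^ 2 := by
    apply weight_le
    · have : (0:ℝ) ≤ n := by positivity
      linarith
    · intro i
      have := lattice_dist hr k k' ξ ξ (χ_ball hr _ _ (left_ne_zero_of_mul hξ))
        (χ_ball hr _ _ (right_ne_zero_of_mul hξ)) i
      simpa using this
  have hk' : 1 ≤ (1 + 2 * (n:ℝ)) ^ N * ω (k - k') ^ 2 := by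
    rw [inv_pow, inv_le_iff_one_le_mul₀ (by positivity)] at hk
    linarith
  calc |χ r j y'| * |χ r j' y| * ‖∫ ξ, osc Ψ ξ * (b ξ : ℂ)‖ ≤ 1 * ‖∫ ξ, osc Ψ ξ * (b ξ : ℂ)‖ := by
        gcongr
        exact mul_le_one₀ (χ_abs_le _ _ _) (abs_nonneg _) (χ_abs_le _ _ _)
    _ ≤ E * ω (j - j') ^ 2 := by
        rw [one_mul]; exact hint.trans (mul_le_mul_of_nonneg_left hj hE0)
    _ ≤ E * ω (j - j') ^ 2 * ((1 + 2 * (n:ℝ)) ^ N * ω (k - k') ^ 2) :=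
        le_mul_of_one_le_right (by positivity) hk'
    _ = _ := by ring
end AF

namespace AF
open Phase Osc Cut
variable {n : ℕ}

instance nontrivial_HH (n : ℕ) : Nontrivial (HH n) := by
  have hm : MeasurableSet (Metric.closedBall (0 : EE n) 1) := Metric.isClosed_closedBall.measurableSet
  have hf : volume (Metric.closedBall (0 : EE n) 1) ≠ ⊤ := (isCompact_closedBall _ _).measure_lt_top.ne
  have hp : 0 < volume (Metric.closedBall (0 : EE n) 1) := Metric.measure_closedBall_pos _ _ one_pos
  refine nontrivial_of_ne (indicatorConstLp 2 hm hf (1:ℂ)) 0 fun h => ?_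
  have h2 := norm_indicatorConstLp (p := 2) (hs := hm) (hμs := hf) (c := (1:ℂ)) (by norm_num) (by norm_num)
  rw [h, norm_zero, norm_one, one_mul] at h2
  have : 0 < volume.real (Metric.closedBall (0 : EE n) 1) := ENNReal.toReal_pos hp.ne' hf
  have := Real.rpow_pos_of_pos this (1 / (2:ℝ≥0∞).toReal)
  linarith

/-- localized kernels -/
def kk (φ : EE n × EE n → ℝ) (hφ : Continuous φ) (r : ℝ) (hr : 0 < r)
    (p : (Fin n → ℤ) × (Fin n → ℤ)) : Ker n where
  k := fun ξ y => (χ r p.2 ξ : ℂ) * osc (fun ξ => φ (y, ξ)) ξ * (χ r p.1 y : ℂ)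
  P := ball r p.2
  Q := ball r p.1
  hP := ball_compact r p.2
  hQ := ball_compact r p.1
  cont := by
    have h1 : Continuous (χ r p.1) := (χ_smooth r p.1).continuous
    have h2 : Continuous (χ r p.2) := (χ_smooth r p.2).continuous
    unfold osc
    fun_prop
  supp := fun ξ y h => by
    by_cases h1 : χ r p.2 ξ = 0
    · simp [h1]
    by_cases h2 : χ r p.1 y = 0
    · simp [h2]
    exact absurd ⟨χ_ball hr _ _ h1, χ_ball hr _ _ h2⟩ h

lemma ω_neg (d d' : Fin n → ℤ) : ω (d - d') = ω (d' - d) := by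
  unfold ω ρ
  refine Finset.prod_congr rfl fun i _ => ?_
  simp only [Pi.sub_apply]
  push_cast
  rw [abs_sub_comm]

lemma conj_osc (Ψ : EE n → ℝ) (x : EE n) : (starRingEnd ℂ) (osc Ψ x) = Complex.exp (-(Complex.I * (Ψ x : ℂ))) := by
  unfold osc
  rw [← Complex.exp_conj]
  simp

lemma kk_star_mul {φ : EE n × EE n → ℝ} (hφ : Continuous φ) {r : ℝ} (hr : 0 < r)
    (p p' : (Fin n → ℤ) × (Fin n → ℤ)) (y' y : EE n) :
    ‖∫ ξ, (starRingEnd ℂ) ((kk φ hφ r hr p').k ξ y') * (kk φ hφ r hr p).k ξ y‖ =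
    |χ r p'.1 y'| * |χ r p.1 y| * ‖∫ ξ, osc (fun ξ => φ (y, ξ) - φ (y', ξ)) ξ *
      ((χ r p'.2 ξ * χ r p.2 ξ : ℝ) : ℂ)‖ := by
  have : ∀ ξ, (starRingEnd ℂ) ((kk φ hφ r hr p').k ξ y') * (kk φ hφ r hr p).k ξ y =
      ((χ r p'.1 y' * χ r p.1 y : ℝ) : ℂ) * (osc (fun ξ => φ (y, ξ) - φ (y', ξ)) ξ *
      ((χ r p'.2 ξ * χ r p.2 ξ : ℝ) : ℂ)) := by
    intro ξ
    simp only [kk, map_mul, conj_osc, Complex.conj_ofReal]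
    have : osc (fun ξ => φ (y, ξ) - φ (y', ξ)) ξ = Complex.exp (-(Complex.I * (φ (y', ξ) : ℂ))) *
        osc (fun ξ => φ (y, ξ)) ξ := by
      unfold osc
      rw [← Complex.exp_add]
      congr 1
      push_cast; ring
    rw [this]
    push_cast
    ring
  simp_rw [this]
  rw [integral_const_mul, norm_mul, Complex.norm_real, Real.norm_eq_abs, abs_mul]

lemma kk_mul_star {φ : EE n × EE n → ℝ} (hφ : Continuous φ) {r : ℝ} (hr : 0 < r)
    (p p' : (Fin n → ℤ) × (Fin n → ℤ)) (ξ ξ' : EE n) :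
    ‖∫ y, (kk φ hφ r hr p).k ξ y * (starRingEnd ℂ) ((kk φ hφ r hr p').k ξ' y)‖ =
    |χ r p'.2 ξ'| * |χ r p.2 ξ| * ‖∫ y, osc (fun y => (φ ∘ sw n) (ξ, y) - (φ ∘ sw n) (ξ', y)) y *
      ((χ r p'.1 y * χ r p.1 y : ℝ) : ℂ)‖ := by
  have : ∀ y, (kk φ hφ r hr p).k ξ y * (starRingEnd ℂ) ((kk φ hφ r hr p').k ξ' y) =
      ((χ r p'.2 ξ' * χ r p.2 ξ : ℝ) : ℂ) * (osc (fun y => (φ ∘ sw n) (ξ, y) - (φ ∘ sw n) (ξ', y)) y *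
      ((χ r p'.1 y * χ r p.1 y : ℝ) : ℂ)) := by
    intro y
    simp only [kk, map_mul, conj_osc, Complex.conj_ofReal]
    have : osc (fun y => (φ ∘ sw n) (ξ, y) - (φ ∘ sw n) (ξ', y)) y =
        Complex.exp (-(Complex.I * (φ (y, ξ') : ℂ))) * osc (fun ξ => φ (y, ξ)) ξ := by
      unfold osc
      rw [← Complex.exp_add]
      congr 1
      change Complex.I * ((φ (y, ξ) - φ (y, ξ') : ℝ) : ℂ) = _
      push_cast; ring
    rw [this]
    push_cast
    ring
  simp_rw [this]
  rw [integral_const_mul, norm_mul, Complex.norm_real, Real.norm_eq_abs, abs_mul]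

set_option maxHeartbeats 1000000 in
theorem kk_sum_bound (n : ℕ) (C₀ : ℝ) (hC₀ : 0 < C₀) (Cph : (Fin n → ℕ) → ℝ) :
    ∃ r Λ : ℝ, ∃ hr : 0 < r, 0 ≤ Λ ∧ ∀ φ, (H : Hyp n C₀ Cph φ) → ∀ m : ℕ,
      ‖∑ p ∈ box n m ×ˢ box n m, (kk φ H.smooth.continuous r hr p).op‖ ≤ Λ := by
  obtain ⟨c, L, hc, hL, hF⟩ := facts_of_hyp n C₀ hC₀ Cph
  obtain ⟨r, C, hr, hC, hK⟩ := kernel_bound n c L hc hL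
  obtain ⟨W, hW0, hW⟩ := ω_sum n
  set V := volume.real (Metric.closedBall (0 : EE n) (n * r)) with hV
  have hV0 : 0 ≤ V := measureReal_nonneg
  refine ⟨r, √(C * V) * (W * W), hr, by positivity, fun φ H m => ?_⟩
  set g : ((Fin n → ℤ) × (Fin n → ℤ)) → ((Fin n → ℤ) × (Fin n → ℤ)) → ℝ := fun p p' =>
    √(C * V) * (ω (p.1 - p'.1) * ω (p.2 - p'.2)) with hg
  have hg2 : ∀ p p', g p p' ^ 2 = C * (ω (p.1 - p'.1) * ω (p.2 - p'.2)) ^ 2 * V := by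
    intro p p'
    rw [hg]
    simp only
    rw [mul_pow, Real.sq_sqrt (by positivity)]; ring
  have h1 : ∀ i j, ‖star (kk φ H.smooth.continuous r hr i).op * (kk φ H.smooth.continuous r hr j).op‖ ≤ g i j ^ 2 := by
    intro i j
    rw [hg2]
    refine Ker.norm_star_mul_le _ _ (ball_volume _ _).le (ball_volume _ _).le fun y' y => ?_
    rw [kk_star_mul]
    exact hK φ (hF φ H) _ _ _ _ _ _
  refine CotlarAux.cotlar (A := HH n →L[ℂ] HH n) (box n m ×ˢ box n m)
    (fun p => (kk φ H.smooth.continuous r hr p).op) g ?_ h1 ?_ ?_ (by positivity) (B := √(C * V) * (ω (0 : Fin n → ℤ) * ω (0 : Fin n → ℤ))) ?_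
  · intro i j
    have := ω_nonneg (i.1 - j.1)
    have := ω_nonneg (i.2 - j.2)
    positivity
  · intro i j
    rw [hg2]
    refine Ker.norm_mul_star_le _ _ (ball_volume _ _).le (ball_volume _ _).le fun ξ ξ' => ?_
    rw [kk_mul_star, ω_neg i.1, ω_neg i.2, mul_comm (ω _)]
    exact hK _ (hF _ H.swap) _ _ _ _ _ _
  · intro i
    rw [hg, ← Finset.mul_sum, Finset.sum_product]
    refine mul_le_mul_of_nonneg_left ?_ (Real.sqrt_nonneg _)
    simp only
    rw [← Finset.sum_mul_sum]
    exact mul_le_mul (hW m i.1) (hW m i.2) (Finset.sum_nonneg fun _ _ => ω_nonneg _) hW0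
  · intro i
    have := h1 i i
    have e : ‖star (kk φ H.smooth.continuous r hr i).op * (kk φ H.smooth.continuous r hr i).op‖ =
        ‖(kk φ H.smooth.continuous r hr i).op‖ * ‖(kk φ H.smooth.continuous r hr i).op‖ :=
      CStarRing.norm_star_mul_self (x := (kk φ H.smooth.continuous r hr i).op)
    have e2 : g i i = √(C * V) * (ω (0 : Fin n → ℤ) * ω (0 : Fin n → ℤ)) := by
      simp only [hg, sub_self]
    rw [e, e2, ← pow_two] at this
    have h0 := ω_nonneg (0 : Fin n → ℤ)
    exact le_of_sq_le_sq this (by positivity)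

lemma sum_op_coe {ι : Type*} (s : Finset ι) (κ : ι → Ker n) {u : EE n → ℂ} (hu : MemLp u 2 volume) :
    ((∑ p ∈ s, (κ p).op) hu.toLp : EE n → ℂ) =ᵐ[volume] fun ξ => ∑ p ∈ s, (κ p).app u ξ := by
  classical
  induction s using Finset.induction_on with
  | empty =>
    simp only [Finset.sum_empty]
    exact Lp.coeFn_zero _ _ _
  | insert a s ha ih =>
    rw [Finset.sum_insert ha]
    rw [add_apply]
    filter_upwards [Lp.coeFn_add ((κ a).op hu.toLp) ((∑ p ∈ s, (κ p).op) hu.toLp), ih, (κ a).op_coe hu.toLp]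
      with ξ h1 h2 h3
    rw [h1, Pi.add_apply, h2, h3, Finset.sum_insert ha]
    congr 1
    unfold Ker.app
    refine integral_congr_ae ?_
    filter_upwards [hu.coeFn_toLp] with y hy
    rw [hy]

lemma sum_app_norm {ι : Type*} (s : Finset ι) (κ : ι → Ker n) {Λ : ℝ} (h : ‖∑ p ∈ s, (κ p).op‖ ≤ Λ)
    {u : EE n → ℂ} (hu : MemLp u 2 volume) :
    eLpNorm (fun ξ => ∑ p ∈ s, (κ p).app u ξ) 2 volume ≤ ENNReal.ofReal Λ * eLpNorm u 2 volume := by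
  have h1 : eLpNorm (fun ξ => ∑ p ∈ s, (κ p).app u ξ) 2 volume = ‖(∑ p ∈ s, (κ p).op) hu.toLp‖ₑ := by
    rw [Lp.enorm_def]
    exact (eLpNorm_congr_ae (sum_op_coe s κ hu)).symm
  have h2 : eLpNorm u 2 volume = ‖hu.toLp‖ₑ := by
    rw [Lp.enorm_def]
    exact (eLpNorm_congr_ae hu.coeFn_toLp).symm
  rw [h1, h2, ← ofReal_norm, ← ofReal_norm, ← ENNReal.ofReal_mul ((norm_nonneg _).trans h)]
  refine ENNReal.ofReal_le_ofReal ?_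
  exact ((∑ p ∈ s, (κ p).op).le_opNorm _).trans (mul_le_mul_of_nonneg_right h (norm_nonneg _))

/-- the oscillatory integral operator without amplitude -/
def fop (φ : EE n × EE n → ℝ) (u : EE n → ℂ) (ξ : EE n) : ℂ := ∫ y, osc (fun ξ => φ (y, ξ)) ξ * u y

lemma fop_integrable {φ : EE n × EE n → ℝ} (hφ : Continuous φ) {u : EE n → ℂ} (hu : Integrable u) (ξ : EE n) :
    Integrable (fun y => osc (fun ξ => φ (y, ξ)) ξ * u y) := by
  have hc : Continuous (fun y => osc (fun ξ => φ (y, ξ)) ξ) := by unfold osc; fun_prop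
  refine hu.bdd_mul (c := 1) hc.aestronglyMeasurable ?_
  exact Filter.Eventually.of_forall fun y => (norm_osc _ _).le

theorem part1 (n : ℕ) (C₀ : ℝ) (hC₀ : 0 < C₀) (Cph : (Fin n → ℕ) → ℝ) :
    ∃ Λ : ℝ, 0 ≤ Λ ∧ ∀ φ, Hyp n C₀ Cph φ → ∀ u : EE n → ℂ, Integrable u → MemLp u 2 volume →
      eLpNorm (fop φ u) 2 volume ≤ ENNReal.ofReal Λ * eLpNorm u 2 volume := by
  obtain ⟨r, Λ, hr, hΛ, hmain⟩ := kk_sum_bound n C₀ hC₀ Cph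
  refine ⟨Λ, hΛ, fun φ H u hu1 hu2 => ?_⟩
  have hφ := H.smooth.continuous
  set S : ℕ → Set (EE n) := fun m => Metric.closedBall 0 (r * m) with hS
  have hSm : ∀ m, MeasurableSet (S m) := fun m => Metric.isClosed_closedBall.measurableSet
  set um : ℕ → EE n → ℂ := fun m => (S m).indicator u with hum
  have hum2 : ∀ m, MemLp (um m) 2 volume := fun m => hu2.indicator (hSm m)
  set fm : ℕ → EE n → ℂ := fun m ξ => ∑ p ∈ box n m ×ˢ box n m, (kk φ hφ r hr p).app (um m) ξ with hfm
  have hle : ∀ m, eLpNorm (fm m) 2 volume ≤ ENNReal.ofReal Λ * eLpNorm u 2 volume := fun m =>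
    (sum_app_norm _ _ (hmain φ H m) (hum2 m)).trans (by gcongr; exact eLpNorm_indicator_le _)
  have hlarge : ∀ x : EE n, ∀ᶠ m : ℕ in Filter.atTop, x ∈ S m := by
    intro x
    obtain ⟨M, hM⟩ := exists_nat_ge (‖x‖ / r)
    filter_upwards [Filter.eventually_ge_atTop M] with m hm
    rw [hS, mem_closedBall_zero_iff]
    rw [div_le_iff₀ hr] at hM
    have : (M:ℝ) ≤ m := by exact_mod_cast hm
    nlinarith
  have hlim : ∀ ξ, Filter.Tendsto (fun m => fm m ξ) Filter.atTop (nhds (fop φ u ξ)) := by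
    intro ξ
    have h1 : Filter.Tendsto (fun m => fop φ (um m) ξ) Filter.atTop (nhds (fop φ u ξ)) := by
      refine tendsto_integral_of_dominated_convergence (fun y => ‖u y‖) ?_ hu1.norm ?_ ?_
      · exact fun m => (fop_integrable hφ (hu1.indicator (hSm m)) ξ).1
      · intro m
        refine Filter.Eventually.of_forall fun y => ?_
        rw [norm_mul, norm_osc, one_mul]
        exact norm_indicator_le_norm_self _ _
      · refine Filter.Eventually.of_forall fun y => ?_
        refine tendsto_const_nhds.congr' ?_
        filter_upwards [hlarge y] with m hm
        rw [hum]; simp only [Set.indicator_of_mem hm]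
    refine h1.congr' ?_
    filter_upwards [hlarge ξ] with m hm
    rw [hfm]
    simp only [Ker.app, fop]
    rw [← integral_finsetSum _ (fun p _ => (kk φ hφ r hr p).integrable_app (hum2 m) ξ)]
    refine integral_congr_ae (Filter.Eventually.of_forall fun y => ?_)
    simp only [hum]
    by_cases hy : y ∈ S m
    · have e1 := χ_sum hr m ξ (mem_closedBall_zero_iff.1 hm)
      have e2 := χ_sum hr m y (mem_closedBall_zero_iff.1 hy)
      rw [← Finset.sum_mul]
      congr 1
      simp only [kk]
      rw [Finset.sum_product]
      simp only
      have e3 : ∀ x ∈ box n m, ∑ x_1 ∈ box n m, (χ r x_1 ξ : ℂ) * osc (fun ξ => φ (y, ξ)) ξ * (χ r x y : ℂ) =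
        osc (fun ξ => φ (y, ξ)) ξ * (χ r x y : ℂ) := by
        intro x _
        rw [← Finset.sum_mul, ← Finset.sum_mul, ← Complex.ofReal_sum, e1]; simp
      rw [Finset.sum_congr rfl e3, ← Finset.mul_sum, ← Complex.ofReal_sum, e2]; simp
    · simp [Set.indicator_of_notMem hy]
  refine (Lp.eLpNorm_lim_le_liminf_eLpNorm (f := fm) ?_ _ (Filter.Eventually.of_forall hlim)).trans ?_
  · intro m
    refine Continuous.aestronglyMeasurable ?_
    exact continuous_finsetSum _ fun p _ => (kk φ hφ r hr p).continuous_app (hum2 m)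
  · refine (Filter.liminf_le_liminf (Filter.Eventually.of_forall hle)).trans ?_
    simp

end AF

namespace Childs
variable {n : ℕ}

/-- all directions of the phase space -/
abbrev II (n : ℕ) := Fin n ⊕ Fin n

/-- phase space -/
abbrev WW (n : ℕ) := EE n × EE n

/-- coordinate directions -/
def dd (i : II n) : WW n := Sum.elim dX dY i

/-- coordinates -/
def cc (i : II n) (z : WW n) : ℝ := Sum.elim (fun i => z.1 i) (fun j => z.2 j) i

/-- product functions -/
def PP (f : II n → ℝ → ℝ) (z : WW n) : ℝ := ∏ i, f i (cc i z)

/-- dual difference -/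
def shift (h : ℝ) (f : ℝ → ℝ) : ℝ → ℝ := fun t => f (t - h) - f t

lemma cc_sub (i k : II n) (h : ℝ) (z : WW n) :
    cc i (z - h • dd k) = if i = k then cc i z - h else cc i z := by
  rcases i with i | i <;> rcases k with k | k
  · simp only [cc, dd, dX, Sum.elim_inl, Prod.fst_sub, Prod.smul_fst, PiLp.sub_apply, PiLp.smul_apply,
      PiLp.single_apply, Sum.inl.injEq, smul_eq_mul]
    split_ifs <;> simp
  · simp [cc, dd, dY]
  · simp [cc, dd, dX]
  · simp only [cc, dd, dY, Sum.elim_inr, Prod.snd_sub, Prod.smul_snd, PiLp.sub_apply, PiLp.smul_apply,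
      PiLp.single_apply, Sum.inr.injEq, smul_eq_mul]
    split_ifs <;> simp

lemma PP_update (f : II n → ℝ → ℝ) (k : II n) (g : ℝ → ℝ) (z : WW n) :
    PP (Function.update f k g) z = g (cc k z) * ∏ i ∈ Finset.univ.erase k, f i (cc i z) := by
  unfold PP
  rw [← Finset.mul_prod_erase Finset.univ _ (Finset.mem_univ k), Function.update_self]
  congr 1
  refine Finset.prod_congr rfl fun i hi => ?_
  rw [Function.update_of_ne (Finset.ne_of_mem_erase hi)]

lemma PP_shift (f : II n → ℝ → ℝ) (k : II n) (h : ℝ) (z : WW n) :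
    PP f (z - h • dd k) - PP f z = PP (Function.update f k (shift h (f k))) z := by
  rw [PP_update]
  unfold PP
  rw [← Finset.mul_prod_erase Finset.univ _ (Finset.mem_univ k),
    ← Finset.mul_prod_erase Finset.univ (fun i => f i (cc i z)) (Finset.mem_univ k)]
  have : ∏ i ∈ Finset.univ.erase k, f i (cc i (z - h • dd k)) = ∏ i ∈ Finset.univ.erase k, f i (cc i z) := by
    refine Finset.prod_congr rfl fun i hi => ?_
    rw [cc_sub, if_neg (Finset.ne_of_mem_erase hi)]
  rw [this, cc_sub, if_pos rfl, shift]
  ring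

lemma integrable_prod_E {f : Fin n → ℝ → ℝ} (hf : ∀ i, Integrable (f i)) :
    Integrable (fun x : EE n => ∏ i, f i (x i)) := by
  have h := Integrable.fintype_prod (f := f) hf
  have h2 := (EuclideanSpace.volume_preserving_symm_measurableEquiv_toLp (Fin n)).symm
  have h3 := (EuclideanSpace.volume_preserving_symm_measurableEquiv_toLp (Fin n)).integrable_comp_emb
    (MeasurableEquiv.measurableEmbedding _) (g := fun x : Fin n → ℝ => ∏ i, f i (x i))
  exact h3.2 h

lemma integral_prod_E (f : Fin n → ℝ → ℝ) :
    ∫ x : EE n, ∏ i, f i (x i) = ∏ i, ∫ t, f i t := by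
  rw [← integral_fintype_prod_volume_eq_prod]
  exact (EuclideanSpace.volume_preserving_symm_measurableEquiv_toLp (Fin n)).integral_comp
    (MeasurableEquiv.measurableEmbedding _) (fun x : Fin n → ℝ => ∏ i, f i (x i))

lemma PP_eq (f : II n → ℝ → ℝ) (z : WW n) :
    PP f z = (∏ i, f (Sum.inl i) (z.1 i)) * ∏ j, f (Sum.inr j) (z.2 j) := by
  unfold PP
  rw [Fintype.prod_sum_type]
  rfl

lemma integrable_PP {f : II n → ℝ → ℝ} (hf : ∀ i, Integrable (f i)) : Integrable (PP f) := by
  have : PP f = fun z : EE n × EE n => (∏ i, f (Sum.inl i) (z.1 i)) * ∏ j, f (Sum.inr j) (z.2 j) :=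
    funext (PP_eq f)
  rw [this]
  exact Integrable.mul_prod (integrable_prod_E fun i => hf (Sum.inl i))
    (integrable_prod_E fun i => hf (Sum.inr i))

lemma integral_PP (f : II n → ℝ → ℝ) : ∫ z, PP f z = ∏ i, ∫ t, f i t := by
  have : PP f = fun z : EE n × EE n => (∏ i, f (Sum.inl i) (z.1 i)) * ∏ j, f (Sum.inr j) (z.2 j) :=
    funext (PP_eq f)
  rw [this, Fintype.prod_sum_type, ← integral_prod_E, ← integral_prod_E]
  exact integral_prod_mul (fun x : EE n => ∏ i, f (Sum.inl i) (x i)) (fun x : EE n => ∏ i, f (Sum.inr i) (x i))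

/-- bounded continuous functions -/
def Good (g : WW n → ℂ) : Prop := Continuous g ∧ ∃ M, ∀ z, ‖g z‖ ≤ M

lemma Good.dDiff {g : WW n → ℂ} (h : Good g) (v : WW n) : Good (dDiff v g) := by
  obtain ⟨h1, M, h2⟩ := h
  refine ⟨?_, M + M, fun z => (norm_sub_le _ _).trans (add_le_add (h2 _) (h2 _))⟩
  unfold _root_.dDiff
  fun_prop

lemma Good.iter {g : WW n → ℂ} (h : Good g) (v : WW n) (m : ℕ) : Good ((_root_.dDiff v)^[m] g) := by
  induction m with
  | zero => exact h
  | succ m ih => rw [Function.iterate_succ_apply']; exact ih.dDiff v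

lemma integrable_gPP {g : WW n → ℂ} (h : Good g) {f : II n → ℝ → ℝ} (hf : ∀ i, Integrable (f i)) :
    Integrable (fun z => g z * (PP f z : ℂ)) := by
  obtain ⟨h1, M, h2⟩ := h
  exact (integrable_PP hf).ofReal.bdd_mul h1.aestronglyMeasurable (Filter.Eventually.of_forall h2)

lemma integrable_shift {f : ℝ → ℝ} (hf : Integrable f) (h : ℝ) : Integrable (shift h f) :=
  (hf.comp_sub_right h).sub hf

lemma integrable_shift_iter {f : ℝ → ℝ} (hf : Integrable f) (h : ℝ) (m : ℕ) :
    Integrable ((shift h)^[m] f) := by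
  induction m with
  | zero => exact hf
  | succ m ih => rw [Function.iterate_succ_apply']; exact integrable_shift ih h

lemma integrable_update {f : II n → ℝ → ℝ} (hf : ∀ i, Integrable (f i)) (k : II n) {g : ℝ → ℝ}
    (hg : Integrable g) (i : II n) : Integrable (Function.update f k g i) := by
  by_cases h : i = k
  · subst h; rwa [Function.update_self]
  · rw [Function.update_of_ne h]; exact hf i

lemma vol_left (n : ℕ) : (volume : Measure (WW n)).IsAddLeftInvariant := by
  have : (volume : Measure (WW n)) = (volume : Measure (EE n)).prod volume := rfl
  rw [this]
  infer_instance

lemma vol_right (n : ℕ) : (volume : Measure (WW n)).IsAddRightInvariant := by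
  have := vol_left n
  infer_instance

lemma adj_one {g : WW n → ℂ} (hg : Good g) {f : II n → ℝ → ℝ} (hf : ∀ i, Integrable (f i)) (k : II n)
    (h : ℝ) : ∫ z, dDiff (h • dd k) g z * (PP f z : ℂ) =
      ∫ z, g z * (PP (Function.update f k (shift h (f k))) z : ℂ) := by
  have hvol := vol_right n
  have e1 : ∀ z, dDiff (h • dd k) g z * (PP f z : ℂ) = g (z + h • dd k) * (PP f z : ℂ) - g z * (PP f z : ℂ) := by
    intro z; unfold dDiff; ring
  have e2 : ∀ z, g z * (PP (Function.update f k (shift h (f k))) z : ℂ) =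
      g z * (PP f (z - h • dd k) : ℂ) - g z * (PP f z : ℂ) := by
    intro z; rw [← PP_shift]; push_cast; ring
  have hg2 : Good (fun z => g (z + h • dd k)) := by
    obtain ⟨h1, M, h2⟩ := hg
    exact ⟨by fun_prop, M, fun z => h2 _⟩
  have i1 : Integrable (fun z => g (z + h • dd k) * (PP f z : ℂ)) := integrable_gPP hg2 hf
  have i2 : Integrable (fun z => g z * (PP f (z - h • dd k) : ℂ)) := by
    have := i1.comp_sub_right (h • dd k)
    simpa using this
  simp_rw [e1, e2]
  rw [integral_sub i1 (integrable_gPP hg hf), integral_sub i2 (integrable_gPP hg hf)]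
  congr 1
  have := integral_sub_right_eq_self (μ := (volume : Measure (WW n))) (fun z => g (z + h • dd k) * (PP f z : ℂ)) (h • dd k)
  rw [← this]
  simp

lemma adj_iter {g : WW n → ℂ} (hg : Good g) {f : II n → ℝ → ℝ} (hf : ∀ i, Integrable (f i)) (k : II n)
    (h : ℝ) (m : ℕ) : ∫ z, (dDiff (h • dd k))^[m] g z * (PP f z : ℂ) =
      ∫ z, g z * (PP (Function.update f k ((shift h)^[m] (f k))) z : ℂ) := by
  induction m generalizing g with
  | zero => simp
  | succ m ih =>
    rw [Function.iterate_succ_apply, ih (hg.dDiff _),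
      adj_one hg (integrable_update hf k (integrable_shift_iter (hf k) h m))]
    rw [Function.update_idem, Function.update_self, Function.iterate_succ_apply']

/-- iterated differences over a list of directions -/
def DT (H : II n → ℝ) (A : II n → ℕ) (l : List (II n)) (g : WW n → ℂ) : WW n → ℂ :=
  l.foldr (fun i g => (dDiff (H i • dd i))^[A i] g) g

lemma Good.DT {g : WW n → ℂ} (hg : Good g) (H : II n → ℝ) (A : II n → ℕ) (l : List (II n)) :
    Good (DT H A l g) := by
  induction l with
  | nil => exact hg
  | cons i l ih => exact ih.iter _ _

open Classical in
lemma adj_list {g : WW n → ℂ} (hg : Good g) (H : II n → ℝ) (A : II n → ℕ) (l : List (II n)) (hl : l.Nodup)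
    {f : II n → ℝ → ℝ} (hf : ∀ i, Integrable (f i)) :
    ∫ z, DT H A l g z * (PP f z : ℂ) =
      ∫ z, g z * (PP (fun i => if i ∈ l then (shift (H i))^[A i] (f i) else f i) z : ℂ) := by
  induction l generalizing f with
  | nil => simp [DT]
  | cons k l ih =>
    rw [List.nodup_cons] at hl
    have e := adj_iter (hg.DT H A l) hf k (H k) (A k)
    rw [ih hl.2 (integrable_update hf k (integrable_shift_iter (hf k) (H k) (A k)))] at e
    refine e.trans (integral_congr_ae (Filter.Eventually.of_forall fun z => ?_))
    simp only
    congr 3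
    funext i
    by_cases hi : i = k
    · subst hi
      simp [hl.1]
    · simp [hi]

lemma foldr_comp {ι B : Type*} (T : ι → B → B) (l : List ι) (g : B) :
    ((l.map T).foldr (· ∘ ·) id) g = l.foldr (fun i g => T i g) g := by
  induction l with
  | nil => rfl
  | cons i l ih => simp [ih]

lemma mdiff_eq_DT (H : II n → ℝ) (A : II n → ℕ) (g : WW n → ℂ) :
    mdiff dX (fun i => A (Sum.inl i)) (fun i => H (Sum.inl i))
      (mdiff dY (fun i => A (Sum.inr i)) (fun i => H (Sum.inr i)) g) =
    DT H A ((List.finRange n).map Sum.inl ++ (List.finRange n).map Sum.inr) g := by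
  unfold mdiff DT
  rw [List.ofFn_eq_map, List.ofFn_eq_map, foldr_comp, foldr_comp, List.foldr_append, List.foldr_map,
    List.foldr_map]
  rfl

lemma list_nodup : ((List.finRange n).map Sum.inl ++ (List.finRange n).map Sum.inr : List (II n)).Nodup := by
  rw [List.nodup_append]
  refine ⟨(List.nodup_finRange n).map Sum.inl_injective, (List.nodup_finRange n).map Sum.inr_injective, ?_⟩
  simp

lemma list_mem (i : II n) : i ∈ ((List.finRange n).map Sum.inl ++ (List.finRange n).map Sum.inr : List (II n)) := by
  rcases i with i | i <;> simp

/-- dyadic windows -/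
def ψ (j : ℕ) (t : ℝ) : ℝ := (Set.Ico (0:ℝ) ((1/2) ^ j)).indicator (fun _ => (2:ℝ) ^ j) t

/-- sign/size factors -/
def cj (j : ℕ) : ℝ := if j = 0 then 1 else -(1/2)

/-- differences of dyadic windows -/
def bj (j : ℕ) (t : ℝ) : ℝ := cj j * (shift ((1/2) ^ j))^[min j 1] (ψ j) t

lemma ψ_step (j : ℕ) (t : ℝ) : ψ (j+1) t - ψ j t = bj (j+1) t := by
  have hp : (0:ℝ) < (1/2)^j := by positivity
  have h2 : ((1:ℝ)/2)^(j+1) = (1/2)^j / 2 := by rw [pow_succ]; ring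
  simp only [bj, cj, Nat.succ_ne_zero, if_false, shift, ψ, Set.indicator, Set.mem_Ico, h2, pow_succ,
    show min (j+1) 1 = 1 by omega, Function.iterate_one]
  generalize ((1:ℝ)/2)^j = p at *
  generalize (2:ℝ)^j = q
  split_ifs <;> first | (exfalso; grind) | ring

lemma ψ_sum (N : ℕ) (t : ℝ) : ∑ j ∈ Finset.range (N+1), bj j t = ψ N t := by
  induction N with
  | zero => simp [bj, cj]
  | succ N ih => rw [Finset.sum_range_succ, ih, ← ψ_step]; ring

lemma ψ_nonneg (j : ℕ) (t : ℝ) : 0 ≤ ψ j t := Set.indicator_nonneg (fun _ _ => by positivity) _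

lemma ψ_integrable (j : ℕ) : Integrable (ψ j) := by
  unfold ψ
  rw [show (fun t => (Set.Ico (0:ℝ) ((1/2) ^ j)).indicator (fun _ => (2:ℝ) ^ j) t) =
    (Set.Ico (0:ℝ) ((1/2) ^ j)).indicator (fun _ => (2:ℝ) ^ j) from rfl, integrable_indicator_iff measurableSet_Ico]
  exact integrableOn_const (by simp)

lemma ψ_integral (j : ℕ) : ∫ t, ψ j t = 1 := by
  unfold ψ
  rw [integral_indicator measurableSet_Ico]
  simp [Measure.real]

lemma ψ_sq_integral (j : ℕ) : ∫ t, ψ j t ^ 2 = 2 ^ j := by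
  have : ∀ t, ψ j t ^ 2 = 2 ^ j * ψ j t := by
    intro t
    unfold ψ Set.indicator
    split_ifs <;> ring
  simp_rw [this]
  rw [integral_const_mul, ψ_integral, mul_one]

lemma ψ_measurable (j : ℕ) : Measurable (ψ j) := measurable_const.indicator measurableSet_Ico

lemma ψ_ne {j : ℕ} {t : ℝ} (h : ψ j t ≠ 0) : 0 ≤ t ∧ t < (1/2)^j := by
  have := Set.mem_of_indicator_ne_zero h
  exact this

/-- translated window -/
def win (A : II n → ℕ) (z : WW n) (z' : WW n) : ℝ := PP (fun i t => ψ (A i) (t - cc i z)) z'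

lemma shift_translate (h c : ℝ) (m : ℕ) (f : ℝ → ℝ) :
    (shift h)^[m] (fun t => f (t - c)) = fun t => (shift h)^[m] f (t - c) := by
  induction m with
  | zero => rfl
  | succ m ih =>
    rw [Function.iterate_succ_apply', ih, Function.iterate_succ_apply']
    funext t
    simp only [shift]
    rw [sub_right_comm]

/-- the amplitude of the block `A` -/
def bA (a : WW n → ℂ) (A : II n → ℕ) (z : WW n) : ℂ :=
  ((∏ i, cj (A i) : ℝ) : ℂ) * mdiff dX (fun i => min (A (Sum.inl i)) 1) (fun i => (1/2) ^ A (Sum.inl i))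
      (mdiff dY (fun i => min (A (Sum.inr i)) 1) (fun i => (1/2) ^ A (Sum.inr i)) a) z

theorem decomp {a : WW n → ℂ} (ha : Good a) (N : ℕ) (z : WW n) :
    ∫ z', a z' * (win (fun _ => N) z z' : ℂ) =
      ∑ A ∈ Fintype.piFinset (fun _ : II n => Finset.range (N+1)), ∫ z', bA a A z' * (win A z z' : ℂ) := by
  have e1 : ∀ z', win (fun _ => N) z z' = ∑ A ∈ Fintype.piFinset (fun _ : II n => Finset.range (N+1)),
      PP (fun i t => bj (A i) (t - cc i z)) z' := by
    intro z'
    unfold win PP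
    rw [← Finset.prod_univ_sum (fun _ : II n => Finset.range (N+1)) (fun i j => bj j (cc i z' - cc i z))]
    refine Finset.prod_congr rfl fun i _ => ?_
    rw [ψ_sum]
  have hint : ∀ j (c : ℝ), Integrable (fun t => bj j (t - c)) := by
    intro j c
    have : Integrable (bj j) := (integrable_shift_iter (ψ_integrable j) _ _).const_mul _
    exact this.comp_sub_right c
  simp_rw [e1]
  push_cast
  simp_rw [Finset.mul_sum]
  rw [integral_finsetSum _ (fun A _ => integrable_gPP ha fun i => hint _ _)]
  refine Finset.sum_congr rfl fun A _ => ?_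
  have h := adj_list ha (fun i => (1/2) ^ A i) (fun i => min (A i) 1) _ (list_nodup (n := n))
    (f := fun i t => ψ (A i) (t - cc i z)) (fun i => (ψ_integrable _).comp_sub_right _)
  simp only [list_mem, if_true, shift_translate] at h
  rw [← mdiff_eq_DT] at h
  unfold bA win
  simp_rw [mul_assoc]
  rw [integral_const_mul, h, ← integral_const_mul]
  refine integral_congr_ae (Filter.Eventually.of_forall fun z' => ?_)
  simp only [PP, bj]
  rw [Finset.prod_mul_distrib]
  push_cast
  ring

lemma bA_cont {a : WW n → ℂ} (ha : Good a) (A : II n → ℕ) : Good (bA a A) := by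
  have := ha.DT (fun i => (1/2) ^ A i) (fun i => min (A i) 1)
    ((List.finRange n).map Sum.inl ++ (List.finRange n).map Sum.inr)
  rw [← mdiff_eq_DT] at this
  obtain ⟨h1, M, h2⟩ := this
  refine ⟨continuous_const.mul h1, ‖((∏ i, cj (A i) : ℝ) : ℂ)‖ * M, fun z => ?_⟩
  unfold bA
  rw [norm_mul]
  exact mul_le_mul_of_nonneg_left (h2 z) (norm_nonneg _)

/-- the amplitude hypothesis -/
def Amp (lam C₁ : ℝ) (a : WW n → ℂ) : Prop :=
  ∀ α β : Fin n → ℕ, (∀ i, α i ≤ 1) → (∀ i, β i ≤ 1) →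
          ∀ h h' : Fin n → ℝ, ∀ z,
            ‖mdiff dX α h (mdiff dY β h' a) z‖ ≤
              C₁ * (∏ i, |h i| ^ ((α i : ℝ) * lam)) * ∏ j, |h' j| ^ ((β j : ℝ) * lam)

lemma Amp.bound {lam C₁ : ℝ} {a : WW n → ℂ} (h : Amp lam C₁ a) (z : WW n) : ‖a z‖ ≤ C₁ := by
  have := h (fun _ => 0) (fun _ => 0) (by simp) (by simp) (fun _ => 0) (fun _ => 0) z
  have e := mdiff_eq_DT (n := n) (fun _ => 0) (fun _ => 0) a
  rw [e] at this
  have e2 : ∀ l : List (II n), DT (fun _ => 0) (fun _ => 0) l a = a := by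
    intro l
    induction l with
    | nil => rfl
    | cons i l ih => exact ih
  rw [e2] at this
  simpa using this

lemma bA_bound {lam C₁ : ℝ} {a : WW n → ℂ} (h : Amp lam C₁ a) (A : II n → ℕ) (z : WW n) :
    ‖bA a A z‖ ≤ C₁ * ∏ i, ((1/2 : ℝ) ^ lam) ^ A i := by
  have key : ∀ j : ℕ, |(1/2 : ℝ) ^ j| ^ (((min j 1 : ℕ) : ℝ) * lam) = ((1/2 : ℝ) ^ lam) ^ j := by
    intro j
    rcases Nat.eq_zero_or_pos j with h | h
    · subst h; simp
    · rw [show min j 1 = 1 by omega, abs_of_pos (by positivity)]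
      rw [← Real.rpow_natCast, ← Real.rpow_natCast, ← Real.rpow_mul (by norm_num), ← Real.rpow_mul (by norm_num)]
      push_cast; ring_nf
  have h1 := h (fun i => min (A (Sum.inl i)) 1) (fun i => min (A (Sum.inr i)) 1) (fun i => min_le_right _ _)
    (fun i => min_le_right _ _) (fun i => (1/2) ^ A (Sum.inl i)) (fun i => (1/2) ^ A (Sum.inr i)) z
  simp_rw [key] at h1
  unfold bA
  rw [norm_mul, Fintype.prod_sum_type (fun i : II n => ((1/2 : ℝ) ^ lam) ^ A i), ← mul_assoc C₁]
  have h2 : ‖((∏ i, cj (A i) : ℝ) : ℂ)‖ ≤ 1 := by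
    rw [Complex.norm_real, Real.norm_eq_abs, Finset.abs_prod]
    refine Finset.prod_le_one (fun _ _ => abs_nonneg _) fun i _ => ?_
    unfold cj
    split_ifs
    · simp
    · rw [abs_neg, abs_of_pos] <;> norm_num
  calc _ ≤ 1 * _ := mul_le_mul h2 h1 (norm_nonneg _) zero_le_one
    _ = _ := one_mul _

lemma win_nonneg (A : II n → ℕ) (z z' : WW n) : 0 ≤ win A z z' := by
  unfold win PP
  exact Finset.prod_nonneg fun _ _ => ψ_nonneg _ _

lemma win_integrable (A : II n → ℕ) (z : WW n) : Integrable (win A z) :=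
  integrable_PP fun _ => (ψ_integrable _).comp_sub_right _

lemma win_integral (A : II n → ℕ) (z : WW n) : ∫ z', win A z z' = 1 := by
  unfold win
  rw [integral_PP]
  refine Finset.prod_eq_one fun i _ => ?_
  rw [integral_sub_right_eq_self (ψ (A i)) (cc i z), ψ_integral]

lemma smooth_bound {a : WW n → ℂ} {M : ℝ} (hM : ∀ z, ‖a z‖ ≤ M) (A : II n → ℕ) (z : WW n) :
    ‖∫ z', a z' * (win A z z' : ℂ)‖ ≤ M := by
  refine (norm_integral_le_of_norm_le ((win_integrable A z).const_mul M) (Filter.Eventually.of_forall fun z' => ?_)).trans ?_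
  · rw [norm_mul, Complex.norm_real, Real.norm_eq_abs, abs_of_nonneg (win_nonneg _ _ _)]
    exact mul_le_mul_of_nonneg_right (hM _) (win_nonneg _ _ _)
  · rw [integral_const_mul, win_integral, mul_one]

lemma win_dist {N : ℕ} {z z' : WW n} (h : win (fun _ => N) z z' ≠ 0) : dist z' z ≤ n * (1/2)^N := by
  have h0 : ∀ i, |cc i z' - cc i z| ≤ (1/2)^N := by
    intro i
    unfold win PP at h
    have := Finset.prod_ne_zero_iff.1 h i (Finset.mem_univ i)
    have := ψ_ne this
    rw [abs_of_nonneg this.1]; exact this.2.le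
  have key : ∀ x y : EE n, (∀ i, |x i - y i| ≤ (1/2)^N) → dist x y ≤ n * (1/2)^N := by
    intro x y hxy
    rw [dist_eq_norm, Phase.vec_sum (x - y)]
    refine (norm_sum_le _ _).trans ?_
    calc _ ≤ ∑ i : Fin n, ((1:ℝ)/2)^N := Finset.sum_le_sum fun i _ => by
            rw [norm_smul]; simpa using hxy i
      _ = _ := by simp
  rw [Prod.dist_eq]
  exact max_le (key _ _ fun i => h0 (Sum.inl i)) (key _ _ fun i => h0 (Sum.inr i))

lemma smooth_tendsto {a : WW n → ℂ} (ha : Good a) (z : WW n) :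
    Filter.Tendsto (fun N : ℕ => ∫ z', a z' * (win (fun _ => N) z z' : ℂ)) Filter.atTop (nhds (a z)) := by
  rw [Metric.tendsto_atTop]
  intro ε hε
  obtain ⟨δ, hδ, hd⟩ := Metric.continuous_iff.1 ha.1 z (ε/2) (by positivity)
  have hl : Filter.Tendsto (fun N : ℕ => (n:ℝ) * (1/2)^N) Filter.atTop (nhds 0) := by
    have := (tendsto_pow_atTop_nhds_zero_of_lt_one (r := (1/2:ℝ)) (by norm_num) (by norm_num)).const_mul (n:ℝ)
    simpa using this
  obtain ⟨N₀, hN₀⟩ := Filter.eventually_atTop.1 (hl.eventually_lt_const hδ)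
  refine ⟨N₀, fun N hN => ?_⟩
  have e : (∫ z', a z' * (win (fun _ => N) z z' : ℂ)) - a z = ∫ z', (a z' - a z) * (win (fun _ => N) z z' : ℂ) := by
    simp_rw [sub_mul]
    have hi : Integrable (fun z' => a z' * (win (fun _ => N) z z' : ℂ)) :=
      integrable_gPP ha fun _ => (ψ_integrable _).comp_sub_right _
    rw [integral_sub hi, integral_const_mul,
      integral_complex_ofReal, win_integral]
    · simp
    · exact ((win_integrable _ _).ofReal).const_mul _
  rw [dist_eq_norm, e]
  refine (norm_integral_le_of_norm_le ((win_integrable (fun _ => N) z).const_mul (ε/2)) (Filter.Eventually.of_forall fun z' => ?_)).trans_lt ?_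
  · rw [norm_mul, Complex.norm_real, Real.norm_eq_abs, abs_of_nonneg (win_nonneg _ _ _)]
    by_cases h : win (fun _ => N) z z' = 0
    · simp [h]
    · refine mul_le_mul_of_nonneg_right ?_ (win_nonneg _ _ _)
      rw [← dist_eq_norm]
      exact (hd z' ((win_dist h).trans_lt (hN₀ N hN))).le
  · rw [integral_const_mul, win_integral]; linarith

end Childs

namespace Childs
variable {n : ℕ}

/-- the bilinear phase -/
def ip (z : WW n) : ℝ := ⟪z.1, z.2⟫

lemma ip_smooth : ContDiff ℝ (⊤ : ℕ∞) (ip (n := n)) := by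
  exact contDiff_fst.inner ℝ contDiff_snd

lemma ip_cont : Continuous (ip (n := n)) := ip_smooth.continuous

lemma ip_hess (i j : Fin n) : mixedHessXY (ip (n := n)) i j = fun _ => if i = j then 1 else 0 := by
  have h1 : dLine (dY j) (ip (n := n)) = fun z => z.1 j := by
    funext z
    unfold dLine ip
    rw [fderiv_inner_apply ℝ (by fun_prop) (by fun_prop)]
    have e1 : fderiv ℝ (fun t : WW n => t.2) z = ContinuousLinearMap.snd ℝ (EE n) (EE n) := fderiv_snd
    have e2 : fderiv ℝ (fun t : WW n => t.1) z = ContinuousLinearMap.fst ℝ (EE n) (EE n) := fderiv_fst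
    rw [e1, e2]
    simp [dY, EuclideanSpace.inner_single_right]
  unfold mixedHessXY
  rw [h1]
  funext z
  unfold dLine
  have : (fun z : WW n => z.1 j) = ((EuclideanSpace.proj j : EE n →L[ℝ] ℝ).comp (ContinuousLinearMap.fst ℝ (EE n) (EE n))) := rfl
  rw [this, ContinuousLinearMap.fderiv]
  simp [dX, eq_comm]

lemma foldr_pres {A : Type*} (P : A → Prop) : ∀ (L : List (A → A)), (∀ f ∈ L, ∀ a, P a → P (f a)) →
    ∀ a, P a → P (L.foldr (· ∘ ·) id a)
  | [], _, a, ha => ha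
  | f :: L, h, a, ha => by
    have := foldr_pres P L (fun g hg => h g (List.mem_cons_of_mem _ hg)) a ha
    exact h f List.mem_cons_self _ this

lemma mderiv_const (d : Fin n → WW n) (α : Fin n → ℕ) (g : WW n → ℝ)
    (hg : ∃ c : ℝ, |c| ≤ 1 ∧ g = fun _ => c) : ∃ c : ℝ, |c| ≤ 1 ∧ mderiv d α g = fun _ => c := by
  unfold mderiv
  refine foldr_pres (fun g : WW n → ℝ => ∃ c : ℝ, |c| ≤ 1 ∧ g = fun _ => c) _ ?_ g hg
  intro f hf
  rw [List.mem_ofFn] at hf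
  obtain ⟨i, rfl⟩ := hf
  intro a ha
  induction α i with
  | zero => exact ha
  | succ m ih =>
    rw [Function.iterate_succ_apply']
    obtain ⟨c, _, h2⟩ := ih
    refine ⟨0, by simp, ?_⟩
    rw [h2]
    funext z
    simp [dLine]

lemma ip_hyp : Phase.Hyp n 1 (fun _ => 1) ip where
  smooth := ip_smooth
  det := by
    intro z
    have : (Matrix.of fun i j => mixedHessXY (ip (n := n)) i j z) = 1 := by
      ext i j
      rw [Matrix.of_apply, ip_hess, Matrix.one_apply]
    rw [this]; simp
  bd := by
    intro i j α _
    have h : ∃ c : ℝ, |c| ≤ 1 ∧ mixedHessXY (ip (n := n)) i j = fun _ => c := by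
      refine ⟨if i = j then 1 else 0, ?_, ip_hess i j⟩
      split_ifs <;> simp
    constructor
    · obtain ⟨c, h1, h2⟩ := mderiv_const dX α _ h
      intro z; rw [h2]; exact h1
    · obtain ⟨c, h1, h2⟩ := mderiv_const dY α _ h
      intro z; rw [h2]; exact h1

/-- the L2 energy -/
def En {α : Type*} [MeasurableSpace α] (μ : Measure α) (f : α → ℂ) : ℝ≥0∞ := ∫⁻ x, ‖f x‖ₑ ^ 2 ∂μ

lemma eLp_sq {α : Type*} [MeasurableSpace α] (μ : Measure α) (f : α → ℂ) :
    eLpNorm f 2 μ ^ 2 = En μ f := by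
  have := eLpNorm_nnreal_pow_eq_lintegral (f := f) (μ := μ) (p := 2) (by norm_num)
  unfold En
  simp only [NNReal.coe_ofNat, ENNReal.coe_ofNat, ENNReal.rpow_ofNat] at this
  exact this

/-- the Fourier transform constant -/
lemma four (n : ℕ) : ∃ Λ : ℝ, 0 ≤ Λ ∧ ∀ u : EE n → ℂ, Integrable u → MemLp u 2 volume →
    En volume (AF.fop ip u) ≤ ENNReal.ofReal Λ ^ 2 * En volume u := by
  obtain ⟨Λ, h0, h⟩ := AF.part1 n 1 one_pos (fun _ => 1)
  refine ⟨Λ, h0, fun u h1 h2 => ?_⟩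
  rw [← eLp_sq, ← eLp_sq, ← mul_pow]
  exact pow_le_pow_left₀ (zero_le) (h ip ip_hyp u h1 h2) 2

/-- short time transform with window `G` -/
def St (G : EE n → ℝ) (w : EE n → ℂ) (z : WW n) : ℂ :=
  AF.fop ip (fun x => (G (z.1 - x) : ℂ) * w x) z.2

lemma St_eq (G : EE n → ℝ) (w : EE n → ℂ) (z : WW n) :
    St G w z = ∫ x, Complex.exp (Complex.I * (ip (x, z.2) : ℂ)) * ((G (z.1 - x) : ℂ) * w x) := rfl

lemma St_meas {G : EE n → ℝ} (hG : Measurable G) {w : EE n → ℂ} (hw : Measurable w) :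
    Measurable (St G w) := by
  have : St G w = fun z => ∫ x, Complex.exp (Complex.I * (ip (x, z.2) : ℂ)) * ((G (z.1 - x) : ℂ) * w x) := rfl
  rw [this]
  apply StronglyMeasurable.measurable
  apply StronglyMeasurable.integral_prod_right
  apply Measurable.stronglyMeasurable
  have h1 := (ip_cont (n := n)).measurable
  unfold Function.uncurry
  fun_prop

lemma win_mul {G : EE n → ℝ} (hG : Measurable G) {B : ℝ} (hB : ∀ x, |G x| ≤ B)
    {w : EE n → ℂ} (hw : Integrable w) (hw2 : MemLp w 2 volume) (p : EE n) :
    Integrable (fun x => (G (p - x) : ℂ) * w x) ∧ MemLp (fun x => (G (p - x) : ℂ) * w x) 2 volume := by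
  have hm : AEStronglyMeasurable (fun x => (G (p - x) : ℂ)) volume :=
    (by fun_prop : Measurable (fun x => (G (p - x) : ℂ))).aestronglyMeasurable
  have hb : ∀ x, ‖(G (p - x) : ℂ)‖ ≤ B := fun x => by
    rw [Complex.norm_real]; exact hB _
  refine ⟨hw.bdd_mul hm (Filter.Eventually.of_forall hb), ?_⟩
  refine MemLp.of_le_mul (c := B) hw2 (hm.mul hw2.1) (Filter.Eventually.of_forall fun x => ?_)
  rw [norm_mul]
  exact mul_le_mul_of_nonneg_right (hb x) (norm_nonneg _)

lemma St_bound {Λ : ℝ} (hΛ : ∀ u : EE n → ℂ, Integrable u → MemLp u 2 volume →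
    En volume (AF.fop ip u) ≤ ENNReal.ofReal Λ ^ 2 * En volume u)
    {G : EE n → ℝ} (hG : Measurable G) {B : ℝ} (hB : ∀ x, |G x| ≤ B)
    {w : EE n → ℂ} (hwm : Measurable w) (hw : Integrable w) (hw2 : MemLp w 2 volume) :
    En volume (St G w) ≤ ENNReal.ofReal Λ ^ 2 * ((∫⁻ x, ‖G x‖ₑ ^ 2) * En volume w) := by
  have s1 : En volume (St G w) ≤ ∫⁻ p : EE n, ∫⁻ q : EE n, ‖St G w (p, q)‖ₑ ^ 2 :=
    lintegral_prod_le _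
  have s2 : ∀ p : EE n, ∫⁻ q : EE n, ‖St G w (p, q)‖ₑ ^ 2 ≤
      ENNReal.ofReal Λ ^ 2 * ∫⁻ x, ‖G (p - x)‖ₑ ^ 2 * ‖w x‖ₑ ^ 2 := by
    intro p
    have h := win_mul hG hB hw hw2 p
    have := hΛ _ h.1 h.2
    refine this.trans (le_of_eq ?_)
    congr 1
    unfold En
    refine lintegral_congr fun x => ?_
    rw [enorm_mul, mul_pow]
    congr 2
    rw [← ofReal_norm, ← ofReal_norm, Complex.norm_real]
  refine s1.trans ((lintegral_mono s2).trans ?_)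
  have hm : Measurable (Function.uncurry fun (p : EE n) (x : EE n) => ‖G (p - x)‖ₑ ^ 2 * ‖w x‖ₑ ^ 2) := by
    unfold Function.uncurry
    fun_prop
  rw [lintegral_const_mul' _ _ (by simp)]
  gcongr
  rw [lintegral_lintegral_swap hm.aemeasurable]
  have e : ∀ x : EE n, ∫⁻ p : EE n, ‖G (p - x)‖ₑ ^ 2 * ‖w x‖ₑ ^ 2 = (∫⁻ x, ‖G x‖ₑ ^ 2) * ‖w x‖ₑ ^ 2 := by
    intro x
    rw [lintegral_mul_const' _ _ (by simp), lintegral_sub_right_eq_self (fun p => ‖G p‖ₑ ^ 2)]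
  simp_rw [e]
  unfold En
  rw [lintegral_const_mul _ (by fun_prop)]

end Childs

namespace Childs
variable {n : ℕ}

/-- product window -/
def pw (J : Fin n → ℕ) (z : EE n) : ℝ := ∏ i, ψ (J i) (z i)

/-- product window with a monomial -/
def Gk (J : Fin n → ℕ) {m : ℕ} (κ : Fin m → Fin n) (z : EE n) : ℝ := pw J z * ∏ r, z (κ r)

lemma win_pw (A : II n → ℕ) (z z' : WW n) :
    win A z z' = pw (fun i => A (Sum.inl i)) (z'.1 - z.1) * pw (fun i => A (Sum.inr i)) (z'.2 - z.2) := by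
  unfold win
  rw [PP_eq]
  rfl

lemma pw_nonneg (J : Fin n → ℕ) (z : EE n) : 0 ≤ pw J z := Finset.prod_nonneg fun i _ => ψ_nonneg _ _

lemma ψ_le (j : ℕ) (t : ℝ) : ψ j t ≤ 2 ^ j := by
  unfold ψ
  exact Set.indicator_le_self' (fun _ _ => by positivity) t

lemma pw_le (J : Fin n → ℕ) (z : EE n) : pw J z ≤ ∏ i, 2 ^ J i :=
  Finset.prod_le_prod (fun i _ => ψ_nonneg _ _) fun i _ => ψ_le _ _

lemma pw_meas (J : Fin n → ℕ) : Measurable (pw (n := n) J) := by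
  unfold pw
  refine Finset.measurable_prod _ fun i _ => ?_
  exact (ψ_measurable (J i)).comp (by fun_prop)

lemma Gk_meas (J : Fin n → ℕ) {m : ℕ} (κ : Fin m → Fin n) : Measurable (Gk J κ) := by
  unfold Gk
  refine (pw_meas J).mul (Finset.measurable_prod _ fun i _ => by fun_prop)

lemma Gk_le_pw (J : Fin n → ℕ) {m : ℕ} (κ : Fin m → Fin n) (z : EE n) : |Gk J κ z| ≤ pw J z := by
  unfold Gk
  rw [abs_mul, abs_of_nonneg (pw_nonneg J z)]
  by_cases h : pw J z = 0
  · simp [h]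
  · refine mul_le_of_le_one_right (pw_nonneg J z) ?_
    rw [Finset.abs_prod]
    refine Finset.prod_le_one (fun i _ => abs_nonneg _) fun i _ => ?_
    unfold pw at h
    obtain ⟨h1, h2⟩ := ψ_ne (Finset.prod_ne_zero_iff.1 h (κ i) (Finset.mem_univ _))
    rw [abs_of_nonneg h1]
    exact h2.le.trans (pow_le_one₀ (by norm_num) (by norm_num))

lemma Gk_le (J : Fin n → ℕ) {m : ℕ} (κ : Fin m → Fin n) (z : EE n) : |Gk J κ z| ≤ ∏ i, 2 ^ J i :=
  (Gk_le_pw J κ z).trans (pw_le J z)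

/-- size of windows -/
def RR {ι : Type*} [Fintype ι] (J : ι → ℕ) : ℝ≥0∞ := ENNReal.ofReal (∏ i, (√2) ^ J i)

lemma Gk_energy (J : Fin n → ℕ) {m : ℕ} (κ : Fin m → Fin n) :
    ∫⁻ x, ‖Gk J κ x‖ₑ ^ 2 ≤ RR J ^ 2 := by
  have h1 : ∫⁻ x, ‖Gk J κ x‖ₑ ^ 2 ≤ ∫⁻ x : EE n, ENNReal.ofReal (∏ i, ψ (J i) (x i) ^ 2) := by
    refine lintegral_mono fun x => ?_
    show _ ≤ ENNReal.ofReal (∏ i, ψ (J i) (x i) ^ 2)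
    rw [Finset.prod_pow]
    change _ ≤ ENNReal.ofReal ((pw J x) ^ 2)
    rw [ENNReal.ofReal_pow (pw_nonneg J x), ← ofReal_norm]
    gcongr
    exact Gk_le_pw J κ x
  refine h1.trans ?_
  have hi : ∀ i, Integrable (fun t => ψ (J i) t ^ 2) := by
    intro i
    have : (fun t => ψ (J i) t ^ 2) = fun t => ψ (J i) t * ψ (J i) t := by funext t; ring
    rw [this]
    refine (ψ_integrable (J i)).bdd_mul (c := 2 ^ J i) (ψ_measurable _).aestronglyMeasurable
      (Filter.Eventually.of_forall fun t => ?_)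
    rw [Real.norm_of_nonneg (ψ_nonneg _ _)]
    exact ψ_le _ _
  rw [← ofReal_integral_eq_lintegral_ofReal (integrable_prod_E (f := fun i t => ψ (J i) t ^ 2) hi)
    (Filter.Eventually.of_forall fun x => Finset.prod_nonneg fun i _ => sq_nonneg _),
    integral_prod_E (fun i t => ψ (J i) t ^ 2)]
  unfold RR
  rw [← ENNReal.ofReal_pow (by positivity), ← Finset.prod_pow]
  refine le_of_eq ?_
  congr 1
  refine Finset.prod_congr rfl fun i _ => ?_
  rw [ψ_sq_integral, ← pow_mul, mul_comm, pow_mul, Real.sq_sqrt (by norm_num)]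

lemma RR_split (A : II n → ℕ) : RR A = RR (fun i => A (Sum.inl i)) * RR (fun i => A (Sum.inr i)) := by
  unfold RR
  rw [Fintype.prod_sum_type, ENNReal.ofReal_mul (by positivity)]

lemma holder_sq {f g : WW n → ℂ} (hf : Measurable f) (hg : Measurable g) {a b : ℝ≥0∞}
    (ha : En volume f ≤ a ^ 2) (hb : En volume g ≤ b ^ 2) :
    ∫⁻ z, ‖f z‖ₑ * ‖g z‖ₑ ≤ a * b := by
  have := ENNReal.lintegral_mul_le_Lp_mul_Lq (volume : Measure (WW n)) Real.HolderConjugate.two_two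
    (f := fun z => ‖f z‖ₑ) (g := fun z => ‖g z‖ₑ) hf.enorm.aemeasurable hg.enorm.aemeasurable
  simp only [Pi.mul_apply, ENNReal.rpow_ofNat] at this
  refine this.trans ?_
  have key : ∀ {x y : ℝ≥0∞}, x ≤ y ^ 2 → x ^ (1 / (2:ℝ)) ≤ y := by
    intro x y h
    refine (ENNReal.rpow_le_rpow h (by norm_num)).trans (le_of_eq ?_)
    rw [← ENNReal.rpow_natCast, ← ENNReal.rpow_mul]
    norm_num
  exact mul_le_mul' (key ha) (key hb)

lemma En_swap {f : WW n → ℂ} : En volume (fun z : WW n => f z.swap) = En volume f := by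
  unfold En
  exact (Measure.measurePreserving_swap (μ := (volume : Measure (EE n))) (ν := (volume : Measure (EE n)))).lintegral_comp_emb
    (MeasurableEquiv.prodComm.measurableEmbedding) (fun z => ‖f z‖ₑ ^ 2)

/-- L1 L2 measurable functions -/
structure LL (w : EE n → ℂ) : Prop where
  meas : Measurable w
  int : Integrable w
  sq : MemLp w 2 volume

lemma St_pair {Λ : ℝ} (hΛ : ∀ u : EE n → ℂ, Integrable u → MemLp u 2 volume →
    En volume (AF.fop ip u) ≤ ENNReal.ofReal Λ ^ 2 * En volume u)
    {w v : EE n → ℂ} (hw : LL w) (hv : LL v) (J L : Fin n → ℕ) {m : ℕ} (κ : Fin m → Fin n) :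
    ∫⁻ z : WW n, ‖St (Gk J κ) w z‖ₑ * ‖St (Gk L κ) v z.swap‖ₑ ≤
      (ENNReal.ofReal Λ * RR J * eLpNorm w 2 volume) * (ENNReal.ofReal Λ * RR L * eLpNorm v 2 volume) := by
  have key : ∀ {w : EE n → ℂ} (hw : LL w) (J : Fin n → ℕ), En volume (St (Gk J κ) w) ≤
      (ENNReal.ofReal Λ * RR J * eLpNorm w 2 volume) ^ 2 := by
    intro w hw J
    refine (St_bound hΛ (Gk_meas J κ) (Gk_le J κ) hw.meas hw.int hw.sq).trans ?_
    rw [← eLp_sq, mul_pow, mul_pow, mul_assoc]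
    gcongr
    exact Gk_energy J κ
  refine holder_sq (f := St (Gk J κ) w) (g := fun z => St (Gk L κ) v z.swap)
    (St_meas (Gk_meas J κ) hw.meas) ((St_meas (Gk_meas L κ) hv.meas).comp measurable_swap) (key hw J) ?_
  rw [En_swap]
  exact key hv L

end Childs

namespace Childs
variable {n : ℕ}

lemma ip_expand (x ξ p q : EE n) :
    ip (x, ξ) = ip (x, q) + ip (ξ, p) - ip (p, q) + ip (p - x, q - ξ) := by
  unfold ip
  simp only [inner_sub_left, inner_sub_right]
  rw [real_inner_comm ξ p]
  ring

lemma ip_sum (x ξ : EE n) : ip (x, ξ) = ∑ i, x i * ξ i := by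
  unfold ip
  simp [PiLp.inner_apply, mul_comm]

lemma ip_pow (x ξ : EE n) (m : ℕ) :
    ip (x, ξ) ^ m = ∑ κ : Fin m → Fin n, (∏ r, x (κ r)) * ∏ r, ξ (κ r) := by
  rw [ip_sum, Finset.sum_pow']
  simp [Finset.prod_mul_distrib]

/-- factor integrand -/
def fac (G : EE n → ℝ) (w : EE n → ℂ) (z : WW n) (x : EE n) : ℂ :=
  Complex.exp (Complex.I * (ip (x, z.2) : ℂ)) * ((G (z.1 - x) : ℂ) * w x)

/-- terms of the expansion -/
def term (A : II n → ℕ) (w v : EE n → ℂ) (z' : WW n) (m : ℕ) (z : WW n) : ℂ :=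
  ∑ κ : Fin m → Fin n, (Complex.exp (-(Complex.I * (ip z' : ℂ))) * (Complex.I ^ m / (m.factorial : ℂ))) *
    (fac (Gk (fun i => A (Sum.inl i)) κ) w z' z.1 * fac (Gk (fun i => A (Sum.inr i)) κ) v z'.swap z.2)

/-- integrand -/
def gg (A : II n → ℕ) (w v : EE n → ℂ) (z' z : WW n) : ℂ :=
  Complex.exp (Complex.I * (ip z : ℂ)) * ((win A z z' : ℂ) * (w z.1 * v z.2))

lemma term_eq (A : II n → ℕ) (w v : EE n → ℂ) (z' : WW n) (m : ℕ) (z : WW n) :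
    term A w v z' m z = Complex.exp (Complex.I * ((ip z - ip (z'.1 - z.1, z'.2 - z.2) : ℝ) : ℂ)) *
      ((win A z z' : ℂ) * (w z.1 * v z.2)) *
      ((Complex.I * (ip (z'.1 - z.1, z'.2 - z.2) : ℂ)) ^ m / (m.factorial : ℂ)) := by
  obtain ⟨x, ξ⟩ := z
  obtain ⟨p, q⟩ := z'
  have e1 : Complex.exp (Complex.I * ((ip (x, ξ) - ip (p - x, q - ξ) : ℝ) : ℂ)) =
      Complex.exp (Complex.I * (ip (x, q) : ℂ)) * Complex.exp (Complex.I * (ip (ξ, p) : ℂ)) *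
        Complex.exp (-(Complex.I * (ip (p, q) : ℂ))) := by
    rw [← Complex.exp_add, ← Complex.exp_add, ip_expand x ξ p q]
    congr 1
    push_cast
    ring
  simp only [] at *
  rw [e1, mul_pow, ← Complex.ofReal_pow, ip_pow, win_pw]
  unfold term fac Gk
  simp only [Prod.swap]
  push_cast
  rw [Finset.mul_sum, Finset.sum_div, Finset.mul_sum]
  refine Finset.sum_congr rfl fun κ _ => ?_
  ring

lemma term_hasSum (A : II n → ℕ) (w v : EE n → ℂ) (z' z : WW n) :
    HasSum (fun m => term A w v z' m z) (gg A w v z' z) := by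
  have h := NormedSpace.expSeries_div_hasSum_exp (𝔸 := ℂ)
    (Complex.I * (ip (z'.1 - z.1, z'.2 - z.2) : ℂ))
  rw [← Complex.exp_eq_exp_ℂ] at h
  have h2 := h.mul_left (Complex.exp (Complex.I * ((ip z - ip (z'.1 - z.1, z'.2 - z.2) : ℝ) : ℂ)) *
      ((win A z z' : ℂ) * (w z.1 * v z.2)))
  simp_rw [term_eq]
  have : Complex.exp (Complex.I * (ip z : ℂ)) =
    Complex.exp (Complex.I * ((ip z - ip (z'.1 - z.1, z'.2 - z.2) : ℝ) : ℂ)) *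
      Complex.exp (Complex.I * (ip (z'.1 - z.1, z'.2 - z.2) : ℂ)) := by
    rw [← Complex.exp_add]; congr 1; push_cast; ring
  have e : gg A w v z' z = Complex.exp (Complex.I * ((ip z - ip (z'.1 - z.1, z'.2 - z.2) : ℝ) : ℂ)) *
      ((win A z z' : ℂ) * (w z.1 * v z.2)) * Complex.exp (Complex.I * (ip (z'.1 - z.1, z'.2 - z.2) : ℂ)) := by
    unfold gg
    rw [this]; ring
  rw [e]
  exact h2

lemma fac_integrable {w : EE n → ℂ} (hw : LL w) (J : Fin n → ℕ) {m : ℕ} (κ : Fin m → Fin n) (z : WW n) :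
    Integrable (fac (Gk J κ) w z) :=
  AF.fop_integrable ip_cont (win_mul (Gk_meas J κ) (Gk_le J κ) hw.int hw.sq z.1).1 z.2

lemma term_integrable (A : II n → ℕ) {w v : EE n → ℂ} (hw : LL w) (hv : LL v) (z' : WW n) (m : ℕ) :
    Integrable (term A w v z' m) := by
  unfold term
  refine integrable_finsetSum _ fun κ _ => Integrable.const_mul ?_ _
  exact Integrable.mul_prod (fac_integrable hw _ κ z') (fac_integrable hv _ κ z'.swap)

lemma term_integral (A : II n → ℕ) {w v : EE n → ℂ} (hw : LL w) (hv : LL v) (z' : WW n) (m : ℕ) :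
    ∫ z, term A w v z' m z = ∑ κ : Fin m → Fin n,
      (Complex.exp (-(Complex.I * (ip z' : ℂ))) * (Complex.I ^ m / (m.factorial : ℂ))) *
      (St (Gk (fun i => A (Sum.inl i)) κ) w z' * St (Gk (fun i => A (Sum.inr i)) κ) v z'.swap) := by
  unfold term
  have hi : ∀ κ ∈ (Finset.univ : Finset (Fin m → Fin n)), Integrable (fun z : WW n =>
      (Complex.exp (-(Complex.I * (ip z' : ℂ))) * (Complex.I ^ m / (m.factorial : ℂ))) *
    (fac (Gk (fun i => A (Sum.inl i)) κ) w z' z.1 * fac (Gk (fun i => A (Sum.inr i)) κ) v z'.swap z.2)) :=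
    fun κ _ => Integrable.const_mul
      (Integrable.mul_prod (fac_integrable hw _ κ z') (fac_integrable hv _ κ z'.swap)) _
  rw [integral_finsetSum _ hi]
  refine Finset.sum_congr rfl fun κ _ => ?_
  rw [integral_const_mul]
  congr 1
  exact integral_prod_mul (fac (Gk (fun i => A (Sum.inl i)) κ) w z')
    (fac (Gk (fun i => A (Sum.inr i)) κ) v z'.swap)

lemma norm_expI (t : ℝ) : ‖Complex.exp (Complex.I * (t : ℂ))‖ = 1 := by
  rw [mul_comm]; exact Complex.norm_exp_ofReal_mul_I t

lemma norm_expI_neg (t : ℝ) : ‖Complex.exp (-(Complex.I * (t : ℂ)))‖ = 1 := by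
  rw [show -(Complex.I * (t : ℂ)) = Complex.I * ((-t : ℝ) : ℂ) by push_cast; ring]
  exact norm_expI _

lemma win_support {A : II n → ℕ} {z z' : WW n} (h : win A z z' ≠ 0) :
    |ip (z'.1 - z.1, z'.2 - z.2)| ≤ n := by
  rw [win_pw] at h
  have h1 := left_ne_zero_of_mul h
  have h2 := right_ne_zero_of_mul h
  have key : ∀ (J : Fin n → ℕ) (y : EE n), pw J y ≠ 0 → ∀ i, |y i| ≤ 1 := by
    intro J y hy i
    obtain ⟨h1, h2⟩ := ψ_ne (Finset.prod_ne_zero_iff.1 hy i (Finset.mem_univ _))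
    rw [abs_of_nonneg h1]
    exact h2.le.trans (pow_le_one₀ (by norm_num) (by norm_num))
  rw [ip_sum]
  refine (Finset.abs_sum_le_sum_abs _ _).trans ?_
  refine (Finset.sum_le_card_nsmul _ _ 1 fun i _ => ?_).trans (by simp)
  rw [abs_mul]
  exact mul_le_one₀ (key _ _ h1 i) (abs_nonneg _) (key _ _ h2 i)

lemma term_norm (A : II n → ℕ) (w v : EE n → ℂ) (z' : WW n) (m : ℕ) (z : WW n) :
    ‖term A w v z' m z‖ ≤ ((n : ℝ) ^ m / (m.factorial : ℝ)) * ‖(win A z z' : ℂ) * (w z.1 * v z.2)‖ := by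
  rw [term_eq, norm_mul, norm_mul, norm_expI, one_mul, mul_comm]
  by_cases h : win A z z' = 0
  · simp [h]
  · refine mul_le_mul_of_nonneg_right ?_ (norm_nonneg _)
    rw [norm_div, norm_pow, norm_mul, Complex.norm_I, one_mul, Complex.norm_real, Complex.norm_natCast]
    gcongr
    exact win_support h

lemma hw_integrable (A : II n → ℕ) {w v : EE n → ℂ} (hw : LL w) (hv : LL v) (z' : WW n) :
    Integrable (fun z : WW n => (win A z z' : ℂ) * (w z.1 * v z.2)) := by
  have h1 : ∀ {w : EE n → ℂ} (hw : LL w) (J : Fin n → ℕ) (p : EE n),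
      Integrable (fun x => (pw J (p - x) : ℂ) * w x) := fun hw J p =>
    (win_mul (pw_meas J) (B := ∏ i, 2 ^ J i)
      (fun x => by rw [abs_of_nonneg (pw_nonneg _ _)]; exact pw_le _ _) hw.int hw.sq p).1
  have := Integrable.mul_prod (h1 hw (fun i => A (Sum.inl i)) z'.1) (h1 hv (fun i => A (Sum.inr i)) z'.2)
  refine this.congr (Filter.Eventually.of_forall fun z => ?_)
  simp only [win_pw]
  push_cast
  ring

lemma gg_enorm (A : II n → ℕ) {w v : EE n → ℂ} (hw : LL w) (hv : LL v) (z' : WW n) :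
    ‖∫ z, gg A w v z' z‖ₑ ≤ ∑' m : ℕ, ∑ κ : Fin m → Fin n, ENNReal.ofReal (1 / (m.factorial : ℝ)) *
      (‖St (Gk (fun i => A (Sum.inl i)) κ) w z'‖ₑ * ‖St (Gk (fun i => A (Sum.inr i)) κ) v z'.swap‖ₑ) := by
  have hs : Summable fun m => ∫ z, ‖term A w v z' m z‖ := by
    refine Summable.of_nonneg_of_le (fun m => integral_nonneg fun z => norm_nonneg _) (fun m => ?_)
      ((Real.summable_pow_div_factorial (n : ℝ)).mul_right
        (∫ z : WW n, ‖(win A z z' : ℂ) * (w z.1 * v z.2)‖))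
    rw [← integral_const_mul]
    exact integral_mono (term_integrable A hw hv z' m).norm ((hw_integrable A hw hv z').norm.const_mul _)
      (term_norm A w v z' m)
  have h := (hasSum_integral_of_summable_integral_norm (term_integrable A hw hv z') hs).tsum_eq
  have e : ∫ z, gg A w v z' z = ∫ z, ∑' m, term A w v z' m z :=
    integral_congr_ae (Filter.Eventually.of_forall fun z => (term_hasSum A w v z' z).tsum_eq.symm)
  rw [e, ← h]
  refine enorm_tsum_le_tsum_enorm.trans (ENNReal.tsum_le_tsum fun m => ?_)
  rw [term_integral A hw hv]
  refine (enorm_sum_le _ _).trans (Finset.sum_le_sum fun κ _ => ?_)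
  rw [enorm_mul, enorm_mul (St _ _ _)]
  refine mul_le_mul_left (le_of_eq ?_) _
  rw [← ofReal_norm, norm_mul, norm_expI_neg, one_mul, norm_div, norm_pow, Complex.norm_I, one_pow,
    Complex.norm_natCast]

lemma gg_L1 {Λ : ℝ} (hΛ : ∀ u : EE n → ℂ, Integrable u → MemLp u 2 volume →
    En volume (AF.fop ip u) ≤ ENNReal.ofReal Λ ^ 2 * En volume u)
    (A : II n → ℕ) {w v : EE n → ℂ} (hw : LL w) (hv : LL v) :
    ∫⁻ z', ‖∫ z, gg A w v z' z‖ₑ ≤ ENNReal.ofReal (Real.exp n) *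
      (ENNReal.ofReal Λ ^ 2 * RR A * (eLpNorm w 2 volume * eLpNorm v 2 volume)) := by
  refine (lintegral_mono (gg_enorm A hw hv)).trans ?_
  have hm : ∀ {w : EE n → ℂ} (hw : LL w) (J : Fin n → ℕ) {m : ℕ} (κ : Fin m → Fin n),
    Measurable (St (Gk J κ) w) := fun hw J _ κ => St_meas (Gk_meas J κ) hw.meas
  have hm2 : ∀ (m : ℕ) (κ : Fin m → Fin n), Measurable fun z' : WW n => 
      ENNReal.ofReal (1 / (m.factorial : ℝ)) *
      (‖St (Gk (fun i => A (Sum.inl i)) κ) w z'‖ₑ * ‖St (Gk (fun i => A (Sum.inr i)) κ) v z'.swap‖ₑ) :=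
    fun m κ => ((hm hw _ κ).enorm.mul ((hm hv _ κ).comp measurable_swap).enorm).const_mul _
  rw [lintegral_tsum fun m => (Finset.measurable_sum _ fun κ _ => hm2 m κ).aemeasurable]
  have hb : ∀ m : ℕ, ∫⁻ z' : WW n, ∑ κ : Fin m → Fin n, ENNReal.ofReal (1 / (m.factorial : ℝ)) *
      (‖St (Gk (fun i => A (Sum.inl i)) κ) w z'‖ₑ * ‖St (Gk (fun i => A (Sum.inr i)) κ) v z'.swap‖ₑ) ≤
      ENNReal.ofReal ((n : ℝ) ^ m / (m.factorial : ℝ)) *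
        (ENNReal.ofReal Λ ^ 2 * RR A * (eLpNorm w 2 volume * eLpNorm v 2 volume)) := by
    intro m
    rw [lintegral_finsetSum _ fun κ _ => hm2 m κ]
    have h1 : ∀ κ ∈ (Finset.univ : Finset (Fin m → Fin n)), ∫⁻ z' : WW n, ENNReal.ofReal (1 / (m.factorial : ℝ)) *
      (‖St (Gk (fun i => A (Sum.inl i)) κ) w z'‖ₑ * ‖St (Gk (fun i => A (Sum.inr i)) κ) v z'.swap‖ₑ) ≤
        ENNReal.ofReal (1 / (m.factorial : ℝ)) *
        (ENNReal.ofReal Λ ^ 2 * RR A * (eLpNorm w 2 volume * eLpNorm v 2 volume)) := by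
      intro κ _
      rw [lintegral_const_mul' _ _ (by simp)]
      gcongr
      refine (St_pair hΛ hw hv _ _ κ).trans (le_of_eq ?_)
      rw [RR_split]; ring
    refine (Finset.sum_le_card_nsmul _ _ _ h1).trans (le_of_eq ?_)
    rw [Finset.card_univ, Fintype.card_fun, Fintype.card_fin, Fintype.card_fin, nsmul_eq_mul, ← mul_assoc]
    congr 1
    rw [div_eq_mul_one_div ((n : ℝ) ^ m), ENNReal.ofReal_mul (by positivity)]
    congr 1
    rw [ENNReal.ofReal_pow (by positivity), ENNReal.ofReal_natCast]
    push_cast; rfl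
  refine (ENNReal.tsum_le_tsum hb).trans (le_of_eq ?_)
  rw [ENNReal.tsum_mul_right]
  congr 1
  rw [← ENNReal.ofReal_tsum_of_nonneg (fun m => by positivity) (Real.summable_pow_div_factorial _)]
  congr 1
  have := (NormedSpace.expSeries_div_hasSum_exp (𝔸 := ℝ) (n : ℝ)).tsum_eq
  rw [this, Real.exp_eq_exp_ℝ]

end Childs

namespace Childs
variable {n : ℕ}

lemma wv_integrable {w v : EE n → ℂ} (hw : LL w) (hv : LL v) :
    Integrable (fun z : WW n => w z.1 * v z.2) := Integrable.mul_prod hw.int hv.int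

lemma win_joint (A : II n → ℕ) : Measurable (fun zz : WW n × WW n => win A zz.1 zz.2) := by
  have h1 := pw_meas (fun i => A (Sum.inl i))
  have h2 := pw_meas (fun i => A (Sum.inr i))
  simp only [win_pw]
  fun_prop

lemma dom_integrable (A : II n → ℕ) {w v : EE n → ℂ} (hw : LL w) (hv : LL v) :
    Integrable (fun zz : WW n × WW n => (win A zz.1 zz.2 : ℂ) * (w zz.1.1 * v zz.1.2))
      ((volume : Measure (WW n)).prod volume) := by
  have h1 := win_joint A
  have h2 := hw.meas
  have h3 := hv.meas
  have hm : Measurable (fun zz : WW n × WW n => (win A zz.1 zz.2 : ℂ) * (w zz.1.1 * v zz.1.2)) := by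
    fun_prop
  rw [integrable_prod_iff hm.aestronglyMeasurable]
  have hz : ∀ z : WW n, Integrable (fun z' : WW n => (win A z z' : ℂ) * (w z.1 * v z.2)) := fun z =>
    Integrable.mul_const ((win_integrable A z).ofReal (𝕜 := ℂ)) (w z.1 * v z.2)
  have he : ∀ z : WW n, ∫ z' : WW n, ‖(win A z z' : ℂ) * (w z.1 * v z.2)‖ = ‖w z.1 * v z.2‖ := by
    intro z
    have e1 : ∀ z' : WW n, ‖(win A z z' : ℂ) * (w z.1 * v z.2)‖ = win A z z' * ‖w z.1 * v z.2‖ := by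
      intro z'
      rw [norm_mul, Complex.norm_real, Real.norm_of_nonneg (win_nonneg _ _ _)]
    simp_rw [e1]
    rw [integral_mul_const, win_integral, one_mul]
  refine ⟨Filter.Eventually.of_forall hz, ?_⟩
  simp_rw [he]
  exact (wv_integrable hw hv).norm

lemma full_integrable (A : II n → ℕ) {w v : EE n → ℂ} (hw : LL w) (hv : LL v) {b : WW n → ℂ} (hb : Good b) :
    Integrable (fun zz : WW n × WW n => b zz.2 * gg A w v zz.2 zz.1)
      ((volume : Measure (WW n)).prod volume) := by
  obtain ⟨hc, M, hM⟩ := hb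
  have hip := ip_cont (n := n)
  have := (dom_integrable A hw hv).bdd_mul (c := M)
    (f := fun zz : WW n × WW n => b zz.2 * Complex.exp (Complex.I * (ip zz.1 : ℂ)))
    (by
      apply Continuous.aestronglyMeasurable
      fun_prop) (Filter.Eventually.of_forall fun zz => by
        rw [norm_mul, norm_expI, mul_one]; exact hM _)
  refine this.congr (Filter.Eventually.of_forall fun zz => ?_)
  simp only [gg]
  ring

/-- the quadratic form -/
def QF (a : WW n → ℂ) (w v : EE n → ℂ) : ℂ :=
  ∫ z, Complex.exp (Complex.I * (ip z : ℂ)) * (a z * (w z.1 * v z.2))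

/-- smoothing -/
def Sm (A : II n → ℕ) (b : WW n → ℂ) (z : WW n) : ℂ := ∫ z', b z' * (win A z z' : ℂ)

lemma Sm_eq (A : II n → ℕ) (w v : EE n → ℂ) (b : WW n → ℂ) (z : WW n) :
    Complex.exp (Complex.I * (ip z : ℂ)) * (Sm A b z * (w z.1 * v z.2)) =
      ∫ z', b z' * gg A w v z' z := by
  unfold Sm gg
  rw [← integral_mul_const, ← integral_const_mul]
  refine integral_congr_ae (Filter.Eventually.of_forall fun z' => ?_)
  simp only []
  ring

lemma Sm_integrable (A : II n → ℕ) {w v : EE n → ℂ} (hw : LL w) (hv : LL v) {b : WW n → ℂ} (hb : Good b) :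
    Integrable (fun z => Complex.exp (Complex.I * (ip z : ℂ)) * (Sm A b z * (w z.1 * v z.2))) := by
  simp_rw [Sm_eq]
  exact (full_integrable A hw hv hb).integral_prod_left

/-- the block constant -/
def KB (n : ℕ) (Λ : ℝ) (w v : EE n → ℂ) : ℝ≥0∞ :=
  ENNReal.ofReal (Real.exp n) * ENNReal.ofReal Λ ^ 2 * (eLpNorm w 2 volume * eLpNorm v 2 volume)

lemma form_block {Λ : ℝ} (hΛ : ∀ u : EE n → ℂ, Integrable u → MemLp u 2 volume →
    En volume (AF.fop ip u) ≤ ENNReal.ofReal Λ ^ 2 * En volume u)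
    (A : II n → ℕ) {w v : EE n → ℂ} (hw : LL w) (hv : LL v) {b : WW n → ℂ} (hb : Good b)
    {M : ℝ} (hM : ∀ z, ‖b z‖ ≤ M) :
    ‖QF (Sm A b) w v‖ₑ ≤ KB n Λ w v * (ENNReal.ofReal M * RR A) := by
  unfold QF
  simp_rw [Sm_eq]
  rw [integral_integral_swap (full_integrable A hw hv hb)]
  simp_rw [integral_const_mul]
  refine (enorm_integral_le_lintegral_enorm _).trans ?_
  have h1 : ∀ z', ‖b z' * ∫ z, gg A w v z' z‖ₑ ≤ ENNReal.ofReal M * ‖∫ z, gg A w v z' z‖ₑ := by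
    intro z'
    rw [enorm_mul, ← ofReal_norm (b z')]
    gcongr
    exact hM z'
  refine (lintegral_mono h1).trans ?_
  rw [lintegral_const_mul' _ _ (by simp)]
  refine (mul_le_mul_right (gg_L1 hΛ A hw hv) _).trans (le_of_eq ?_)
  unfold KB
  ring

lemma form_sum {Λ : ℝ} (hΛ : ∀ u : EE n → ℂ, Integrable u → MemLp u 2 volume →
    En volume (AF.fop ip u) ≤ ENNReal.ofReal Λ ^ 2 * En volume u)
    {lam C₁ : ℝ} (hlam : 1 / 2 < lam) (hC₁ : 0 < C₁)
    {w v : EE n → ℂ} (hw : LL w) (hv : LL v) {a : WW n → ℂ} (ha : Good a) (h : Amp lam C₁ a) (N : ℕ) :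
    ‖QF (Sm (fun _ => N) a) w v‖ₑ ≤ KB n Λ w v *
      ENNReal.ofReal (C₁ * ∏ _i : II n, (1 - √2 * (1/2 : ℝ) ^ lam)⁻¹) := by
  set s : ℝ := √2 * (1/2 : ℝ) ^ lam with hs
  have hs0 : 0 ≤ s := by positivity
  have hs1 : s < 1 := by
    have e : √2 = ((1/2 : ℝ) ^ (1/2 : ℝ))⁻¹ := by
      rw [← Real.inv_rpow (by norm_num), Real.sqrt_eq_rpow]; norm_num
    rw [hs, e, inv_mul_lt_iff₀ (by positivity), mul_one]
    exact Real.rpow_lt_rpow_of_exponent_gt (by norm_num) (by norm_num) hlam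
  have e1 : ∀ z, Sm (fun _ => N) a z =
      ∑ A ∈ Fintype.piFinset (fun _ : II n => Finset.range (N+1)), Sm A (bA a A) z := fun z => decomp ha N z
  have e2 : QF (Sm (fun _ => N) a) w v =
      ∑ A ∈ Fintype.piFinset (fun _ : II n => Finset.range (N+1)), QF (Sm A (bA a A)) w v := by
    unfold QF
    rw [← integral_finsetSum _ fun A _ => Sm_integrable A hw hv (bA_cont ha A)]
    refine integral_congr_ae (Filter.Eventually.of_forall fun z => ?_)
    simp only []
    rw [e1, Finset.sum_mul, Finset.mul_sum]
  rw [e2]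
  refine (enorm_sum_le _ _).trans ?_
  have hb : ∀ A ∈ Fintype.piFinset (fun _ : II n => Finset.range (N+1)), ‖QF (Sm A (bA a A)) w v‖ₑ ≤
      KB n Λ w v * ENNReal.ofReal (C₁ * ∏ i, s ^ A i) := by
    intro A _
    refine (form_block hΛ A hw hv (bA_cont ha A) (bA_bound h A)).trans (le_of_eq ?_)
    congr 1
    unfold RR
    rw [← ENNReal.ofReal_mul (by positivity), mul_assoc, ← Finset.prod_mul_distrib]
    congr 2
    refine Finset.prod_congr rfl fun i _ => ?_
    rw [hs, mul_pow, mul_comm]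
  refine (Finset.sum_le_sum hb).trans ?_
  rw [← Finset.mul_sum, ← ENNReal.ofReal_sum_of_nonneg fun A _ => by positivity, ← Finset.mul_sum]
  gcongr
  rw [← Finset.prod_univ_sum (fun _ : II n => Finset.range (N+1)) (fun _ j => s ^ j)]
  refine Finset.prod_le_prod (fun i _ => by positivity) fun i _ => ?_
  rw [← tsum_geometric_of_lt_one hs0 hs1]
  exact (summable_geometric_of_lt_one hs0 hs1).sum_le_tsum _ fun j _ => by positivity

theorem form (n : ℕ) {lam C₁ : ℝ} (hlam : 1 / 2 < lam) (hC₁ : 0 < C₁) :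
    ∃ C : ℝ, 0 ≤ C ∧ ∀ (a : WW n → ℂ), Continuous a → Amp lam C₁ a → ∀ w v : EE n → ℂ, LL w → LL v →
      ‖QF a w v‖ₑ ≤ ENNReal.ofReal C * (eLpNorm w 2 volume * eLpNorm v 2 volume) := by
  obtain ⟨Λ, hΛ0, hΛ⟩ := four n
  refine ⟨Real.exp n * Λ ^ 2 * |C₁ * ∏ _i : II n, (1 - √2 * (1/2 : ℝ) ^ lam)⁻¹|, by positivity, ?_⟩
  intro a hac h w v hw hv
  have ha : Good a := ⟨hac, C₁, h.bound⟩
  have hlim : Filter.Tendsto (fun N => QF (Sm (fun _ => N) a) w v) Filter.atTop (nhds (QF a w v)) := by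
    unfold QF
    refine tendsto_integral_of_dominated_convergence (fun z => C₁ * ‖w z.1 * v z.2‖)
      (fun N => (Sm_integrable _ hw hv ha).aestronglyMeasurable) ((wv_integrable hw hv).norm.const_mul _)
      (fun N => Filter.Eventually.of_forall fun z => ?_) (Filter.Eventually.of_forall fun z => ?_)
    · rw [norm_mul, norm_expI, one_mul, norm_mul]
      exact mul_le_mul_of_nonneg_right (smooth_bound h.bound _ z) (norm_nonneg _)
    · exact ((smooth_tendsto ha z).mul_const _).const_mul _
  refine le_of_tendsto hlim.enorm (Filter.Eventually.of_forall fun N => ?_)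
  refine (form_sum hΛ hlam hC₁ hw hv ha h N).trans ?_
  unfold KB
  rw [ENNReal.ofReal_mul (p := Real.exp n * Λ ^ 2) (by positivity),
    ENNReal.ofReal_mul (p := Real.exp n) (by positivity), ENNReal.ofReal_pow hΛ0]
  have : ENNReal.ofReal (C₁ * ∏ _i : II n, (1 - √2 * (1/2 : ℝ) ^ lam)⁻¹) ≤
    ENNReal.ofReal |C₁ * ∏ _i : II n, (1 - √2 * (1/2 : ℝ) ^ lam)⁻¹| := ENNReal.ofReal_le_ofReal (le_abs_self _)
  refine (mul_le_mul_right this _).trans (le_of_eq ?_)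
  ring

end Childs

namespace Childs
variable {n : ℕ}

lemma LL_indicator {f : EE n → ℂ} (hf : Measurable f) {M : ℝ} (hM : ∀ x, ‖f x‖ ≤ M) {K : Set (EE n)}
    (hK : MeasurableSet K) (hfin : volume K < ∞) : LL (K.indicator f) := by
  have : IsFiniteMeasure (volume.restrict K : Measure (EE n)) := ⟨by simpa using hfin⟩
  have h : ∀ p : ℝ≥0∞, MemLp (K.indicator f) p volume := fun p => by
    rw [memLp_indicator_iff_restrict hK]
    exact MemLp.of_bound hf.aestronglyMeasurable M (Filter.Eventually.of_forall hM)
  exact ⟨hf.indicator hK, memLp_one_iff_integrable.1 (h 1), h 2⟩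

/-- operator with amplitude `a` -/
def Op (a : WW n → ℂ) (v : EE n → ℂ) (x : EE n) : ℂ :=
  ∫ ξ, Complex.exp (Complex.I * (ip (x, ξ) : ℂ)) * (a (x, ξ) * v ξ)

lemma Op_meas {a : WW n → ℂ} (ha : Continuous a) {v : EE n → ℂ} (hv : Measurable v) : Measurable (Op a v) := by
  unfold Op
  apply StronglyMeasurable.measurable
  apply StronglyMeasurable.integral_prod_right
  apply Measurable.stronglyMeasurable
  have h1 := (ip_cont (n := n)).measurable
  have h2 := ha.measurable
  unfold Function.uncurry
  fun_prop

lemma Op_bound {a : WW n → ℂ} {C₁ : ℝ} (hb : ∀ z, ‖a z‖ ≤ C₁) {v : EE n → ℂ} (hv : Integrable v) (x : EE n) :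
    ‖Op a v x‖ ≤ ∫ ξ, C₁ * ‖v ξ‖ := by
  unfold Op
  refine norm_integral_le_of_norm_le (hv.norm.const_mul C₁) (Filter.Eventually.of_forall fun ξ => ?_)
  rw [norm_mul, norm_expI, one_mul, norm_mul]
  exact mul_le_mul_of_nonneg_right (hb _) (norm_nonneg _)

lemma QF_Op {a : WW n → ℂ} (ha : Continuous a) {C₁ : ℝ} (hb : ∀ z, ‖a z‖ ≤ C₁) {w v : EE n → ℂ}
    (hw : LL w) (hv : LL v) : QF a w v = ∫ x, w x * Op a v x := by
  have hip := ip_cont (n := n)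
  have hi : Integrable (fun z : WW n => Complex.exp (Complex.I * (ip z : ℂ)) * (a z * (w z.1 * v z.2)))
      ((volume : Measure (EE n)).prod volume) := by
    have := (wv_integrable hw hv).bdd_mul (c := C₁)
      (f := fun z : WW n => Complex.exp (Complex.I * (ip z : ℂ)) * a z)
      (by apply Continuous.aestronglyMeasurable; fun_prop) (Filter.Eventually.of_forall fun z => by
        rw [norm_mul, norm_expI, one_mul]; exact hb _)
    refine this.congr (Filter.Eventually.of_forall fun z => ?_)
    simp only []
    ring
  have h := integral_prod _ hi
  refine h.trans (integral_congr_ae (Filter.Eventually.of_forall fun x => ?_))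
  simp only [Op]
  rw [← integral_const_mul]
  refine integral_congr_ae (Filter.Eventually.of_forall fun ξ => ?_)
  simp only []
  ring

theorem Op_L2 {a : WW n → ℂ} (ha : Continuous a) {C₁ : ℝ} (hb : ∀ z, ‖a z‖ ≤ C₁) {C : ℝ}
    (hC : ∀ w v : EE n → ℂ, LL w → LL v →
      ‖QF a w v‖ₑ ≤ ENNReal.ofReal C * (eLpNorm w 2 volume * eLpNorm v 2 volume))
    {v : EE n → ℂ} (hv : LL v) :
    eLpNorm (Op a v) 2 volume ≤ ENNReal.ofReal C * eLpNorm v 2 volume := by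
  have hFm : Measurable (Op a v) := Op_meas ha hv.meas
  have hFb := Op_bound hb hv.int
  have hcov : AECover (volume : Measure (EE n)) Filter.atTop (fun N : ℕ => Metric.closedBall (0 : EE n) (N : ℝ)) :=
    aecover_closedBall tendsto_natCast_atTop_atTop
  have ht := hcov.lintegral_tendsto_of_nat (f := fun x => ‖Op a v x‖ₑ ^ 2) (hFm.enorm.pow_const 2).aemeasurable
  have hbd : ∀ N : ℕ, ∫⁻ x in Metric.closedBall (0 : EE n) (N : ℝ), ‖Op a v x‖ₑ ^ 2 ≤
      (ENNReal.ofReal C * eLpNorm v 2 volume) ^ 2 := by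
    intro N
    set S := Metric.closedBall (0 : EE n) (N : ℝ)
    have hS : MeasurableSet S := Metric.isClosed_closedBall.measurableSet
    have hcm : Measurable (fun x => starRingEnd ℂ (Op a v x)) := Complex.continuous_conj.measurable.comp hFm
    set w : EE n → ℂ := S.indicator (fun x => starRingEnd ℂ (Op a v x)) with hwdef
    have hw : LL w := LL_indicator hcm (fun x => by rw [RCLike.norm_conj]; exact hFb x) hS measure_closedBall_lt_top
    have e0 : ∀ x, ‖w x‖ₑ ^ 2 = S.indicator (fun x => ‖Op a v x‖ₑ ^ 2) x := by
      intro x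
      by_cases hx : x ∈ S
      · simp only [hwdef, Set.indicator_of_mem hx]
        rw [← ofReal_norm, RCLike.norm_conj, ofReal_norm]
      · simp [hwdef, Set.indicator_of_notMem hx]
    have e1 : ∫⁻ x in S, ‖Op a v x‖ₑ ^ 2 = eLpNorm w 2 volume ^ 2 := by
      rw [eLp_sq, En]
      simp_rw [e0]
      rw [lintegral_indicator hS]
    have e2 : ∀ x, w x * Op a v x = ((‖w x‖ ^ 2 : ℝ) : ℂ) := by
      intro x
      by_cases hx : x ∈ S
      · simp only [hwdef, Set.indicator_of_mem hx]
        rw [RCLike.norm_conj, mul_comm, Complex.mul_conj, Complex.normSq_eq_norm_sq]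
      · simp [hwdef, Set.indicator_of_notMem hx]
    have e3 : ‖QF a w v‖ₑ = eLpNorm w 2 volume ^ 2 := by
      rw [QF_Op ha hb hw hv]
      simp_rw [e2]
      rw [integral_complex_ofReal, ← ofReal_norm, Complex.norm_real,
        Real.norm_of_nonneg (integral_nonneg fun x => sq_nonneg _), eLp_sq, En,
        ofReal_integral_eq_lintegral_ofReal ((memLp_two_iff_integrable_sq_norm hw.sq.1).1 hw.sq) (Filter.Eventually.of_forall fun x => sq_nonneg _)]
      refine lintegral_congr fun x => ?_
      rw [ENNReal.ofReal_pow (norm_nonneg _), ofReal_norm]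
    rw [e1]
    have h := hC w v hw hv
    rw [e3] at h
    gcongr
    by_cases h0 : eLpNorm w 2 volume = 0
    · rw [h0]; exact zero_le
    have htop : eLpNorm w 2 volume ≠ ∞ := hw.sq.2.ne
    have h' : eLpNorm w 2 volume * eLpNorm w 2 volume ≤
        eLpNorm w 2 volume * (ENNReal.ofReal C * eLpNorm v 2 volume) := by
      calc _ = eLpNorm w 2 volume ^ 2 := by ring
        _ ≤ _ := h
        _ = _ := by ring
    exact (ENNReal.mul_le_mul_iff_right h0 htop).1 h'
  have hE : eLpNorm (Op a v) 2 volume ^ 2 ≤ (ENNReal.ofReal C * eLpNorm v 2 volume) ^ 2 := by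
    rw [eLp_sq]
    exact le_of_tendsto ht (Filter.Eventually.of_forall hbd)
  exact (ENNReal.pow_right_strictMono two_ne_zero).le_iff_le.1 hE

end Childs

theorem main_aux (n : ℕ) (C₀ : ℝ) (hC₀ : 0 < C₀) (Cph : (Fin n → ℕ) → ℝ)
    (lam C₁ : ℝ) (hlam : 1 / 2 < lam) (hC₁ : 0 < C₁) :
    ∃ C : ℝ, 0 < C ∧
      ∀ (φ : EE n × EE n → ℝ) (a : EE n × EE n → ℂ) (K : Set (EE n)), IsCompact K →
        Phase.Hyp n C₀ Cph φ → Continuous a → (∀ x ξ, ξ ∉ K → a (x, ξ) = 0) →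
        Childs.Amp lam C₁ a →
        ∀ u : EE n → ℂ, Continuous u → Integrable u → MemLp u 2 volume →
          eLpNorm (fun x => ∫ ξ, ∫ y,
              Complex.exp (Complex.I * ((⟪x, ξ⟫ + φ (y, ξ) : ℝ) : ℂ)) * a (x, ξ) * u y)
              2 volume
            ≤ ENNReal.ofReal C * eLpNorm u 2 volume := by
  obtain ⟨Λ, hΛ0, hΛ⟩ := AF.part1 n C₀ hC₀ Cph
  obtain ⟨C, hC0, hC⟩ := Childs.form n hlam hC₁
  refine ⟨C * Λ + 1, by positivity, ?_⟩
  intro φ a K hK hφ ha hvan hamp u huc hu hu2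
  have hφc := hφ.smooth.continuous
  have hfm : Measurable (AF.fop φ u) := by
    have : AF.fop φ u = fun ξ => ∫ y, Complex.exp (Complex.I * (φ (y, ξ) : ℂ)) * u y := rfl
    rw [this]
    apply StronglyMeasurable.measurable
    apply StronglyMeasurable.integral_prod_right
    apply Continuous.stronglyMeasurable
    unfold Function.uncurry
    fun_prop
  have hfb : ∀ ξ, ‖AF.fop φ u ξ‖ ≤ ∫ y, ‖u y‖ := by
    intro ξ
    refine norm_integral_le_of_norm_le hu.norm (Filter.Eventually.of_forall fun y => ?_)
    change ‖Complex.exp (Complex.I * (φ (y, ξ) : ℂ)) * u y‖ ≤ _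
    rw [norm_mul, Childs.norm_expI, one_mul]
  have hV : Childs.LL (K.indicator (AF.fop φ u)) :=
    Childs.LL_indicator hfm hfb hK.measurableSet hK.measure_lt_top
  have e : (fun x : EE n => ∫ ξ, ∫ y,
      Complex.exp (Complex.I * ((⟪x, ξ⟫ + φ (y, ξ) : ℝ) : ℂ)) * a (x, ξ) * u y) =
      Childs.Op a (K.indicator (AF.fop φ u)) := by
    funext x
    unfold Childs.Op
    refine integral_congr_ae (Filter.Eventually.of_forall fun ξ => ?_)
    simp only []
    by_cases hξ : ξ ∈ K
    · rw [Set.indicator_of_mem hξ]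
      have : AF.fop φ u ξ = ∫ y, Complex.exp (Complex.I * (φ (y, ξ) : ℂ)) * u y := rfl
      rw [this, ← integral_const_mul, ← integral_const_mul]
      refine integral_congr_ae (Filter.Eventually.of_forall fun y => ?_)
      simp only [Childs.ip]
      push_cast
      rw [mul_add, Complex.exp_add]
      ring
    · simp [hvan x ξ hξ]
  rw [e]
  refine (Childs.Op_L2 ha hamp.bound (fun w v hw hv => hC a ha hamp w v hw hv) hV).trans ?_
  have h1 : eLpNorm (K.indicator (AF.fop φ u)) 2 volume ≤ ENNReal.ofReal Λ * eLpNorm u 2 volume :=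
    (eLpNorm_indicator_le _).trans (hΛ φ hφ u hu hu2)
  refine (mul_le_mul_right h1 _).trans ?_
  rw [← mul_assoc, ← ENNReal.ofReal_mul hC0]
  gcongr
  linarith

/-- `L²`-boundedness of `Tu(x) = ∫∫ e^{i(x·ξ+φ(y,ξ))} a(x,ξ) u(y) dy dξ`
for continuous amplitudes satisfying Childs-type finite-difference conditions of Hölder
order `λ > 1/2`, with constant depending only on `n`, `λ`, `C₁`, `C₀` and the phase
constants, independent of the compact set `K`. -/
theorem statement7 (n : ℕ) (C₀ : ℝ) (hC₀ : 0 < C₀) (Cph : (Fin n → ℕ) → ℝ)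
    (lam C₁ : ℝ) (hlam : 1 / 2 < lam) (hC₁ : 0 < C₁) :
    ∃ C : ℝ, 0 < C ∧
      ∀ (φ : EuclideanSpace ℝ (Fin n) × EuclideanSpace ℝ (Fin n) → ℝ)
        (a : EuclideanSpace ℝ (Fin n) × EuclideanSpace ℝ (Fin n) → ℂ)
        (K : Set (EuclideanSpace ℝ (Fin n))), IsCompact K →
        ContDiff ℝ (⊤ : ℕ∞) φ →
        -- nondegeneracy of the mixed Hessian `∂_y∂_ξ φ`:
        (∀ z, C₀ ≤ |Matrix.det (Matrix.of fun i j => mixedHessXY φ i j z)|) →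
        -- bounded derivatives of the entries of `∂_y∂_ξ φ`:
        (∀ i j : Fin n, ∀ α : Fin n → ℕ, mdeg α ≤ 2 * n + 1 →
          (∀ z, |mderiv dX α (mixedHessXY φ i j) z| ≤ Cph α) ∧
          (∀ z, |mderiv dY α (mixedHessXY φ i j) z| ≤ Cph α)) →
        -- `a` is continuous and vanishes for `ξ` outside the compact set `K`:
        Continuous a →
        (∀ x ξ, ξ ∉ K → a (x, ξ) = 0) →
        -- the finite-difference (Hölder) condition of order `λ`:
        (∀ α β : Fin n → ℕ, (∀ i, α i ≤ 1) → (∀ i, β i ≤ 1) →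
          ∀ h h' : Fin n → ℝ, ∀ z,
            ‖mdiff dX α h (mdiff dY β h' a) z‖ ≤
              C₁ * (∏ i, |h i| ^ ((α i : ℝ) * lam)) * ∏ j, |h' j| ^ ((β j : ℝ) * lam)) →
        ∀ u : 𝓢(EuclideanSpace ℝ (Fin n), ℂ),
          eLpNorm (fun x => ∫ ξ, ∫ y,
              Complex.exp (Complex.I * ((⟪x, ξ⟫ + φ (y, ξ) : ℝ) : ℂ)) * a (x, ξ) * u y)
              2 volume
            ≤ ENNReal.ofReal C * eLpNorm (⇑u) 2 volume := by
  obtain ⟨C, hC, h⟩ := main_aux n C₀ hC₀ Cph lam C₁ hlam hC₁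
  refine ⟨C, hC, ?_⟩
  intro φ a K hK hs hd hb ha hv hamp u
  exact h φ a K hK ⟨hs, hd, hb⟩ ha hv hamp u u.continuous u.integrable (u.memLp 2 volume)
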